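/- (Schauder existence theorem) Let Ω ⊆ ℝⁿ be a bounded domain whose boundary is of class C^{2,α} for some 0 < α < 1. Suppose a_{ij}, b_i, c, f ∈ C^{0,α}(Ω̄), the matrix (a_{ij}(x)) satisfies Σ a_{ij}(x)ξ_iξ_j ≥ λ|ξ|² for all x ∈ Ω, ξ ∈ ℝⁿ (λ > 0), the b_i are bounded, and c ≤ 0 on Ω. Then for every φ ∈ C^{2,α}(Ω̄) there exists a unique u ∈ C^{2,α}(Ω̄) solving the boundary value problem Lu = Σ_{i,j} a_{ij} ∂_{ij}u + Σ_i b_i ∂_i u + c·u = f in Ω and u = φ on ∂Ω. -/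

import Mathlib

open scoped BigOperators

/-- A function `f` is uniformly `α`-Hölder continuous on `s` with constant `M`. -/
def HolderOnWith' {E F : Type*} [NormedAddCommGroup E] [NormedAddCommGroup F]
    (α : ℝ) (s : Set E) (f : E → F) (M : ℝ) : Prop :=
  ∀ x ∈ s, ∀ y ∈ s, ‖f x - f y‖ ≤ M * dist x y ^ α

/-- The Hölder seminorm `[f]_{α;s} = sup_{x ≠ y ∈ s} ‖f x − f y‖ / d(x,y)^α`. -/
noncomputable def holderSeminorm {E F : Type*} [NormedAddCommGroup E] [NormedAddCommGroup F]
    (α : ℝ) (s : Set E) (f : E → F) : ℝ :=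
  sSup ((fun p : E × E => ‖f p.1 - f p.2‖ / dist p.1 p.2 ^ α) '' (s ×ˢ s))

/-- Membership in the Hölder space `C^{k,α}(s)`: all derivatives up to order `k` exist and are
continuous on `s`, and the `k`-th order derivative is uniformly `α`-Hölder continuous on `s`. -/
def MemCkα {E : Type*} [NormedAddCommGroup E] [NormedSpace ℝ E] {F : Type*}
    [NormedAddCommGroup F] [NormedSpace ℝ F]
    (k : ℕ) (α : ℝ) (s : Set E) (f : E → F) : Prop :=
  ContDiffOn ℝ k f s ∧ ∃ M : ℝ, HolderOnWith' α s (iteratedFDerivWithin ℝ k f s) M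

/-- The Hölder norm `‖f‖_{C^{k,α}(s)} = Σ_{j≤k} sup_s ‖D^j f‖ + [D^k f]_{α;s}`. -/
noncomputable def holderNorm {E : Type*} [NormedAddCommGroup E] [NormedSpace ℝ E] {F : Type*}
    [NormedAddCommGroup F] [NormedSpace ℝ F]
    (k : ℕ) (α : ℝ) (s : Set E) (f : E → F) : ℝ :=
  (∑ j ∈ Finset.range (k + 1), sSup ((fun x => ‖iteratedFDerivWithin ℝ j f s x‖) '' s))
    + holderSeminorm α s (iteratedFDerivWithin ℝ k f s)

/-- A bounded domain `Ω ⊆ ℝⁿ` and its boundary are of class `C^{2,α}`: every boundary point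
has a neighbourhood `B` and a one-to-one map `ψ : B → D` straightening the boundary
(`ψ(B ∩ Ω) ⊆ ℝⁿ₊`, `ψ(B ∩ ∂Ω) ⊆ ∂ℝⁿ₊`) with `ψ ∈ C^{2,α}(B)` and `ψ⁻¹ ∈ C^{2,α}(D)`. -/
def IsC2αDomain {n : ℕ} [NeZero n] (α : ℝ) (Ω : Set (EuclideanSpace ℝ (Fin n))) : Prop :=
  Bornology.IsBounded Ω ∧
    ∀ x₀ ∈ frontier Ω,
      ∃ (B D : Set (EuclideanSpace ℝ (Fin n)))
        (ψ ψinv : EuclideanSpace ℝ (Fin n) → EuclideanSpace ℝ (Fin n)),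
        IsOpen B ∧ x₀ ∈ B ∧ Set.BijOn ψ B D ∧ Set.InvOn ψinv ψ B D ∧
        ψ '' (B ∩ Ω) ⊆ {x | 0 < x 0} ∧
        ψ '' (B ∩ frontier Ω) ⊆ {x | x 0 = 0} ∧
        MemCkα 2 α B ψ ∧ MemCkα 2 α D ψinv

/-- First partial derivative `∂ᵢ u (x)`. -/
noncomputable def partialDeriv1 {n : ℕ} (u : EuclideanSpace ℝ (Fin n) → ℝ)
    (x : EuclideanSpace ℝ (Fin n)) (i : Fin n) : ℝ :=
  fderiv ℝ u x (EuclideanSpace.single i 1)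

/-- Second partial derivative `∂ᵢⱼ u (x)`. -/
noncomputable def partialDeriv2 {n : ℕ} (u : EuclideanSpace ℝ (Fin n) → ℝ)
    (x : EuclideanSpace ℝ (Fin n)) (i j : Fin n) : ℝ :=
  fderiv ℝ (fun y => fderiv ℝ u y (EuclideanSpace.single j 1)) x (EuclideanSpace.single i 1)

namespace Schauder

open MeasureTheory Filter Topology SchwartzMap Set

section Mollification

set_option linter.unusedSectionVars false
set_option synthInstance.maxHeartbeats 200000

variable {E : Type} [NormedAddCommGroup E] [NormedSpace ℝ E] [FiniteDimensional ℝ E]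
  [MeasureSpace E] [BorelSpace E] [(volume : Measure E).IsAddHaarMeasure]
  {G : Type} [NormedAddCommGroup G] [NormedSpace ℝ G]

/-- The dilated average `∫ F (x + s y) ρ(y) dy` of `F` with (vector valued) weight `ρ`. -/
noncomputable def dilAvg (ρ : E → G) (F : E → ℝ) (x : E) (s : ℝ) : G :=
  ∫ y, F (x + s • y) • ρ y

theorem schwartz_bound (ρ : 𝓢(E, G)) (k : ℕ) :
    ∃ C : ℝ, 0 ≤ C ∧ ∀ y, (1 + ‖y‖) ^ k * ‖ρ y‖ ≤ C := by
  refine ⟨2 ^ k * ((Finset.Iic (k, 0)).sup fun m => SchwartzMap.seminorm ℝ m.1 m.2) ρ,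
    by positivity, fun y => ?_⟩
  have := SchwartzMap.one_add_le_sup_seminorm_apply (𝕜 := ℝ) (m := (k, 0)) le_rfl le_rfl ρ y
  simpa using this

/-- The weight `d ρ(y) + Dρ(y) y` arising from differentiation of `dilAvg` in the scale. -/
noncomputable def eulerWeight (ρ : 𝓢(E, G)) : 𝓢(E, G) :=
  (Module.finrank ℝ E : ℝ) • ρ +
    SchwartzMap.bilinLeftCLM (𝕜 := ℝ) (ContinuousLinearMap.id ℝ (E →L[ℝ] G))
      (g := fun y : E => y) (by fun_prop) (SchwartzMap.fderivCLM ℝ E G ρ)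

theorem eulerWeight_apply (ρ : 𝓢(E, G)) (y : E) :
    eulerWeight ρ y = (Module.finrank ℝ E : ℝ) • ρ y + fderiv ℝ ρ y y := rfl

theorem integrable_smul_schwartz {F : E → ℝ} (hF : Continuous F) {M : ℝ} (hM : ∀ x, |F x| ≤ M)
    (ρ : 𝓢(E, G)) : Integrable (fun y => F y • ρ y) :=
  ρ.integrable.bdd_smul M hF.aestronglyMeasurable (Eventually.of_forall hM)

theorem integral_rescale (f : E → G) (x : E) (s : ℝ) :
    ∫ z, f (s⁻¹ • (z - x)) = |s ^ Module.finrank ℝ E| • ∫ y, f y := by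
  rw [integral_sub_right_eq_self (fun z => f (s⁻¹ • z)) x, Measure.integral_comp_smul]
  simp [abs_pow]

theorem dilAvg_eq (ρ : E → G) (F : E → ℝ) (x : E) {s : ℝ} (hs : s ≠ 0) :
    ∫ z, F z • ρ (s⁻¹ • (z - x)) = |s ^ Module.finrank ℝ E| • dilAvg ρ F x s := by
  rw [dilAvg, ← integral_rescale (fun y => F (x + s • y) • ρ y) x s]
  congr 1; ext z
  rw [smul_inv_smul₀ hs]; simp

theorem integral_kernel_hasFDerivAt {F : E → ℝ} (hF : Continuous F) {M : ℝ}
    (hM : ∀ x, |F x| ≤ M) (ρ : 𝓢(E, G)) (x : E) {s : ℝ} (hs : s ≠ 0) :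
    HasFDerivAt (fun p : E × ℝ => ∫ z, F z • ρ (p.2⁻¹ • (z - p.1)))
      (∫ z, F z • ((fderiv ℝ ρ (s⁻¹ • (z - x))).comp
        (((-s⁻¹) • (ContinuousLinearMap.fst ℝ E ℝ +
          (ContinuousLinearMap.snd ℝ E ℝ).smulRight (s⁻¹ • (z - x))))))) (x, s) := by
  have hs0 : 0 < |s| := abs_pos.2 hs
  have hM0 : 0 ≤ M := (abs_nonneg _).trans (hM 0)
  set N := Module.finrank ℝ E + 1 with hN
  obtain ⟨C, hC0, hC⟩ := schwartz_bound (SchwartzMap.fderivCLM ℝ E G ρ) (N + 1)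
  have hball : ∀ p ∈ Metric.ball (x, s) (|s| / 2), dist p.1 x < |s| / 2 ∧ |p.2 - s| < |s| / 2 := by
    intro p hp
    rw [Metric.mem_ball, Prod.dist_eq, max_lt_iff] at hp
    simpa [Real.dist_eq] using hp
  have hp2 : ∀ p ∈ Metric.ball (x, s) (|s| / 2), |s| / 2 ≤ |p.2| ∧ |p.2| ≤ 2 * |s| := by
    intro p hp
    have h := (hball p hp).2
    have h1 := abs_sub_abs_le_abs_sub s p.2
    have h2 := abs_sub_abs_le_abs_sub p.2 s
    rw [abs_sub_comm] at h1
    constructor <;> linarith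
  refine hasFDerivAt_integral_of_dominated_of_fderiv_le
    (F' := fun p z => F z • ((fderiv ℝ ρ (p.2⁻¹ • (z - p.1))).comp
        (((-p.2⁻¹) • (ContinuousLinearMap.fst ℝ E ℝ +
          (ContinuousLinearMap.snd ℝ E ℝ).smulRight (p.2⁻¹ • (z - p.1)))))))
    (s := Metric.ball (x, s) (|s| / 2))
    (bound := fun z => (M * (2 / |s| * (C * (1 + 2 * |s|) ^ N))) * (1 + ‖z - x‖) ^ (-(N : ℝ)))
    (Metric.ball_mem_nhds _ (by positivity)) ?_ ?_ ?_ ?_ ?_ ?_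
  · refine Eventually.of_forall fun p => ?_
    exact (hF.smul (ρ.continuous.comp (by fun_prop))).aestronglyMeasurable
  · have h1 : Integrable (fun z => ρ (s⁻¹ • (z - x))) :=
      ((integrable_comp_smul_iff volume _ (inv_ne_zero hs)).2 ρ.integrable).comp_sub_right x
    exact h1.bdd_smul M hF.aestronglyMeasurable (Eventually.of_forall hM)
  · have : SecondCountableTopologyEither E (E × ℝ →L[ℝ] G) := ⟨Or.inl inferInstance⟩
    refine (hF.smul ?_).aestronglyMeasurable
    refine Continuous.clm_comp ?_ ?_
    · exact (SchwartzMap.fderivCLM ℝ E G ρ).continuous.comp (by fun_prop)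
    · have h1 : Continuous fun z : E =>
          (ContinuousLinearMap.snd ℝ E ℝ).smulRight (s⁻¹ • (z - x)) :=
        (ContinuousLinearMap.smulRightL ℝ (E × ℝ) E
          (ContinuousLinearMap.snd ℝ E ℝ)).continuous.comp
          ((continuous_id.sub continuous_const).const_smul s⁻¹)
      exact (continuous_const.add h1).const_smul (-s⁻¹)
  · refine Eventually.of_forall fun z p hp => ?_
    obtain ⟨h1, h2⟩ := hp2 p hp
    have h3 := (hball p hp).1
    have hp0 : 0 < |p.2| := by linarith
    set y := p.2⁻¹ • (z - p.1) with hy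
    have hyz : ‖z - p.1‖ = |p.2| * ‖y‖ := by
      rw [hy, norm_smul, norm_inv, Real.norm_eq_abs]; field_simp
    have hz : 1 + ‖z - x‖ ≤ (1 + 2 * |s|) * (1 + ‖y‖) := by
      have : ‖z - x‖ ≤ ‖z - p.1‖ + dist p.1 x := by
        rw [dist_eq_norm]; simpa using norm_add_le (z - p.1) (p.1 - x)
      nlinarith [norm_nonneg y]
    have hL : ‖((-p.2⁻¹) • (ContinuousLinearMap.fst ℝ E ℝ +
          (ContinuousLinearMap.snd ℝ E ℝ).smulRight y))‖ ≤ 2 / |s| * (1 + ‖y‖) := by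
      rw [norm_smul, norm_neg, norm_inv, Real.norm_eq_abs]
      gcongr
      · rw [inv_le_comm₀ hp0 (by positivity), inv_div]; exact h1
      · refine (norm_add_le _ _).trans ?_
        gcongr
        · exact ContinuousLinearMap.norm_fst_le ..
        · rw [ContinuousLinearMap.norm_smulRight_apply]
          exact mul_le_of_le_one_left (norm_nonneg _) (ContinuousLinearMap.norm_snd_le ..)
    have hD : ‖fderiv ℝ ρ y‖ * (1 + ‖y‖) ≤ C * ((1 + ‖y‖) ^ N)⁻¹ := by
      have := hC y
      rw [SchwartzMap.fderivCLM_apply, pow_succ] at this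
      rw [← div_eq_mul_inv, le_div_iff₀ (by positivity)]
      linarith
    have hpow : ((1 + ‖y‖) ^ N)⁻¹ ≤ (1 + 2 * |s|) ^ N * (1 + ‖z - x‖) ^ (-(N : ℝ)) := by
      rw [Real.rpow_neg (by positivity), Real.rpow_natCast, ← div_eq_mul_inv,
        inv_le_comm₀ (by positivity) (by positivity), inv_div, div_le_iff₀ (by positivity),
        mul_comm, ← mul_pow]
      gcongr
    calc _ ≤ |F z| * (‖fderiv ℝ ρ y‖ * (2 / |s| * (1 + ‖y‖))) := by
          rw [norm_smul, Real.norm_eq_abs]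
          gcongr
          exact (ContinuousLinearMap.opNorm_comp_le _ _).trans (by gcongr)
      _ ≤ M * (2 / |s| * (‖fderiv ℝ ρ y‖ * (1 + ‖y‖))) := by
          have := hM z
          rw [mul_left_comm ‖fderiv ℝ ρ y‖]
          gcongr
      _ ≤ M * (2 / |s| * (C * ((1 + 2 * |s|) ^ N * (1 + ‖z - x‖) ^ (-(N : ℝ))))) := by
          refine mul_le_mul_of_nonneg_left (mul_le_mul_of_nonneg_left ?_ (by positivity)) hM0
          exact hD.trans (mul_le_mul_of_nonneg_left hpow hC0)
      _ = _ := by ring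
  · exact ((integrable_one_add_norm (by rw [hN]; push_cast; linarith)).comp_sub_right x).const_mul _
  · refine Eventually.of_forall fun z p hp => ?_
    obtain ⟨h1, h2⟩ := hp2 p hp
    have hp0 : p.2 ≠ 0 := abs_pos.1 (by linarith)
    refine HasFDerivAt.const_smul ?_ (F z)
    have e1 : HasFDerivAt (fun p : E × ℝ => p.2⁻¹ • (z - p.1))
        (((-p.2⁻¹) • (ContinuousLinearMap.fst ℝ E ℝ +
          (ContinuousLinearMap.snd ℝ E ℝ).smulRight (p.2⁻¹ • (z - p.1))))) p := by
      have a1 : HasFDerivAt (fun p : E × ℝ => p.2⁻¹)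
          ((-(p.2 ^ 2)⁻¹) • ContinuousLinearMap.snd ℝ E ℝ) p :=
        (hasDerivAt_inv hp0).comp_hasFDerivAt p hasFDerivAt_snd
      have a2 : HasFDerivAt (fun p : E × ℝ => z - p.1) (-ContinuousLinearMap.fst ℝ E ℝ) p :=
        hasFDerivAt_fst.const_sub z
      refine (a1.smul a2).congr_fderiv ?_
      ext <;> simp [smul_smul, sq]
    exact (ρ.hasFDerivAt _).comp p e1

theorem integrable_dilAvg {F : E → ℝ} (hF : Continuous F) {M : ℝ} (hM : ∀ x, |F x| ≤ M)
    (ρ : 𝓢(E, G)) (x : E) (s : ℝ) : Integrable (fun y => F (x + s • y) • ρ y) :=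
  integrable_smul_schwartz (F := fun y => F (x + s • y)) (by fun_prop) (fun _ => hM _) ρ

theorem dilAvg_hasFDerivAt [CompleteSpace G] {F : E → ℝ} (hF : Continuous F) {M : ℝ}
    (hM : ∀ x, |F x| ≤ M) (ρ : 𝓢(E, G)) (x : E) {s : ℝ} (hs : s ≠ 0) :
    HasFDerivAt (fun p : E × ℝ => dilAvg ρ F p.1 p.2)
      (((-s⁻¹) • ((dilAvg (SchwartzMap.fderivCLM ℝ E G ρ) F x s).comp (ContinuousLinearMap.fst ℝ E ℝ) +
        (ContinuousLinearMap.snd ℝ E ℝ).smulRight (dilAvg (eulerWeight ρ) F x s)))) (x, s) := by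
  set d := Module.finrank ℝ E with hd
  have hI := integral_kernel_hasFDerivAt hF hM ρ x hs
  have hJ : HasFDerivAt (fun p : E × ℝ => |s ^ d|⁻¹ * ((p.2 * s⁻¹) ^ d)⁻¹)
      ((|s ^ d|⁻¹ * (-(d : ℝ) * s⁻¹)) • ContinuousLinearMap.snd ℝ E ℝ) (x, s) := by
    have : HasDerivAt (fun t : ℝ => |s ^ d|⁻¹ * ((t * s⁻¹) ^ d)⁻¹)
        (|s ^ d|⁻¹ * (-(d : ℝ) * s⁻¹)) s := by
      have h := ((((hasDerivAt_id s).mul_const s⁻¹).pow d).inv (by simp [hs])).const_mul |s ^ d|⁻¹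
      simpa [hs] using h
    exact HasDerivAt.comp_hasFDerivAt (f := Prod.snd) (x, s) this hasFDerivAt_snd
  have hprod := hJ.smul hI
  have heq : (fun p : E × ℝ => dilAvg ρ F p.1 p.2) =ᶠ[𝓝 (x, s)]
      fun p => (|s ^ d|⁻¹ * ((p.2 * s⁻¹) ^ d)⁻¹) • ∫ z, F z • ρ (p.2⁻¹ • (z - p.1)) := by
    have : ∀ᶠ p : E × ℝ in 𝓝 (x, s), 0 < p.2 * s⁻¹ := by
      refine (continuous_snd.mul continuous_const).continuousAt.eventually_const_lt ?_
      simp [hs]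
    filter_upwards [this] with p hp
    have hp2 : p.2 ≠ 0 := fun h => by simp [h] at hp
    rw [dilAvg_eq _ _ _ hp2, smul_smul, ← hd]
    have : |p.2 ^ d| = |s ^ d| * (p.2 * s⁻¹) ^ d := by
      rw [← abs_of_pos (pow_pos hp d), ← abs_mul, ← mul_pow]; field_simp
    rw [this, mul_assoc, mul_comm |s ^ d|, ← mul_assoc _ _ |s ^ d|,
      inv_mul_cancel₀ (pow_pos hp d).ne', one_mul, inv_mul_cancel₀ (by simp [hs]), one_smul]
  refine (hprod.congr_of_eventuallyEq heq).congr_fderiv ?_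
  have hsd : |s ^ d| ≠ 0 := by simp [hs]
  have h_integ : ∫ z, F z • ((fderiv ℝ ρ (s⁻¹ • (z - x))).comp
        (((-s⁻¹) • (ContinuousLinearMap.fst ℝ E ℝ +
          (ContinuousLinearMap.snd ℝ E ℝ).smulRight (s⁻¹ • (z - x)))))) =
      |s ^ d| • ∫ y, F (x + s • y) • ((fderiv ℝ ρ y).comp
        (((-s⁻¹) • (ContinuousLinearMap.fst ℝ E ℝ + (ContinuousLinearMap.snd ℝ E ℝ).smulRight y)))) :=
    dilAvg_eq (fun y => (fderiv ℝ ρ y).comp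
        (((-s⁻¹) • (ContinuousLinearMap.fst ℝ E ℝ + (ContinuousLinearMap.snd ℝ E ℝ).smulRight y))))
        F x hs
  have hi1 := integrable_dilAvg hF hM (SchwartzMap.fderivCLM ℝ E G ρ) x s
  have hi2 := integrable_dilAvg hF hM (SchwartzMap.bilinLeftCLM (𝕜 := ℝ)
    (ContinuousLinearMap.id ℝ (E →L[ℝ] G)) (g := fun y : E => y) (by fun_prop)
    (SchwartzMap.fderivCLM ℝ E G ρ)) x s
  have hi0 := integrable_dilAvg hF hM ρ x s
  replace hi2 : Integrable (fun y => F (x + s • y) • fderiv ℝ ρ y y) := hi2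
  have hsplit : ∫ y, F (x + s • y) • ((fderiv ℝ ρ y).comp
        (((-s⁻¹) • (ContinuousLinearMap.fst ℝ E ℝ + (ContinuousLinearMap.snd ℝ E ℝ).smulRight y)))) =
      ((-s⁻¹) • ((∫ y, F (x + s • y) • (SchwartzMap.fderivCLM ℝ E G ρ) y).comp
        (ContinuousLinearMap.fst ℝ E ℝ) +
        (ContinuousLinearMap.snd ℝ E ℝ).smulRight (∫ y, F (x + s • y) • fderiv ℝ ρ y y))) := by
    have c1 : (∫ y, F (x + s • y) • (SchwartzMap.fderivCLM ℝ E G ρ) y).comp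
        (ContinuousLinearMap.fst ℝ E ℝ) =
        ∫ y, (F (x + s • y) • (SchwartzMap.fderivCLM ℝ E G ρ) y).comp
          (ContinuousLinearMap.fst ℝ E ℝ) := by
      exact (ContinuousLinearMap.integral_comp_comm ((ContinuousLinearMap.compL ℝ (E × ℝ) E G).flip
        (ContinuousLinearMap.fst ℝ E ℝ)) hi1).symm
    have c2 : (ContinuousLinearMap.snd ℝ E ℝ).smulRight (∫ y, F (x + s • y) • fderiv ℝ ρ y y) =
        ∫ y, (ContinuousLinearMap.snd ℝ E ℝ).smulRight (F (x + s • y) • fderiv ℝ ρ y y) :=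
      (ContinuousLinearMap.integral_comp_comm (ContinuousLinearMap.smulRightL ℝ (E × ℝ) G
        (ContinuousLinearMap.snd ℝ E ℝ)) hi2).symm
    have j1 : Integrable (fun y => (F (x + s • y) • (SchwartzMap.fderivCLM ℝ E G ρ) y).comp
          (ContinuousLinearMap.fst ℝ E ℝ)) :=
      ((ContinuousLinearMap.compL ℝ (E × ℝ) E G).flip
        (ContinuousLinearMap.fst ℝ E ℝ)).integrable_comp hi1
    have j2 : Integrable (fun y =>
        (ContinuousLinearMap.snd ℝ E ℝ).smulRight (F (x + s • y) • fderiv ℝ ρ y y)) :=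
      (ContinuousLinearMap.smulRightL ℝ (E × ℝ) G
        (ContinuousLinearMap.snd ℝ E ℝ)).integrable_comp hi2
    rw [c1, c2, ← integral_add j1 j2]
    refine Eq.trans (integral_congr_ae (Eventually.of_forall fun y => ?_))
      (integral_smul (-s⁻¹) _)
    ext
    · simp [smul_smul, mul_comm]
    · simp [smul_smul, mul_comm]
  have heul : dilAvg (eulerWeight ρ) F x s =
      (d : ℝ) • dilAvg ρ F x s + ∫ y, F (x + s • y) • fderiv ℝ ρ y y := by
    simp only [dilAvg, eulerWeight_apply, smul_add]
    rw [integral_add _ hi2, ← integral_smul]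
    · congr 2; ext y; rw [smul_comm]
    · exact (hi0.smul (d : ℝ)).congr (Eventually.of_forall fun y => smul_comm ..)
  simp only [h_integ, hsplit, dilAvg_eq ρ F x hs, heul, ← hd]
  simp only [dilAvg]
  ext
  · simp [hs, smul_smul]
  · have hsd' : |s| ^ d * |s|⁻¹ ^ d = 1 := by rw [← mul_pow, mul_inv_cancel₀ (by simpa), one_pow]
    simp only [abs_pow] at hsd ⊢
    simp [hs, smul_smul]
    match_scalars
    field_simp

theorem dilAvg_hasFDerivAt_left [CompleteSpace G] {F : E → ℝ} (hF : Continuous F) {M : ℝ}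
    (hM : ∀ x, |F x| ≤ M) (ρ : 𝓢(E, G)) (x : E) {s : ℝ} (hs : s ≠ 0) :
    HasFDerivAt (fun x => dilAvg ρ F x s)
      ((-s⁻¹) • dilAvg (SchwartzMap.fderivCLM ℝ E G ρ) F x s) x := by
  have h := (dilAvg_hasFDerivAt hF hM ρ x hs).comp x
    ((hasFDerivAt_id (𝕜 := ℝ) x).prodMk (hasFDerivAt_const (𝕜 := ℝ) s x))
  refine h.congr_fderiv ?_
  ext v
  simp

theorem dilAvg_hasDerivAt_right [CompleteSpace G] {F : E → ℝ} (hF : Continuous F) {M : ℝ}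
    (hM : ∀ x, |F x| ≤ M) (ρ : 𝓢(E, G)) (x : E) {s : ℝ} (hs : s ≠ 0) :
    HasDerivAt (fun s => dilAvg ρ F x s) ((-s⁻¹) • dilAvg (eulerWeight ρ) F x s) s := by
  have h := (dilAvg_hasFDerivAt hF hM ρ x hs).comp_hasDerivAt s
    ((hasDerivAt_const s x).prodMk (hasDerivAt_id s))
  refine h.congr_deriv ?_
  simp

theorem dilAvg_hasFDerivAt_diag [CompleteSpace G] {F : E → ℝ} (hF : Continuous F) {M : ℝ}
    (hM : ∀ x, |F x| ≤ M) (ρ : 𝓢(E, G)) (ℓ : E →L[ℝ] ℝ) (x : E) (hs : ℓ x ≠ 0) :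
    HasFDerivAt (fun x => dilAvg ρ F x (ℓ x))
      ((-(ℓ x)⁻¹) • (dilAvg (SchwartzMap.fderivCLM ℝ E G ρ) F x (ℓ x) +
        ℓ.smulRight (dilAvg (eulerWeight ρ) F x (ℓ x)))) x := by
  have h := (dilAvg_hasFDerivAt hF hM ρ x hs).comp x
    ((hasFDerivAt_id (𝕜 := ℝ) x).prodMk ℓ.hasFDerivAt)
  refine h.congr_fderiv ?_
  ext v
  simp

theorem dilAvg_one (ρ : 𝓢(E, G)) (x : E) (s : ℝ) : dilAvg ρ (fun _ => 1) x s = ∫ y, ρ y := by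
  simp [dilAvg]

theorem integral_fderivCLM_eq_zero [CompleteSpace G] (ρ : 𝓢(E, G)) :
    ∫ y, SchwartzMap.fderivCLM ℝ E G ρ y = 0 := by
  have h := dilAvg_hasFDerivAt_left (F := fun _ : E => (1 : ℝ)) continuous_const (M := 1)
    (by simp) ρ 0 (s := 1) one_ne_zero
  simp only [dilAvg_one] at h
  simpa using h.unique (hasFDerivAt_const _ _)

theorem integral_eulerWeight_eq_zero [CompleteSpace G] (ρ : 𝓢(E, G)) :
    ∫ y, eulerWeight ρ y = 0 := by
  have h := dilAvg_hasDerivAt_right (F := fun _ : E => (1 : ℝ)) continuous_const (M := 1)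
    (by simp) ρ 0 (s := 1) one_ne_zero
  simp only [dilAvg_one] at h
  simpa using h.unique (hasDerivAt_const _ _)

end Mollification

section Gaussian

variable {E : Type} [NormedAddCommGroup E] [InnerProductSpace ℝ E] 

theorem hasTemperateGrowth_fderiv {G : Type} [NormedAddCommGroup G]
    [NormedSpace ℝ G] {p : E → G} (hp : Function.HasTemperateGrowth p) :
    Function.HasTemperateGrowth (fderiv ℝ p) := by
  refine ⟨hp.1.fderiv_right (by simp), fun n => ?_⟩
  obtain ⟨k, C, h⟩ := hp.2 (n + 1)
  exact ⟨k, C, fun x => by rw [norm_iteratedFDeriv_fderiv]; exact h x⟩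

theorem hasTemperateGrowth_fderiv_gaussian_factor {G : Type} [NormedAddCommGroup G]
    [NormedSpace ℝ G] {p : E → G} (hp : Function.HasTemperateGrowth p) :
    Function.HasTemperateGrowth (fun y => fderiv ℝ p y - (innerSL ℝ y).smulRight (p y)) := by
  refine (hasTemperateGrowth_fderiv hp).sub ?_
  have h1 : Function.HasTemperateGrowth fun y : E => innerSL ℝ y :=
    (innerSL ℝ (E := E)).hasTemperateGrowth
  exact (ContinuousLinearMap.smulRightL ℝ E G).bilinear_hasTemperateGrowth h1 hp

theorem hasFDerivAt_gaussian_smul {G : Type} [NormedAddCommGroup G]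
    [NormedSpace ℝ G] {p : E → G} (hp : Differentiable ℝ p) (y : E) :
    HasFDerivAt (fun y => Real.exp (-‖y‖ ^ 2 / 2) • p y)
      (Real.exp (-‖y‖ ^ 2 / 2) • (fderiv ℝ p y - (innerSL ℝ y).smulRight (p y))) y := by
  have h1 : HasFDerivAt (fun y : E => -‖y‖ ^ 2 / 2) (-innerSL ℝ y) y := by
    have := ((hasStrictFDerivAt_norm_sq y).hasFDerivAt.const_mul (-1 / 2 : ℝ))
    refine (this.congr_of_eventuallyEq (Eventually.of_forall fun z => ?_)).congr_fderiv ?_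
    · simp; ring
    · ext v; simp; ring
  refine (h1.exp.smul (hp y).hasFDerivAt).congr_fderiv ?_
  ext v
  simp [smul_smul, sub_eq_add_neg, smul_add]

theorem gaussian_decay (m : ℕ) : ∀ {G : Type} [NormedAddCommGroup G] [NormedSpace ℝ G]
    {p : E → G}, Function.HasTemperateGrowth p → ∀ k : ℕ, ∃ C, ∀ x,
      ‖x‖ ^ k * ‖iteratedFDeriv ℝ m (fun y => Real.exp (-‖y‖ ^ 2 / 2) • p y) x‖ ≤ C := by
  induction m with
  | zero =>
    intro G _ _ p hp k
    obtain ⟨j, C, hC⟩ := hp.2 0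
    have hC0 : 0 ≤ C := by
      have := (norm_nonneg _).trans (hC 0)
      simpa using this
    refine ⟨C * (Real.exp (3 / 2) * (k + j).factorial), fun x => ?_⟩
    rw [norm_iteratedFDeriv_zero, norm_smul, Real.norm_eq_abs, Real.abs_exp]
    have h1 := hC x
    rw [norm_iteratedFDeriv_zero] at h1
    have h2 : Real.exp (-‖x‖ ^ 2 / 2) ≤ Real.exp (3 / 2) * (Real.exp (1 + ‖x‖))⁻¹ := by
      rw [← Real.exp_neg, ← Real.exp_add]
      apply Real.exp_le_exp.2
      nlinarith [sq_nonneg (‖x‖ - 1)]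
    have h3 : (1 + ‖x‖) ^ (k + j) * (Real.exp (1 + ‖x‖))⁻¹ ≤ (k + j).factorial := by
      have := Real.pow_div_factorial_le_exp (x := 1 + ‖x‖) (by positivity) (k + j)
      rw [div_le_iff₀ (by positivity)] at this
      rw [← div_eq_mul_inv, div_le_iff₀ (by positivity), mul_comm]
      exact this
    have h4 : ‖x‖ ^ k ≤ (1 + ‖x‖) ^ k := by gcongr; linarith
    calc _ ≤ (1 + ‖x‖) ^ k * (Real.exp (3 / 2) * (Real.exp (1 + ‖x‖))⁻¹ *
          (C * (1 + ‖x‖) ^ j)) := by gcongr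
      _ = C * (Real.exp (3 / 2) * ((1 + ‖x‖) ^ (k + j) * (Real.exp (1 + ‖x‖))⁻¹)) := by
          rw [pow_add]; ring
      _ ≤ _ := by gcongr
  | succ m ih =>
    intro G _ _ p hp k
    obtain ⟨C, hC⟩ := ih (hasTemperateGrowth_fderiv_gaussian_factor hp) k
    refine ⟨C, fun x => ?_⟩
    rw [← norm_iteratedFDeriv_fderiv]
    have : fderiv ℝ (fun y => Real.exp (-‖y‖ ^ 2 / 2) • p y) = fun y =>
        Real.exp (-‖y‖ ^ 2 / 2) • (fderiv ℝ p y - (innerSL ℝ y).smulRight (p y)) :=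
      funext fun y => (hasFDerivAt_gaussian_smul (hp.1.differentiable (by simp)) y).fderiv
    rw [this]
    exact hC x

/-- The Schwartz function `exp(-|y|²/2) p(y)`. -/
noncomputable def gaussianMul {G : Type} [NormedAddCommGroup G]
    [NormedSpace ℝ G] {p : E → G} (hp : Function.HasTemperateGrowth p) : 𝓢(E, G) where
  toFun y := Real.exp (-‖y‖ ^ 2 / 2) • p y
  smooth' := by
    refine ContDiff.smul ?_ hp.1
    exact ContDiff.exp (((contDiff_norm_sq ℝ).neg).div_const 2)
  decay' k n := gaussian_decay n hp k

variable [FiniteDimensional ℝ E] [MeasurableSpace E] [BorelSpace E]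

variable (E) in
/-- The normalised Gaussian. -/
noncomputable def gaussian : 𝓢(E, ℝ) :=
  (∫ y : E, Real.exp (-‖y‖ ^ 2 / 2))⁻¹ • gaussianMul (Function.HasTemperateGrowth.const (1 : ℝ))

theorem gaussian_apply (y : E) :
    gaussian E y = (∫ y : E, Real.exp (-‖y‖ ^ 2 / 2))⁻¹ * Real.exp (-‖y‖ ^ 2 / 2) := by
  change (∫ y : E, Real.exp (-‖y‖ ^ 2 / 2))⁻¹ • (Real.exp (-‖y‖ ^ 2 / 2) • (1 : ℝ)) = _
  simp

theorem integral_gaussian : ∫ y, gaussian E y = 1 := by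
  simp only [gaussian_apply, integral_const_mul]
  refine inv_mul_cancel₀ (ne_of_gt ?_)
  refine integral_exp_pos ?_
  have := (gaussianMul (E := E) (Function.HasTemperateGrowth.const (1 : ℝ))).integrable (μ := volume)
  refine this.congr (Eventually.of_forall fun y => ?_)
  change Real.exp (-‖y‖ ^ 2 / 2) • (1 : ℝ) = _
  simp

theorem fderiv_gaussian (y : E) : fderiv ℝ (gaussian E) y = -(gaussian E y • innerSL ℝ y) := by
  have h := (hasFDerivAt_gaussian_smul (p := fun _ : E =>
    (∫ y : E, Real.exp (-‖y‖ ^ 2 / 2))⁻¹) (differentiable_const _) y).fderiv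
  have e : (gaussian E : E → ℝ) = fun y => Real.exp (-‖y‖ ^ 2 / 2) •
      (∫ y : E, Real.exp (-‖y‖ ^ 2 / 2))⁻¹ := by
    ext y; rw [gaussian_apply, smul_eq_mul, mul_comm]
  rw [e, h]
  ext v
  simp
  ring

theorem fderiv_fderiv_gaussian (y v w : E) :
    fderiv ℝ (fun y => fderiv ℝ (gaussian E) y) y v w =
      gaussian E y * (inner ℝ y v * inner ℝ y w - inner ℝ v w) := by
  have e : (fun y => fderiv ℝ (gaussian E) y) = fun y => -(gaussian E y • innerSL ℝ y) :=
    funext fderiv_gaussian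
  have h : HasFDerivAt (fun y : E => -(gaussian E y • innerSL ℝ y)) _ y :=
    (((gaussian E).hasFDerivAt y).smul (innerSL ℝ (E := E)).hasFDerivAt).neg
  rw [e, h.fderiv]
  simp only [fderiv_gaussian, neg_apply, add_apply,
    smul_apply, ContinuousLinearMap.smulRight_apply, smul_eq_mul]
  rw [innerSL_apply_apply, innerSL_apply_apply, innerSL_apply_apply]
  ring

theorem eulerWeight_gaussian (y : E) :
    eulerWeight (gaussian E) y = gaussian E y * (Module.finrank ℝ E - ‖y‖ ^ 2) := by
  rw [eulerWeight_apply, fderiv_gaussian]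
  simp
  ring

theorem sum_fderiv_fderiv_gaussian {ι : Type*} [Fintype ι] (b : OrthonormalBasis ι ℝ E) (y : E) :
    ∑ i, fderiv ℝ (fun y => fderiv ℝ (gaussian E) y) y (b i) (b i) =
      -eulerWeight (gaussian E) y := by
  simp only [fderiv_fderiv_gaussian, eulerWeight_gaussian]
  rw [← Finset.mul_sum, Finset.sum_sub_distrib]
  have h1 : ∑ i, inner ℝ y (b i) * inner ℝ y (b i) = ‖y‖ ^ 2 := by
    rw [← b.sum_sq_norm_inner_left y]
    refine Finset.sum_congr rfl fun i _ => ?_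
    rw [Real.norm_eq_abs, sq_abs, sq]
  have h2 : ∑ i, inner ℝ (b i) (b i) = (Module.finrank ℝ E : ℝ) := by
    simp [Module.finrank_eq_card_basis b.toBasis]
  rw [h1, h2]
  ring

end Gaussian

set_option maxSynthPendingDepth 3

section Bounds

set_option linter.unusedSectionVars false

variable {E : Type} [NormedAddCommGroup E] [InnerProductSpace ℝ E] [FiniteDimensional ℝ E]
  [MeasurableSpace E] [BorelSpace E]
  {G : Type} [NormedAddCommGroup G] [NormedSpace ℝ G] [CompleteSpace G]

/-- `F` is bounded by `M` and `α`-Hölder with constant `N` on the whole space. -/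
structure BddHolder {X : Type} [NormedAddCommGroup X] (α : ℝ) (F : X → ℝ) (M N : ℝ) : Prop where
  bound : ∀ x, |F x| ≤ M
  holder : ∀ x y, |F x - F y| ≤ N * ‖x - y‖ ^ α

theorem continuous_of_holder {X Y : Type} [NormedAddCommGroup X] [NormedAddCommGroup Y] {α : ℝ}
    (hα : 0 < α) {F : X → Y} {N : ℝ} (h : ∀ x y, ‖F x - F y‖ ≤ N * ‖x - y‖ ^ α) :
    Continuous F := by
  rw [continuous_iff_continuousAt]
  intro x
  rw [ContinuousAt, tendsto_iff_norm_sub_tendsto_zero]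
  have : Tendsto (fun y => N * ‖y - x‖ ^ α) (𝓝 x) (𝓝 0) := by
    have h1 : Continuous fun y : X => N * ‖y - x‖ ^ α :=
      continuous_const.mul ((continuous_id.sub continuous_const).norm.rpow_const
        fun _ => Or.inr hα.le)
    simpa [Real.zero_rpow hα.ne'] using h1.tendsto x
  exact squeeze_zero (fun _ => norm_nonneg _) (fun y => h y x) this

theorem BddHolder.continuous {X : Type} [NormedAddCommGroup X] {α : ℝ} (hα : 0 < α) {F : X → ℝ}
    {M N : ℝ} (h : BddHolder α F M N) : Continuous F :=
  continuous_of_holder hα h.holder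

theorem BddHolder.M_nonneg {X : Type} [NormedAddCommGroup X] {α : ℝ} {F : X → ℝ}
    {M N : ℝ} (h : BddHolder α F M N) : 0 ≤ M := (abs_nonneg _).trans (h.bound 0)

/-- First absolute moment of a weight. -/
noncomputable def mass (ρ : 𝓢(E, G)) : ℝ := ∫ y, (1 + ‖y‖) * ‖ρ y‖

theorem integrable_mass (ρ : 𝓢(E, G)) : Integrable fun y => (1 + ‖y‖) * ‖ρ y‖ := by
  have h0 := ρ.integrable_pow_mul (volume : Measure E) 0
  have h1 := ρ.integrable_pow_mul (volume : Measure E) 1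
  refine (h0.add h1).congr (Eventually.of_forall fun y => ?_)
  simp; ring

theorem mass_nonneg (ρ : 𝓢(E, G)) : 0 ≤ mass ρ := integral_nonneg fun y => by positivity

theorem norm_integral_smul_le_mass (ρ : 𝓢(E, G)) {g : E → ℝ} {c : ℝ} 
    (hg : ∀ y, |g y| ≤ c * (1 + ‖y‖)) : ‖∫ y, g y • ρ y‖ ≤ c * mass ρ := by
  rw [mass, ← integral_const_mul]
  refine norm_integral_le_of_norm_le ((integrable_mass ρ).const_mul c)
    (Eventually.of_forall fun y => ?_)
  rw [norm_smul, ← mul_assoc, Real.norm_eq_abs]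
  exact mul_le_mul_of_nonneg_right (hg y) (norm_nonneg _)

theorem norm_dilAvg_le (ρ : 𝓢(E, G)) {F : E → ℝ} {M : ℝ} (hM : ∀ x, |F x| ≤ M) (x : E) (s : ℝ) :
    ‖dilAvg ρ F x s‖ ≤ M * mass ρ :=
  norm_integral_smul_le_mass ρ fun y => (hM _).trans
    (le_mul_of_one_le_right ((abs_nonneg _).trans (hM 0)) (by linarith [norm_nonneg y]))

theorem norm_rpow_le_one_add {α : ℝ} (h0 : 0 ≤ α) (h1 : α ≤ 1) {t : ℝ} (ht : 0 ≤ t) :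
    t ^ α ≤ 1 + t := by
  rcases le_total t 1 with h | h
  · exact (Real.rpow_le_one ht h h0).trans (by linarith)
  · exact (Real.rpow_le_rpow_of_exponent_le h h1).trans (by rw [Real.rpow_one]; linarith)

variable {α : ℝ} {F : E → ℝ} {M N : ℝ}

theorem norm_dilAvg_sub_le (h0 : 0 < α) (h1 : α < 1) (hF : BddHolder α F M N) (hN : 0 ≤ N)
    (ρ : 𝓢(E, G)) (x : E) {s : ℝ} (hs : 0 ≤ s) :
    ‖dilAvg ρ F x s - F x • ∫ y, ρ y‖ ≤ N * s ^ α * mass ρ := by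
  rw [dilAvg, ← integral_smul, ← integral_sub (integrable_dilAvg (hF.continuous h0) hF.bound ρ x s)
    (show Integrable (fun y => F x • ρ y) from ρ.integrable.smul _)]
  simp only [← sub_smul]
  refine norm_integral_smul_le_mass ρ fun y => (hF.holder _ _).trans ?_
  rw [add_sub_cancel_left, norm_smul, Real.norm_of_nonneg hs,
    Real.mul_rpow hs (norm_nonneg _), ← mul_assoc]
  gcongr
  exact norm_rpow_le_one_add h0.le h1.le (norm_nonneg _)

theorem norm_dilAvg_le_of_integral_eq_zero (h0 : 0 < α) (h1 : α < 1) (hF : BddHolder α F M N)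
    (hN : 0 ≤ N) {ρ : 𝓢(E, G)} (hρ : ∫ y, ρ y = 0) (x : E) {s : ℝ} (hs : 0 ≤ s) :
    ‖dilAvg ρ F x s‖ ≤ N * s ^ α * mass ρ := by
  simpa [hρ] using norm_dilAvg_sub_le h0 h1 hF hN ρ x hs

theorem norm_dilAvg_sub_dilAvg_le (h0 : 0 < α) (h1 : α < 1) (hF : BddHolder α F M N) (hN : 0 ≤ N)
    (ρ : 𝓢(E, G)) (x x' : E) {s : ℝ} (hs : 0 < s) :
    ‖dilAvg ρ F x s - dilAvg ρ F x' s‖ ≤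
      N * (s⁻¹ * s ^ α) * mass (SchwartzMap.fderivCLM ℝ E G ρ) * ‖x - x'‖ := by
  refine (convex_univ).norm_image_sub_le_of_norm_hasFDerivWithin_le (f := fun x => dilAvg ρ F x s)
    (fun z _ => (dilAvg_hasFDerivAt_left (hF.continuous h0) hF.bound ρ z hs.ne').hasFDerivWithinAt)
    (fun z _ => ?_) (mem_univ x') (mem_univ x)
  rw [norm_smul, norm_neg, norm_inv, Real.norm_of_nonneg hs.le]
  have := norm_dilAvg_le_of_integral_eq_zero h0 h1 hF hN (integral_fderivCLM_eq_zero ρ) z hs.le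
  calc _ ≤ s⁻¹ * (N * s ^ α * mass (SchwartzMap.fderivCLM ℝ E G ρ)) := by gcongr
    _ = _ := by ring

theorem continuousOn_dilAvg (hF : Continuous F) (hM : ∀ x, |F x| ≤ M) (ρ : 𝓢(E, G)) (x : E) :
    ContinuousOn (fun s => dilAvg ρ F x s) (Ioi 0) := fun _ hs =>
  (dilAvg_hasDerivAt_right hF hM ρ x (ne_of_gt hs)).continuousAt.continuousWithinAt

theorem hasFDerivAt_integral_dilAvg (hF : Continuous F) (hM : ∀ x, |F x| ≤ M) (ρ : 𝓢(E, G))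
    {k g : ℝ → ℝ} (hk : ContinuousOn k (Ioi 0)) (hg : IntegrableOn g (Ioi 0))
    (h_integ : ∀ x, IntegrableOn (fun s => k s • dilAvg ρ F x s) (Ioi 0))
    (hb : ∀ s > 0, ∀ x, ‖(-(k s * s⁻¹)) • dilAvg (SchwartzMap.fderivCLM ℝ E G ρ) F x s‖ ≤ g s)
    (x : E) :
    HasFDerivAt (fun x => ∫ s in Ioi 0, k s • dilAvg ρ F x s)
      (∫ s in Ioi 0, (-(k s * s⁻¹)) • dilAvg (SchwartzMap.fderivCLM ℝ E G ρ) F x s) x := by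
  have hc : ∀ (k : ℝ → ℝ), ContinuousOn k (Ioi 0) → ∀ x,
      AEStronglyMeasurable (fun s => k s • dilAvg (SchwartzMap.fderivCLM ℝ E G ρ) F x s)
        (volume.restrict (Ioi 0)) := fun k hk x =>
    (hk.smul (continuousOn_dilAvg hF hM _ x)).aestronglyMeasurable measurableSet_Ioi
  refine hasFDerivAt_integral_of_dominated_of_fderiv_le (s := univ) (bound := g)
    (F' := fun x s => (-(k s * s⁻¹)) • dilAvg (SchwartzMap.fderivCLM ℝ E G ρ) F x s) univ_mem
    (Eventually.of_forall fun x => (h_integ x).aestronglyMeasurable) (h_integ x)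
    (hc (fun s => -(k s * s⁻¹))
      ((hk.mul (continuousOn_inv₀.mono fun s hs => ne_of_gt hs)).neg) x) ?_ hg ?_
  · exact (ae_restrict_mem measurableSet_Ioi).mono fun s hs x _ => hb s hs x
  · refine (ae_restrict_mem measurableSet_Ioi).mono fun s hs x _ => ?_
    refine ((dilAvg_hasFDerivAt_left hF hM ρ x (ne_of_gt hs)).const_smul (k s)).congr_fderiv ?_
    rw [smul_smul, mul_neg]

end Bounds

section WholeSpace

/-- `u` is `C²` with `|u| ≤ A₀`, `|Du| ≤ A₁`, `|D²u| ≤ A₂` and `[D²u]_α ≤ A₃` on the whole space. -/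
structure C2B {X : Type} [NormedAddCommGroup X] [NormedSpace ℝ X] (α : ℝ) (u : X → ℝ)
    (A₀ A₁ A₂ A₃ : ℝ) : Prop where
  contDiff : ContDiff ℝ 2 u
  b0 : ∀ x, |u x| ≤ A₀
  b1 : ∀ x, ‖fderiv ℝ u x‖ ≤ A₁
  b2 : ∀ x, ‖fderiv ℝ (fderiv ℝ u) x‖ ≤ A₂
  b3 : ∀ x y, ‖fderiv ℝ (fderiv ℝ u) x - fderiv ℝ (fderiv ℝ u) y‖ ≤ A₃ * ‖x - y‖ ^ α

theorem contDiff_two_of_hasFDerivAt {X Y : Type} [NormedAddCommGroup X] [NormedSpace ℝ X]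
    [NormedAddCommGroup Y] [NormedSpace ℝ Y]
    {u : X → Y} {u' : X → X →L[ℝ] Y} {u'' : X → X →L[ℝ] X →L[ℝ] Y}
    (h1 : ∀ x, HasFDerivAt u (u' x) x) (h2 : ∀ x, HasFDerivAt u' (u'' x) x)
    (h3 : Continuous u'') : ContDiff ℝ 2 u := by
  have e1 : fderiv ℝ u = u' := funext fun x => (h1 x).fderiv
  have e2 : fderiv ℝ u' = u'' := funext fun x => (h2 x).fderiv
  refine (contDiff_succ_iff_fderiv (n := 1)).2 ⟨fun x => (h1 x).differentiableAt, by simp, ?_⟩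
  rw [e1]
  exact contDiff_one_iff_fderiv.2 ⟨fun x => (h2 x).differentiableAt, by rwa [e2]⟩

theorem C2B.of_hasFDerivAt {X : Type} [NormedAddCommGroup X] [NormedSpace ℝ X] {α : ℝ}
    (hα : 0 < α) {A₀ A₁ A₂ A₃ : ℝ}
    {u : X → ℝ} {u' : X → X →L[ℝ] ℝ} {u'' : X → X →L[ℝ] X →L[ℝ] ℝ}
    (h1 : ∀ x, HasFDerivAt u (u' x) x) (h2 : ∀ x, HasFDerivAt u' (u'' x) x)
    (b0 : ∀ x, |u x| ≤ A₀) (b1 : ∀ x, ‖u' x‖ ≤ A₁) (b2 : ∀ x, ‖u'' x‖ ≤ A₂)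
    (b3 : ∀ x y, ‖u'' x - u'' y‖ ≤ A₃ * ‖x - y‖ ^ α) : C2B α u A₀ A₁ A₂ A₃ := by
  have e1 : fderiv ℝ u = u' := funext fun x => (h1 x).fderiv
  have e2 : fderiv ℝ u' = u'' := funext fun x => (h2 x).fderiv
  refine ⟨contDiff_two_of_hasFDerivAt h1 h2 (continuous_of_holder hα b3), b0, ?_, ?_, ?_⟩
  · rwa [e1]
  · rwa [e1, e2]
  · rwa [e1, e2]

variable {E : Type} [NormedAddCommGroup E] [InnerProductSpace ℝ E] [FiniteDimensional ℝ E]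
  [MeasurableSpace E] [BorelSpace E] {α : ℝ} {F : E → ℝ} {M N : ℝ}

theorem continuous_expSq : Continuous fun s : ℝ => Real.exp (-(1 / 2) * s ^ 2) := by fun_prop

theorem integrableOn_rpow_mul_expSq {p : ℝ} (hp : -1 < p) :
    IntegrableOn (fun s : ℝ => s ^ p * Real.exp (-(1 / 2) * s ^ 2)) (Ioi 0) :=
  integrableOn_rpow_mul_exp_neg_mul_sq (by norm_num) hp

theorem integrableOn_expSq :
    IntegrableOn (fun s : ℝ => Real.exp (-(1 / 2) * s ^ 2)) (Ioi 0) := by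
  simpa using integrableOn_rpow_mul_expSq (p := 0) (by norm_num)

theorem integrableOn_mul_expSq :
    IntegrableOn (fun s : ℝ => s * Real.exp (-(1 / 2) * s ^ 2)) (Ioi 0) := by
  simpa using integrableOn_rpow_mul_expSq (p := 1) (by norm_num)

/-- The resolvent potential, solving `W - ΔW = F`. -/
noncomputable def heatPot (F : E → ℝ) (x : E) : ℝ :=
  ∫ s in Ioi 0, (s * Real.exp (-(1 / 2) * s ^ 2)) • dilAvg (gaussian E) F x s

/-- First derivative of the Gaussian. -/
noncomputable def gaussian₁ (E : Type) [NormedAddCommGroup E] [InnerProductSpace ℝ E]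
    [FiniteDimensional ℝ E] [MeasurableSpace E] [BorelSpace E] : 𝓢(E, E →L[ℝ] ℝ) :=
  SchwartzMap.fderivCLM ℝ E ℝ (gaussian E)

/-- Second derivative of the Gaussian. -/
noncomputable def gaussian₂ (E : Type) [NormedAddCommGroup E] [InnerProductSpace ℝ E]
    [FiniteDimensional ℝ E] [MeasurableSpace E] [BorelSpace E] : 𝓢(E, E →L[ℝ] E →L[ℝ] ℝ) :=
  SchwartzMap.fderivCLM ℝ E _ (gaussian₁ E)

/-- First derivative of `heatPot`. -/
noncomputable def heatPot₁ (F : E → ℝ) (x : E) : E →L[ℝ] ℝ :=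
  ∫ s in Ioi 0, (-Real.exp (-(1 / 2) * s ^ 2)) • dilAvg (gaussian₁ E) F x s

/-- Second derivative of `heatPot`. -/
noncomputable def heatPot₂ (F : E → ℝ) (x : E) : E →L[ℝ] E →L[ℝ] ℝ :=
  ∫ s in Ioi 0, (s⁻¹ * Real.exp (-(1 / 2) * s ^ 2)) • dilAvg (gaussian₂ E) F x s

theorem integrableOn_smul_dilAvg {G : Type} [NormedAddCommGroup G] [NormedSpace ℝ G]
    [CompleteSpace G] (hF : Continuous F) (hM : ∀ x, |F x| ≤ M) (ρ : 𝓢(E, G)) {k g : ℝ → ℝ}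
    (hk : ContinuousOn k (Ioi 0)) (hg : IntegrableOn g (Ioi 0)) (x : E)
    (hb : ∀ s > 0, ‖k s • dilAvg ρ F x s‖ ≤ g s) :
    IntegrableOn (fun s => k s • dilAvg ρ F x s) (Ioi 0) :=
  hg.mono' ((hk.smul (continuousOn_dilAvg hF hM ρ x)).aestronglyMeasurable measurableSet_Ioi)
    ((ae_restrict_mem measurableSet_Ioi).mono fun s hs => hb s hs)

theorem heatPot_integrand_bound (hM : ∀ x, |F x| ≤ M) (x : E) {s : ℝ} (hs : 0 < s) :
    ‖(s * Real.exp (-(1 / 2) * s ^ 2)) • dilAvg (gaussian E) F x s‖ ≤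
      M * mass (gaussian E) * (s * Real.exp (-(1 / 2) * s ^ 2)) := by
  rw [norm_smul, Real.norm_of_nonneg (by positivity), mul_comm]
  gcongr
  exact norm_dilAvg_le _ hM x s

theorem heatPot₁_integrand_bound (hM : ∀ x, |F x| ≤ M) (x : E) (s : ℝ) :
    ‖(-Real.exp (-(1 / 2) * s ^ 2)) • dilAvg (gaussian₁ E) F x s‖ ≤
      M * mass (gaussian₁ E) * (Real.exp (-(1 / 2) * s ^ 2)) := by
  rw [norm_smul, norm_neg, Real.norm_of_nonneg (by positivity), mul_comm]
  gcongr
  exact norm_dilAvg_le _ hM x s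

theorem heatPot₂_integrand_bound (h0 : 0 < α) (h1 : α < 1) (hF : BddHolder α F M N) (hN : 0 ≤ N)
    (x : E) {s : ℝ} (hs : 0 < s) :
    ‖(s⁻¹ * Real.exp (-(1 / 2) * s ^ 2)) • dilAvg (gaussian₂ E) F x s‖ ≤
      N * mass (gaussian₂ E) * (s ^ (α - 1) * Real.exp (-(1 / 2) * s ^ 2)) := by
  rw [norm_smul, Real.norm_of_nonneg (by positivity), Real.rpow_sub_one hs.ne']
  have := norm_dilAvg_le_of_integral_eq_zero h0 h1 hF hN
    (integral_fderivCLM_eq_zero (gaussian₁ E)) x hs.le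
  calc _ ≤ (s⁻¹ * Real.exp (-(1 / 2) * s ^ 2)) * (N * s ^ α * mass (gaussian₂ E)) := by
        gcongr; exact this
    _ = _ := by field_simp

theorem continuousOn_inv_mul_expSq :
    ContinuousOn (fun s : ℝ => s⁻¹ * Real.exp (-(1 / 2) * s ^ 2)) (Ioi 0) :=
  (continuousOn_inv₀.mono fun _ hs => ne_of_gt hs).mul continuous_expSq.continuousOn

theorem heatPot₂_integrable (h0 : 0 < α) (h1 : α < 1) (hF : BddHolder α F M N) (hN : 0 ≤ N)
    (x : E) : IntegrableOn (fun s => (s⁻¹ * Real.exp (-(1 / 2) * s ^ 2)) •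
      dilAvg (gaussian₂ E) F x s) (Ioi 0) :=
  integrableOn_smul_dilAvg (hF.continuous h0) hF.bound _ continuousOn_inv_mul_expSq
    ((integrableOn_rpow_mul_expSq (by linarith)).const_mul _) x
    fun _ hs => heatPot₂_integrand_bound h0 h1 hF hN x hs

theorem hasFDerivAt_heatPot (h0 : 0 < α) (hF : BddHolder α F M N) (x : E) :
    HasFDerivAt (heatPot F) (heatPot₁ F x) x := by
  have e : ∀ s > (0 : ℝ), -(s * Real.exp (-(1 / 2) * s ^ 2) * s⁻¹) =
      -Real.exp (-(1 / 2) * s ^ 2) := fun s hs => by field_simp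
  refine (hasFDerivAt_integral_dilAvg (hF.continuous h0) hF.bound (gaussian E)
    (k := fun s => s * Real.exp (-(1 / 2) * s ^ 2))
    (continuous_id.mul continuous_expSq).continuousOn
    (integrableOn_expSq.const_mul (M * mass (gaussian₁ E))) (fun x => ?_)
    (fun s hs x => ?_) x).congr_fderiv ?_
  · exact integrableOn_smul_dilAvg (hF.continuous h0) hF.bound _
      (continuous_id.mul continuous_expSq).continuousOn (integrableOn_mul_expSq.const_mul _) x
      fun s hs => heatPot_integrand_bound hF.bound x hs
  · rw [e s hs]
    exact heatPot₁_integrand_bound hF.bound x s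
  · refine setIntegral_congr_fun measurableSet_Ioi fun s hs => ?_
    simp only [e s hs]
    rfl

theorem hasFDerivAt_heatPot₁ (h0 : 0 < α) (h1 : α < 1) (hF : BddHolder α F M N) (hN : 0 ≤ N)
    (x : E) : HasFDerivAt (heatPot₁ F) (heatPot₂ F x) x := by
  have e : ∀ s : ℝ, -(-Real.exp (-(1 / 2) * s ^ 2) * s⁻¹) =
      s⁻¹ * Real.exp (-(1 / 2) * s ^ 2) := fun s => by ring
  refine (hasFDerivAt_integral_dilAvg (hF.continuous h0) hF.bound (gaussian₁ E)
    (k := fun s => -Real.exp (-(1 / 2) * s ^ 2)) continuous_expSq.neg.continuousOn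
    ((integrableOn_rpow_mul_expSq (p := α - 1) (by linarith)).const_mul (N * mass (gaussian₂ E)))
    (fun x => ?_) (fun s hs x => ?_) x).congr_fderiv ?_
  · exact integrableOn_smul_dilAvg (hF.continuous h0) hF.bound _
      continuous_expSq.neg.continuousOn (integrableOn_expSq.const_mul _) x
      fun s hs => heatPot₁_integrand_bound hF.bound x s
  · rw [e s]
    exact heatPot₂_integrand_bound h0 h1 hF hN x hs
  · simp only [e]
    rfl

theorem heatPot₂_holder (h0 : 0 < α) (h1 : α < 1) (hF : BddHolder α F M N) (hN : 0 ≤ N)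
    (x y : E) : ‖heatPot₂ F x - heatPot₂ F y‖ ≤
      N * (2 * mass (gaussian₂ E) / α +
        mass (SchwartzMap.fderivCLM ℝ E _ (gaussian₂ E)) / (1 - α)) * ‖x - y‖ ^ α := by
  rcases eq_or_ne x y with rfl | hxy
  · simp [Real.zero_rpow h0.ne']
  set h := ‖x - y‖ with hh
  have hh0 : 0 < h := norm_pos_iff.2 (sub_ne_zero.2 hxy)
  set m₂ := mass (gaussian₂ E)
  set m₃ := mass (SchwartzMap.fderivCLM ℝ E _ (gaussian₂ E))
  have hm₂ : 0 ≤ m₂ := mass_nonneg _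
  have hm₃ : 0 ≤ m₃ := mass_nonneg _
  have hix := heatPot₂_integrable h0 h1 hF hN x
  have hiy := heatPot₂_integrable h0 h1 hF hN y
  have hz := integral_fderivCLM_eq_zero (gaussian₁ E)
  have he : ∀ s : ℝ, Real.exp (-(1 / 2) * s ^ 2) ≤ 1 := fun s =>
    Real.exp_le_one_iff.2 (by nlinarith [sq_nonneg s])
  have hd : ∀ s > 0, ‖(s⁻¹ * Real.exp (-(1 / 2) * s ^ 2)) • dilAvg (gaussian₂ E) F x s -
      (s⁻¹ * Real.exp (-(1 / 2) * s ^ 2)) • dilAvg (gaussian₂ E) F y s‖ ≤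
      s⁻¹ * ‖dilAvg (gaussian₂ E) F x s - dilAvg (gaussian₂ E) F y s‖ := fun s hs => by
    rw [← smul_sub, norm_smul, Real.norm_of_nonneg (by positivity)]
    refine mul_le_mul_of_nonneg_right ?_ (norm_nonneg _)
    exact mul_le_of_le_one_right (by positivity) (he s)
  have hA : ‖∫ s in Ioc 0 h, ((s⁻¹ * Real.exp (-(1 / 2) * s ^ 2)) • dilAvg (gaussian₂ E) F x s -
      (s⁻¹ * Real.exp (-(1 / 2) * s ^ 2)) • dilAvg (gaussian₂ E) F y s)‖ ≤
      N * (2 * m₂ / α) * h ^ α := by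
    have hi : IntegrableOn (fun s : ℝ => s ^ (α - 1)) (Ioc 0 h) :=
      (intervalIntegral.intervalIntegrable_rpow' (by linarith)).1
    have hv : ∫ s in Ioc 0 h, s ^ (α - 1) = h ^ α / α := by
      rw [← intervalIntegral.integral_of_le hh0.le, integral_rpow (Or.inl (by linarith))]
      simp [Real.zero_rpow h0.ne']
    calc _ ≤ ∫ s in Ioc 0 h, (2 * (N * m₂)) * s ^ (α - 1) := by
          refine norm_integral_le_of_norm_le (hi.const_mul _)
            ((ae_restrict_mem measurableSet_Ioc).mono fun s hs => (hd s hs.1).trans ?_)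
          have a1 := norm_dilAvg_le_of_integral_eq_zero h0 h1 hF hN hz x hs.1.le
          have a2 := norm_dilAvg_le_of_integral_eq_zero h0 h1 hF hN hz y hs.1.le
          have hs0 : 0 < s := hs.1
          rw [Real.rpow_sub_one hs0.ne']
          calc _ ≤ s⁻¹ * (N * s ^ α * m₂ + N * s ^ α * m₂) := by
                gcongr; exact (norm_sub_le _ _).trans (add_le_add a1 a2)
            _ = _ := by field_simp; ring
      _ = _ := by rw [integral_const_mul, hv]; ring
  have hB : ‖∫ s in Ioi h, ((s⁻¹ * Real.exp (-(1 / 2) * s ^ 2)) • dilAvg (gaussian₂ E) F x s -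
      (s⁻¹ * Real.exp (-(1 / 2) * s ^ 2)) • dilAvg (gaussian₂ E) F y s)‖ ≤
      N * (m₃ / (1 - α)) * h ^ α := by
    have hi : IntegrableOn (fun s : ℝ => s ^ (α - 2)) (Ioi h) :=
      integrableOn_Ioi_rpow_of_lt (by linarith) hh0
    have hv : ∫ s in Ioi h, s ^ (α - 2) = h ^ (α - 1) / (1 - α) := by
      rw [integral_Ioi_rpow_of_lt (by linarith) hh0, show α - 2 + 1 = -(1 - α) by ring,
        show α - 1 = -(1 - α) by ring, neg_div_neg_eq]
    calc _ ≤ ∫ s in Ioi h, (N * m₃ * h) * s ^ (α - 2) := by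
          refine norm_integral_le_of_norm_le (hi.const_mul _)
            ((ae_restrict_mem measurableSet_Ioi).mono fun s hs => ?_)
          have hs0 : 0 < s := hh0.trans hs
          refine (hd s hs0).trans ?_
          have a1 := norm_dilAvg_sub_dilAvg_le h0 h1 hF hN (gaussian₂ E) x y hs0
          have e2 : s ^ (α - 2) = s ^ α / s / s := by
            rw [← Real.rpow_sub_one hs0.ne', ← Real.rpow_sub_one hs0.ne']; ring_nf
          calc _ ≤ s⁻¹ * (N * (s⁻¹ * s ^ α) * m₃ * h) := by gcongr
            _ = _ := by rw [e2]; field_simp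
      _ = _ := by
          have : h ^ α = h * h ^ (α - 1) := by rw [Real.rpow_sub_one hh0.ne']; field_simp
          rw [integral_const_mul, hv, this]; ring
  have hsplit := setIntegral_union (f := fun s : ℝ =>
      ((s⁻¹ * Real.exp (-(1 / 2) * s ^ 2)) • dilAvg (gaussian₂ E) F x s -
      (s⁻¹ * Real.exp (-(1 / 2) * s ^ 2)) • dilAvg (gaussian₂ E) F y s)) (μ := volume)
      (Ioc_disjoint_Ioi le_rfl : Disjoint (Ioc 0 h) (Ioi h)) measurableSet_Ioi
      ((hix.sub hiy).mono_set Ioc_subset_Ioi_self) ((hix.sub hiy).mono_set (Ioi_subset_Ioi hh0.le))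
  rw [Ioc_union_Ioi_eq_Ioi hh0.le] at hsplit
  rw [heatPot₂, heatPot₂, ← integral_sub hix hiy, hsplit]
  refine (norm_add_le _ _).trans ((add_le_add hA hB).trans_eq ?_)
  ring

theorem heatPot_trace (h0 : 0 < α) (h1 : α < 1) (hF : BddHolder α F M N) (hN : 0 ≤ N)
    {ι : Type*} [Fintype ι] (b : OrthonormalBasis ι ℝ E) (x : E) :
    heatPot F x - ∑ i, heatPot₂ F x (b i) (b i) = F x := by
  have hFc := hF.continuous h0
  have hi := heatPot₂_integrable h0 h1 hF hN x
  have hW : IntegrableOn (fun s => (s * Real.exp (-(1 / 2) * s ^ 2)) •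
      dilAvg (gaussian E) F x s) (Ioi 0) :=
    integrableOn_smul_dilAvg hFc hF.bound _ (continuous_id.mul continuous_expSq).continuousOn
      (integrableOn_mul_expSq.const_mul _) x fun s hs => heatPot_integrand_bound hF.bound x hs
  have htr : ∀ s : ℝ, ∑ i, dilAvg (gaussian₂ E) F x s (b i) (b i) =
      -dilAvg (eulerWeight (gaussian E)) F x s := by
    intro s
    have h_integ := integrable_dilAvg hFc hF.bound (gaussian₂ E) x s
    have e1 : ∀ v : E, dilAvg (gaussian₂ E) F x s v v =
        ∫ y, F (x + s • y) * gaussian₂ E y v v := fun v => by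
      rw [dilAvg, ContinuousLinearMap.integral_apply h_integ,
        ContinuousLinearMap.integral_apply (h_integ.apply_continuousLinearMap v)]
      rfl
    simp only [e1]
    rw [← integral_finsetSum, dilAvg, ← integral_neg]
    · refine integral_congr_ae (Eventually.of_forall fun y => ?_)
      simp only
      rw [← Finset.mul_sum, smul_eq_mul, ← mul_neg, ← sum_fderiv_fderiv_gaussian b]
      rfl
    · intro i _
      exact (h_integ.apply_continuousLinearMap (b i)).apply_continuousLinearMap (b i)
  have hsum : ∑ i, heatPot₂ F x (b i) (b i) =
      ∫ s in Ioi 0, -((s⁻¹ * Real.exp (-(1 / 2) * s ^ 2)) *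
        dilAvg (eulerWeight (gaussian E)) F x s) := by
    have e1 : ∀ v : E, heatPot₂ F x v v = ∫ s in Ioi 0,
        (s⁻¹ * Real.exp (-(1 / 2) * s ^ 2)) * dilAvg (gaussian₂ E) F x s v v := fun v => by
      rw [heatPot₂, ContinuousLinearMap.integral_apply hi,
        ContinuousLinearMap.integral_apply (hi.apply_continuousLinearMap v)]
      rfl
    simp only [e1]
    rw [← integral_finsetSum]
    · refine integral_congr_ae (Eventually.of_forall fun s => ?_)
      simp only
      rw [← Finset.mul_sum, htr s, mul_neg]
    · intro i _
      exact (hi.apply_continuousLinearMap (b i)).apply_continuousLinearMap (b i)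
  have hsumi : IntegrableOn (fun s => -((s⁻¹ * Real.exp (-(1 / 2) * s ^ 2)) *
        dilAvg (eulerWeight (gaussian E)) F x s)) (Ioi 0) := by
    have := integrable_finsetSum (Finset.univ) fun i _ =>
      (hi.apply_continuousLinearMap (b i)).apply_continuousLinearMap (b i)
    refine this.congr (Eventually.of_forall fun s => ?_)
    simp only
    rw [← mul_neg, ← htr s, Finset.mul_sum]
    rfl
  have hderiv : ∀ s ∈ Ioi (0 : ℝ), HasDerivAt
      (fun s => -(Real.exp (-(1 / 2) * s ^ 2) * dilAvg (gaussian E) F x s))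
      ((s * Real.exp (-(1 / 2) * s ^ 2)) • dilAvg (gaussian E) F x s -
        -((s⁻¹ * Real.exp (-(1 / 2) * s ^ 2)) * dilAvg (eulerWeight (gaussian E)) F x s)) s := by
    intro s hs
    have d1 : HasDerivAt (fun s : ℝ => Real.exp (-(1 / 2) * s ^ 2))
        (Real.exp (-(1 / 2) * s ^ 2) * (-(1 / 2) * (2 * s))) s := by
      have := (((hasDerivAt_id s).pow 2).const_mul (-(1 / 2))).exp
      refine this.congr_deriv ?_
      simp
    refine (d1.mul (dilAvg_hasDerivAt_right hFc hF.bound (gaussian E) x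
      (ne_of_gt hs))).neg.congr_deriv ?_
    simp only [smul_eq_mul]
    ring
  have hq0 : dilAvg (gaussian E) F x 0 = F x := by
    simp [dilAvg, integral_const_mul, integral_gaussian]
  have hcont : ContinuousWithinAt
      (fun s => -(Real.exp (-(1 / 2) * s ^ 2) * dilAvg (gaussian E) F x s)) (Ici 0) 0 := by
    refine (continuous_expSq.continuousWithinAt.mul ?_).neg
    rw [ContinuousWithinAt, hq0, tendsto_iff_norm_sub_tendsto_zero]
    have hz : Tendsto (fun s : ℝ => N * s ^ α * mass (gaussian E)) (𝓝[Ici 0] 0) (𝓝 0) := by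
      have h1 : Continuous fun s : ℝ => N * s ^ α * mass (gaussian E) :=
        (continuous_const.mul (continuous_id.rpow_const fun _ => Or.inr h0.le)).mul continuous_const
      have := (h1.tendsto 0).mono_left (nhdsWithin_le_nhds (s := Ici (0 : ℝ)))
      simpa [Real.zero_rpow h0.ne'] using this
    refine squeeze_zero' (Eventually.of_forall fun _ => norm_nonneg _) ?_ hz
    filter_upwards [self_mem_nhdsWithin] with s hs
    have := norm_dilAvg_sub_le h0 h1 hF hN (gaussian E) x hs
    rwa [integral_gaussian, smul_eq_mul, mul_one] at this
  have hlim : Tendsto (fun s => -(Real.exp (-(1 / 2) * s ^ 2) * dilAvg (gaussian E) F x s))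
      atTop (𝓝 0) := by
    have hexp : Tendsto (fun s : ℝ => Real.exp (-(1 / 2) * s ^ 2)) atTop (𝓝 0) := by
      refine Real.tendsto_exp_atBot.comp ?_
      exact (tendsto_pow_atTop two_ne_zero).const_mul_atTop_of_neg (by norm_num)
    refine squeeze_zero_norm (fun s => ?_) (by simpa only [zero_mul] using hexp.mul_const (M * mass (gaussian E)))
    rw [norm_neg, norm_mul, Real.norm_of_nonneg (by positivity)]
    gcongr
    exact norm_dilAvg_le _ hF.bound x s
  have hFTC := integral_Ioi_of_hasDerivAt_of_tendsto hcont hderiv (hW.sub hsumi) hlim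
  rw [heatPot, hsum, ← integral_sub hW hsumi, hFTC, hq0]
  simp

variable (E) in
theorem whole_space_solver (h0 : 0 < α) (h1 : α < 1) : ∃ C, 0 ≤ C ∧ ∀ (F : E → ℝ) (N : ℝ),
    BddHolder α F N N → ∃ W : E → ℝ, C2B α W (C * N) (C * N) (C * N) (C * N) ∧
      ∀ {ι : Type} [Fintype ι] (b : OrthonormalBasis ι ℝ E) (x : E),
        W x - ∑ i, fderiv ℝ (fderiv ℝ W) x (b i) (b i) = F x := by
  set c₀ := ∫ s in Ioi (0 : ℝ), mass (gaussian E) * (s * Real.exp (-(1 / 2) * s ^ 2)) with hc₀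
  set c₁ := ∫ s in Ioi (0 : ℝ), mass (gaussian₁ E) * (Real.exp (-(1 / 2) * s ^ 2)) with hc₁
  set c₂ := ∫ s in Ioi (0 : ℝ), mass (gaussian₂ E) * (s ^ (α - 1) *
    Real.exp (-(1 / 2) * s ^ 2)) with hc₂
  set c₃ := 2 * mass (gaussian₂ E) / α +
        mass (SchwartzMap.fderivCLM ℝ E _ (gaussian₂ E)) / (1 - α) with hc₃
  have p₀ : 0 ≤ c₀ := setIntegral_nonneg measurableSet_Ioi fun s hs => by
    have := mass_nonneg (gaussian E); have : 0 < s := hs; positivity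
  have p₁ : 0 ≤ c₁ := setIntegral_nonneg measurableSet_Ioi fun s hs => by
    have := mass_nonneg (gaussian₁ E); positivity
  have p₂ : 0 ≤ c₂ := setIntegral_nonneg measurableSet_Ioi fun s hs => by
    have := mass_nonneg (gaussian₂ E); have : 0 < s := hs; positivity
  have p₃ : 0 ≤ c₃ := by
    have := mass_nonneg (gaussian₂ E)
    have := mass_nonneg (SchwartzMap.fderivCLM ℝ E _ (gaussian₂ E))
    have : 0 < 1 - α := by linarith
    positivity
  refine ⟨c₀ + c₁ + c₂ + c₃, by positivity, fun F N hF => ⟨heatPot F, ?_, fun {ι} _ b x => ?_⟩⟩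
  · have hN := hF.M_nonneg
    refine C2B.of_hasFDerivAt h0 (fun x => hasFDerivAt_heatPot h0 hF x)
      (fun x => hasFDerivAt_heatPot₁ h0 h1 hF hN x) (fun x => ?_) (fun x => ?_) (fun x => ?_)
      fun x y => ?_
    · have : |heatPot F x| ≤ c₀ * N := by
        rw [hc₀, mul_comm, ← integral_const_mul, ← Real.norm_eq_abs]
        refine norm_integral_le_of_norm_le
          ((integrableOn_mul_expSq.const_mul _).const_mul _)
          ((ae_restrict_mem measurableSet_Ioi).mono fun s hs => ?_)
        rw [← mul_assoc]
        exact heatPot_integrand_bound hF.bound x hs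
      exact this.trans (by gcongr; linarith)
    · have : ‖heatPot₁ F x‖ ≤ c₁ * N := by
        rw [hc₁, mul_comm, ← integral_const_mul]
        refine norm_integral_le_of_norm_le
          ((integrableOn_expSq.const_mul _).const_mul _)
          ((ae_restrict_mem measurableSet_Ioi).mono fun s hs => ?_)
        rw [← mul_assoc]
        exact heatPot₁_integrand_bound hF.bound x s
      exact this.trans (by gcongr; linarith)
    · have : ‖heatPot₂ F x‖ ≤ c₂ * N := by
        rw [hc₂, mul_comm, ← integral_const_mul]
        refine norm_integral_le_of_norm_le
          (((integrableOn_rpow_mul_expSq (by linarith)).const_mul _).const_mul _)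
          ((ae_restrict_mem measurableSet_Ioi).mono fun s hs => ?_)
        rw [← mul_assoc]
        exact heatPot₂_integrand_bound h0 h1 hF hN x hs
      exact this.trans (by gcongr; linarith)
    · refine (heatPot₂_holder h0 h1 hF hN x y).trans ?_
      rw [mul_comm N, ← hc₃]
      gcongr ?_ * N * _
      linarith
  · have e1 : fderiv ℝ (heatPot F) = heatPot₁ F :=
      funext fun x => (hasFDerivAt_heatPot h0 hF x).fderiv
    have e2 : fderiv ℝ (heatPot₁ F) = heatPot₂ F :=
      funext fun x => (hasFDerivAt_heatPot₁ h0 h1 hF hF.M_nonneg x).fderiv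
    rw [e1, e2]
    exact heatPot_trace h0 h1 hF hF.M_nonneg b x

end WholeSpace

section Calculus

set_option linter.unusedSectionVars false

variable {X Y : Type} [NormedAddCommGroup X] [NormedSpace ℝ X]
  [NormedAddCommGroup Y] [NormedSpace ℝ Y]
  {G G₁ G₂ G₃ : Type} [NormedAddCommGroup G] [NormedSpace ℝ G]
  [NormedAddCommGroup G₁] [NormedSpace ℝ G₁]
  [NormedAddCommGroup G₂] [NormedSpace ℝ G₂]
  [NormedAddCommGroup G₃] [NormedSpace ℝ G₃]

/-- `f` is bounded by `A` and `α`-Hölder with constant `B` on the set `S`. -/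
structure HB (α : ℝ) (S : Set X) (f : X → G) (A B : ℝ) : Prop where
  bd : ∀ x ∈ S, ‖f x‖ ≤ A
  hd : ∀ x ∈ S, ∀ y ∈ S, ‖f x - f y‖ ≤ B * ‖x - y‖ ^ α

variable {α : ℝ} {S U : Set X}

theorem HB.mono {f : X → G} {A B A' B' : ℝ} (h : HB α S f A B) (hA : A ≤ A') (hB : B ≤ B') :
    HB α S f A' B' :=
  ⟨fun x hx => (h.bd x hx).trans hA, fun x hx y hy => (h.hd x hx y hy).trans (by gcongr)⟩

theorem HB.subset {f : X → G} {A B : ℝ} (h : HB α S f A B) (hU : U ⊆ S) : HB α U f A B :=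
  ⟨fun x hx => h.bd x (hU hx), fun x hx y hy => h.hd x (hU hx) y (hU hy)⟩

theorem HB.congr {f g : X → G} {A B : ℝ} (h : HB α S f A B) (hg : ∀ x ∈ S, g x = f x) :
    HB α S g A B :=
  ⟨fun x hx => by rw [hg x hx]; exact h.bd x hx,
    fun x hx y hy => by rw [hg x hx, hg y hy]; exact h.hd x hx y hy⟩

theorem HB.add {f g : X → G} {A B A' B' : ℝ} (hf : HB α S f A B) (hg : HB α S g A' B') :
    HB α S (fun x => f x + g x) (A + A') (B + B') := by
  refine ⟨fun x hx => (norm_add_le _ _).trans (add_le_add (hf.bd x hx) (hg.bd x hx)),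
    fun x hx y hy => ?_⟩
  rw [add_sub_add_comm, add_mul]
  exact (norm_add_le _ _).trans (add_le_add (hf.hd x hx y hy) (hg.hd x hx y hy))

theorem HB.neg {f : X → G} {A B : ℝ} (hf : HB α S f A B) : HB α S (fun x => -f x) A B := by
  refine ⟨fun x hx => by rw [norm_neg]; exact hf.bd x hx, fun x hx y hy => ?_⟩
  rw [← neg_sub', norm_neg]
  exact hf.hd x hx y hy

theorem HB.sub {f g : X → G} {A B A' B' : ℝ} (hf : HB α S f A B) (hg : HB α S g A' B') :
    HB α S (fun x => f x - g x) (A + A') (B + B') := by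
  simpa only [sub_eq_add_neg] using hf.add hg.neg

theorem HB.sum {ι : Type} (s : Finset ι) {f : ι → X → G} {A B : ι → ℝ}
    (hf : ∀ i ∈ s, HB α S (f i) (A i) (B i)) :
    HB α S (fun x => ∑ i ∈ s, f i x) (∑ i ∈ s, A i) (∑ i ∈ s, B i) := by
  refine ⟨fun x hx => (norm_sum_le _ _).trans (Finset.sum_le_sum fun i hi => (hf i hi).bd x hx),
    fun x hx y hy => ?_⟩
  rw [← Finset.sum_sub_distrib, Finset.sum_mul]
  exact (norm_sum_le _ _).trans (Finset.sum_le_sum fun i hi => (hf i hi).hd x hx y hy)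

theorem HB.A_nonneg {f : X → G} {A B : ℝ} (hf : HB α S f A B) {x : X} (hx : x ∈ S) : 0 ≤ A :=
  (norm_nonneg _).trans (hf.bd x hx)

theorem HB.const (c : G) : HB α S (fun _ => c) ‖c‖ 0 :=
  ⟨fun _ _ => le_rfl, fun _ _ _ _ => by simp⟩

/-- Bilinear products; the first factor may vanish off a set `U` on which only the second factor is
controlled. -/
theorem HB.cut (L : G₁ →L[ℝ] G₂ →L[ℝ] G₃) (hL : ‖L‖ ≤ 1) {f : X → G₁} {g : X → G₂}
    {A B A' B' : ℝ} (hB : 0 ≤ B) (hB' : 0 ≤ B') (hA' : 0 ≤ A') (hf : HB α S f A B)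
    (hg : HB α (S ∩ U) g A' B')
    (hU : ∀ x ∈ S, x ∉ U → f x = 0) :
    HB α S (fun x => L (f x) (g x)) (A * A') (B * A' + A * B') := by
  have hLe : ∀ a b, ‖L a b‖ ≤ ‖a‖ * ‖b‖ := fun a b =>
    (L.le_opNorm₂ a b).trans (by
      rw [mul_assoc]; exact mul_le_of_le_one_left (by positivity) hL)
  have key : ∀ x ∈ S, ∀ y ∈ S, x ∈ U → y ∉ U →
      ‖L (f x) (g x)‖ ≤ (B * A' + A * B') * ‖x - y‖ ^ α := fun x hx y hy hxU hyU => by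
    have h1 := hf.hd x hx y hy
    rw [hU y hy hyU, sub_zero] at h1
    have hA := hf.A_nonneg hx
    calc _ ≤ ‖f x‖ * ‖g x‖ := hLe _ _
      _ ≤ (B * ‖x - y‖ ^ α) * A' := by gcongr; exact hg.bd x ⟨hx, hxU⟩
      _ = (B * A' + 0) * ‖x - y‖ ^ α := by ring
      _ ≤ _ := by gcongr; positivity
  refine ⟨fun x hx => ?_, fun x hx y hy => ?_⟩
  · have hA := hf.A_nonneg hx
    by_cases hxU : x ∈ U
    · exact (hLe _ _).trans (mul_le_mul (hf.bd x hx) (hg.bd x ⟨hx, hxU⟩) (norm_nonneg _) hA)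
    · simp [hU x hx hxU]; positivity
  · have hA := hf.A_nonneg hx
    by_cases hxU : x ∈ U <;> by_cases hyU : y ∈ U
    · have e : L (f x) (g x) - L (f y) (g y) = L (f x - f y) (g x) + L (f y) (g x - g y) := by
        simp
      rw [e]
      calc _ ≤ ‖f x - f y‖ * ‖g x‖ + ‖f y‖ * ‖g x - g y‖ :=
            (norm_add_le _ _).trans (add_le_add (hLe _ _) (hLe _ _))
        _ ≤ (B * ‖x - y‖ ^ α) * A' + A * (B' * ‖x - y‖ ^ α) := by
            gcongr
            · exact hf.hd x hx y hy
            · exact hg.bd x ⟨hx, hxU⟩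
            · exact hf.bd y hy
            · exact hg.hd x ⟨hx, hxU⟩ y ⟨hy, hyU⟩
        _ = _ := by ring
    · simpa [hU y hy hyU] using key x hx y hy hxU hyU
    · simpa [hU x hx hxU, norm_sub_rev] using key y hy x hx hyU hxU
    · simp [hU x hx hxU, hU y hy hyU]; positivity

theorem rpow_le_of_lipschitz (h0 : 0 < α) (h1 : α < 1) {d A L t : ℝ} (hA : 0 ≤ A) (hL : 0 ≤ L)
    (ht : 0 ≤ t) (hd : d ≤ 2 * A) (hd' : d ≤ L * t) : d ≤ (2 * A + L) * t ^ α := by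
  rcases le_total t 1 with h | h
  · have : t ≤ t ^ α := by
      simpa using Real.rpow_le_rpow_of_exponent_ge' ht h h0.le h1.le
    nlinarith [Real.rpow_nonneg ht α, mul_le_mul_of_nonneg_left this hL]
  · have : 1 ≤ t ^ α := Real.one_le_rpow h h0.le
    nlinarith

theorem HB.of_lipschitz (h0 : 0 < α) (h1 : α < 1) {f : X → G} {A L : ℝ} (hL : 0 ≤ L)
    (hb : ∀ x ∈ S, ‖f x‖ ≤ A) (hl : ∀ x ∈ S, ∀ y ∈ S, ‖f x - f y‖ ≤ L * ‖x - y‖) :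
    HB α S f A (2 * A + L) :=
  ⟨hb, fun x hx y hy => rpow_le_of_lipschitz h0 h1 ((norm_nonneg _).trans (hb x hx)) hL
    (norm_nonneg _) ((norm_sub_le _ _).trans (by linarith [hb x hx, hb y hy])) (hl x hx y hy)⟩

theorem HB.of_fderiv (h0 : 0 < α) (h1 : α < 1) (hU : IsOpen U) (hc : Convex ℝ U) {f : X → G}
    {A L : ℝ} (hL : 0 ≤ L) (hf : DifferentiableOn ℝ f U)
    (hb : ∀ x ∈ U, ‖f x‖ ≤ A) (hl : ∀ x ∈ U, ‖fderiv ℝ f x‖ ≤ L) : HB α U f A (2 * A + L) :=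
  HB.of_lipschitz h0 h1 hL hb fun _ hx _ hy =>
    hc.norm_image_sub_le_of_norm_fderiv_le (fun z hz => (hf z hz).differentiableAt (hU.mem_nhds hz))
      hl hy hx

theorem HB.comp {f : Y → G} {T : Set Y} {A B κ : ℝ} (hα : 0 ≤ α) (hB : 0 ≤ B) (hκ : 0 ≤ κ)
    (hf : HB α T f A B) {p : X → Y} (hp : MapsTo p S T)
    (hl : ∀ x ∈ S, ∀ y ∈ S, ‖p x - p y‖ ≤ κ * ‖x - y‖) :
    HB α S (fun x => f (p x)) A (B * κ ^ α) := by
  refine ⟨fun x hx => hf.bd _ (hp hx), fun x hx y hy => (hf.hd _ (hp hx) _ (hp hy)).trans ?_⟩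
  rw [mul_assoc, ← Real.mul_rpow hκ (norm_nonneg _)]
  gcongr
  exact hl x hx y hy

/-! ### Second derivatives of products and compositions -/

theorem differentiableAt_of_contDiffAt_two {u : X → G} {x : X} (hu : ContDiffAt ℝ 2 u x) :
    DifferentiableAt ℝ u x := hu.differentiableAt (by norm_num)

theorem differentiableAt_fderiv {u : X → G} {x : X} (hu : ContDiffAt ℝ 2 u x) :
    DifferentiableAt ℝ (fderiv ℝ u) x :=
  (hu.fderiv_right (m := 1) (by norm_num)).differentiableAt (by norm_num)

theorem eventually_contDiffAt {u : X → G} {x : X} (hu : ContDiffAt ℝ 2 u x) :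
    ∀ᶠ y in 𝓝 x, ContDiffAt ℝ 2 u y := hu.eventually (by simp)

theorem fderiv_fderiv_mul {χ g : X → ℝ} {x : X} (hχ : ContDiffAt ℝ 2 χ x)
    (hg : ContDiffAt ℝ 2 g x) :
    fderiv ℝ (fderiv ℝ fun y => χ y * g y) x =
      χ x • fderiv ℝ (fderiv ℝ g) x + (fderiv ℝ χ x).smulRight (fderiv ℝ g x) +
        (g x • fderiv ℝ (fderiv ℝ χ) x + (fderiv ℝ g x).smulRight (fderiv ℝ χ x)) := by
  have h : fderiv ℝ (fun y => χ y * g y) =ᶠ[𝓝 x]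
      fun y => χ y • fderiv ℝ g y + g y • fderiv ℝ χ y := by
    filter_upwards [eventually_contDiffAt hχ, eventually_contDiffAt hg] with y h1 h2
    exact fderiv_fun_mul (differentiableAt_of_contDiffAt_two h1)
      (differentiableAt_of_contDiffAt_two h2)
  rw [h.fderiv_eq]
  have d1 := (differentiableAt_of_contDiffAt_two hχ).hasFDerivAt
  have d2 := (differentiableAt_of_contDiffAt_two hg).hasFDerivAt
  exact ((d1.smul (differentiableAt_fderiv hg).hasFDerivAt).add
    (d2.smul (differentiableAt_fderiv hχ).hasFDerivAt)).fderiv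

theorem fderiv_fderiv_comp {u : Y → G} {p : X → Y} {x : X} (hu : ContDiffAt ℝ 2 u (p x))
    (hp : ContDiffAt ℝ 2 p x) (h k : X) :
    fderiv ℝ (fderiv ℝ fun y => u (p y)) x h k =
      fderiv ℝ (fderiv ℝ u) (p x) (fderiv ℝ p x h) (fderiv ℝ p x k) +
        fderiv ℝ u (p x) (fderiv ℝ (fderiv ℝ p) x h k) := by
  have hev : fderiv ℝ (fun y => u (p y)) =ᶠ[𝓝 x]
      fun y => (fderiv ℝ u (p y)).comp (fderiv ℝ p y) := by
    filter_upwards [eventually_contDiffAt hp,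
      hp.continuousAt.eventually (eventually_contDiffAt hu)] with y h1 h2
    exact fderiv_comp y (differentiableAt_of_contDiffAt_two h2)
      (differentiableAt_of_contDiffAt_two h1)
  rw [hev.fderiv_eq]
  have d1 := (differentiableAt_fderiv hu).hasFDerivAt.comp x
    (differentiableAt_of_contDiffAt_two hp).hasFDerivAt
  have d2 := (differentiableAt_fderiv hp).hasFDerivAt
  have := (d1.clm_comp d2).fderiv
  simp only [Function.comp_def] at this
  rw [this]
  simp [add_comm]

theorem fderiv_fderiv_comp_clm {u : Y → G} (L : X →L[ℝ] Y) (hu : ContDiff ℝ 2 u) (x h k : X) :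
    fderiv ℝ (fderiv ℝ fun y => u (L y)) x h k = fderiv ℝ (fderiv ℝ u) (L x) (L h) (L k) := by
  rw [fderiv_fderiv_comp hu.contDiffAt L.contDiff.contDiffAt]
  have : fderiv ℝ (fun y => L y) = fun _ => L := funext fun y => L.fderiv
  simp [this, L.fderiv]

/-! ### Algebra of `C2B` -/

variable {u v : X → ℝ} {A₀ A₁ A₂ A₃ B₀ B₁ B₂ B₃ : ℝ}

theorem C2B.mono (hu : C2B α u A₀ A₁ A₂ A₃) (h0 : A₀ ≤ B₀) (h1 : A₁ ≤ B₁) (h2 : A₂ ≤ B₂)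
    (h3 : A₃ ≤ B₃) : C2B α u B₀ B₁ B₂ B₃ :=
  ⟨hu.contDiff, fun x => (hu.b0 x).trans h0, fun x => (hu.b1 x).trans h1,
    fun x => (hu.b2 x).trans h2, fun x y => (hu.b3 x y).trans (by gcongr)⟩

theorem C2B.fderiv_contDiff (hu : C2B α u A₀ A₁ A₂ A₃) : ContDiff ℝ 1 (fderiv ℝ u) :=
  hu.contDiff.fderiv_right (by norm_num)

theorem C2B.differentiable (hu : C2B α u A₀ A₁ A₂ A₃) : Differentiable ℝ u :=
  hu.contDiff.differentiable (by norm_num)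

theorem C2B.differentiable_fderiv (hu : C2B α u A₀ A₁ A₂ A₃) : Differentiable ℝ (fderiv ℝ u) :=
  hu.fderiv_contDiff.differentiable (by norm_num)

theorem C2B.fderiv_add (hu : C2B α u A₀ A₁ A₂ A₃) (hv : C2B α v B₀ B₁ B₂ B₃) :
    fderiv ℝ (fun x => u x + v x) = fun x => fderiv ℝ u x + fderiv ℝ v x :=
  funext fun x => fderiv_fun_add (hu.differentiable x) (hv.differentiable x)

theorem C2B.fderiv_fderiv_add (hu : C2B α u A₀ A₁ A₂ A₃) (hv : C2B α v B₀ B₁ B₂ B₃) :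
    fderiv ℝ (fderiv ℝ (fun x => u x + v x)) =
      fun x => fderiv ℝ (fderiv ℝ u) x + fderiv ℝ (fderiv ℝ v) x := by
  rw [hu.fderiv_add hv]
  exact funext fun x => fderiv_fun_add (hu.differentiable_fderiv x) (hv.differentiable_fderiv x)

theorem C2B.add (hu : C2B α u A₀ A₁ A₂ A₃) (hv : C2B α v B₀ B₁ B₂ B₃) :
    C2B α (fun x => u x + v x) (A₀ + B₀) (A₁ + B₁) (A₂ + B₂) (A₃ + B₃) := by
  refine ⟨hu.contDiff.add hv.contDiff, fun x => ?_, fun x => ?_, fun x => ?_, fun x y => ?_⟩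
  · exact (abs_add_le _ _).trans (add_le_add (hu.b0 x) (hv.b0 x))
  · rw [hu.fderiv_add hv]
    exact (norm_add_le _ _).trans (add_le_add (hu.b1 x) (hv.b1 x))
  · rw [hu.fderiv_fderiv_add hv]
    exact (norm_add_le _ _).trans (add_le_add (hu.b2 x) (hv.b2 x))
  · rw [hu.fderiv_fderiv_add hv, add_sub_add_comm, add_mul]
    exact (norm_add_le _ _).trans (add_le_add (hu.b3 x y) (hv.b3 x y))

theorem C2B.fderiv_smul (hu : C2B α u A₀ A₁ A₂ A₃) (c : ℝ) :
    fderiv ℝ (fun x => c * u x) = fun x => c • fderiv ℝ u x :=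
  funext fun x => fderiv_const_mul (hu.differentiable x) c

theorem C2B.fderiv_fderiv_smul (hu : C2B α u A₀ A₁ A₂ A₃) (c : ℝ) :
    fderiv ℝ (fderiv ℝ (fun x => c * u x)) = fun x => c • fderiv ℝ (fderiv ℝ u) x := by
  rw [hu.fderiv_smul c]
  exact funext fun x => fderiv_fun_const_smul (hu.differentiable_fderiv x) c

theorem C2B.smul (hu : C2B α u A₀ A₁ A₂ A₃) (c : ℝ) :
    C2B α (fun x => c * u x) (|c| * A₀) (|c| * A₁) (|c| * A₂) (|c| * A₃) := by
  refine ⟨contDiff_const.mul hu.contDiff, fun x => ?_, fun x => ?_, fun x => ?_, fun x y => ?_⟩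
  · rw [abs_mul]; gcongr; exact hu.b0 x
  · rw [hu.fderiv_smul, norm_smul, Real.norm_eq_abs]; gcongr; exact hu.b1 x
  · rw [hu.fderiv_fderiv_smul, norm_smul, Real.norm_eq_abs]; gcongr; exact hu.b2 x
  · rw [hu.fderiv_fderiv_smul, ← smul_sub, norm_smul, Real.norm_eq_abs, mul_assoc]
    gcongr; exact hu.b3 x y

theorem C2B.zero : C2B α (fun _ : X => (0 : ℝ)) 0 0 0 0 := by
  have : fderiv ℝ (fun _ : X => (0 : ℝ)) = fun _ => 0 := funext fun x => by simp
  refine ⟨contDiff_const, ?_, ?_, ?_, ?_⟩ <;> simp [this]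

theorem C2B.sum {ι : Type} (s : Finset ι) {u : ι → X → ℝ} {A₀ A₁ A₂ A₃ : ι → ℝ}
    (hu : ∀ i ∈ s, C2B α (u i) (A₀ i) (A₁ i) (A₂ i) (A₃ i)) :
    C2B α (fun x => ∑ i ∈ s, u i x) (∑ i ∈ s, A₀ i) (∑ i ∈ s, A₁ i) (∑ i ∈ s, A₂ i)
      (∑ i ∈ s, A₃ i) := by
  classical
  induction s using Finset.induction_on with
  | empty => simpa using C2B.zero
  | insert i s hi ih =>
    simp only [Finset.sum_insert hi]
    exact (hu i (Finset.mem_insert_self _ _)).add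
      (ih fun j hj => hu j (Finset.mem_insert_of_mem hj))

theorem C2B.comp_clm {u : Y → ℝ} (hu : C2B α u A₀ A₁ A₂ A₃) (hα : 0 ≤ α) (h3 : 0 ≤ A₃)
    (L : X →L[ℝ] Y) {κ : ℝ} (hL : ‖L‖ ≤ κ) :
    C2B α (fun x => u (L x)) A₀ (κ * A₁) (κ ^ 2 * A₂) (κ ^ 2 * κ ^ α * A₃) := by
  have hκ : 0 ≤ κ := (norm_nonneg _).trans hL
  have hLx : ∀ x, ‖L x‖ ≤ κ * ‖x‖ := fun x => L.le_of_opNorm_le hL x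
  have key : ∀ (T : Y →L[ℝ] Y →L[ℝ] ℝ) (M : ℝ), ‖T‖ ≤ M → ∀ h k, ‖T (L h) (L k)‖ ≤
      κ ^ 2 * M * ‖h‖ * ‖k‖ := fun T M hT h k => by
    have hM := (norm_nonneg _).trans hT
    calc _ ≤ ‖T‖ * ‖L h‖ * ‖L k‖ := T.le_opNorm₂ _ _
      _ ≤ M * (κ * ‖h‖) * (κ * ‖k‖) := by gcongr <;> apply hLx
      _ = _ := by ring
  refine ⟨hu.contDiff.comp L.contDiff, fun x => hu.b0 _, fun x => ?_, fun x => ?_, fun x y => ?_⟩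
  · have : fderiv ℝ (fun x => u (L x)) x = (fderiv ℝ u (L x)).comp L :=
      ((hu.differentiable (L x)).hasFDerivAt.comp x L.hasFDerivAt).fderiv
    rw [this, mul_comm]
    exact (ContinuousLinearMap.opNorm_comp_le _ _).trans
      (mul_le_mul (hu.b1 _) hL (norm_nonneg _) ((norm_nonneg _).trans (hu.b1 (L x))))
  · have := (norm_nonneg _).trans (hu.b2 (L x))
    refine ContinuousLinearMap.opNorm_le_bound₂ _ (by positivity) fun h k => ?_
    rw [fderiv_fderiv_comp_clm L hu.contDiff]
    exact key _ _ (hu.b2 _) h k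
  · have hb := hu.b3 (L x) (L y)
    refine ContinuousLinearMap.opNorm_le_bound₂ _ (by positivity) fun h k => ?_
    rw [_root_.sub_apply, _root_.sub_apply, fderiv_fderiv_comp_clm L hu.contDiff, fderiv_fderiv_comp_clm L hu.contDiff,
      ← _root_.sub_apply, ← _root_.sub_apply]
    refine (key _ _ hb h k).trans ?_
    have : ‖L x - L y‖ ≤ κ * ‖x - y‖ := by rw [← map_sub]; exact hLx _
    calc _ ≤ κ ^ 2 * (A₃ * (κ * ‖x - y‖) ^ α) * ‖h‖ * ‖k‖ := by gcongr
      _ = _ := by rw [Real.mul_rpow hκ (norm_nonneg _)]; ring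

theorem C2B.HB_fun (h0 : 0 < α) (h1 : α < 1) (hu : C2B α u A₀ A₁ A₂ A₃) :
    HB α univ u A₀ (2 * A₀ + A₁) :=
  HB.of_fderiv h0 h1 isOpen_univ convex_univ ((norm_nonneg _).trans (hu.b1 0))
    hu.differentiable.differentiableOn (fun x _ => hu.b0 x) fun x _ => hu.b1 x

theorem C2B.HB_fderiv (h0 : 0 < α) (h1 : α < 1) (hu : C2B α u A₀ A₁ A₂ A₃) :
    HB α univ (fderiv ℝ u) A₁ (2 * A₁ + A₂) :=
  HB.of_fderiv h0 h1 isOpen_univ convex_univ ((norm_nonneg _).trans (hu.b2 0))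
    hu.differentiable_fderiv.differentiableOn (fun x _ => hu.b1 x) fun x _ => hu.b2 x

theorem C2B.HB_fderiv_fderiv (hu : C2B α u A₀ A₁ A₂ A₃) :
    HB α univ (fderiv ℝ (fderiv ℝ u)) A₂ A₃ := ⟨fun x _ => hu.b2 x, fun x _ y _ => hu.b3 x y⟩

/-- Multiplying a function with `C^{2,α}` bounds on an open convex set by a cutoff. -/
theorem C2B.cutoff (h0 : 0 < α) (h1 : α < 1) (hU : IsOpen U) (hc : Convex ℝ U) {χ g : X → ℝ}
    {c B : ℝ} (hc0 : 0 ≤ c) (hB : 0 ≤ B) (hχ : C2B α χ c c c c) (hs : tsupport χ ⊆ U)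
    (hg : ContDiffOn ℝ 2 g U)
    (g0 : ∀ x ∈ U, |g x| ≤ B) (g1 : ∀ x ∈ U, ‖fderiv ℝ g x‖ ≤ B)
    (g2 : HB α U (fderiv ℝ (fderiv ℝ g)) B B) :
    C2B α (fun x => χ x * g x) (24 * c * B) (24 * c * B) (24 * c * B) (24 * c * B) := by
  have hgx : ∀ x ∈ U, ContDiffAt ℝ 2 g x := fun x hx => hg.contDiffAt (hU.mem_nhds hx)
  have hz : ∀ x ∉ U, χ =ᶠ[𝓝 x] fun _ => 0 := fun x hx =>
    notMem_tsupport_iff_eventuallyEq.1 fun h => hx (hs h)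
  have hz0 : ∀ x ∉ U, χ x = 0 := fun x hx => (hz x hx).eq_of_nhds
  have hc0' : fderiv ℝ (fun _ : X => (0 : ℝ)) = fun _ => 0 := funext fun x => by simp
  have hz1' : ∀ x ∉ U, fderiv ℝ χ =ᶠ[𝓝 x] fun _ => 0 := fun x hx => by
    rw [← hc0']; exact (hz x hx).fderiv
  have hz1 : ∀ x ∉ U, fderiv ℝ χ x = 0 := fun x hx => (hz1' x hx).eq_of_nhds
  have hz2 : ∀ x ∉ U, fderiv ℝ (fderiv ℝ χ) x = 0 := fun x hx => by
    simpa using (hz1' x hx).fderiv_eq (𝕜 := ℝ)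
  have hpz : ∀ x ∉ U, (fun x => χ x * g x) =ᶠ[𝓝 x] fun _ => 0 := fun x hx => by
    filter_upwards [hz x hx] with y hy; simp [hy]
  have hCD : ContDiff ℝ 2 fun x => χ x * g x := contDiff_iff_contDiffAt.2 fun x => by
    by_cases hx : x ∈ U
    · exact hχ.contDiff.contDiffAt.mul (hgx x hx)
    · exact contDiffAt_const.congr_of_eventuallyEq (hpz x hx)
  have e1 : fderiv ℝ (fun x => χ x * g x) = fun x => χ x • fderiv ℝ g x + g x • fderiv ℝ χ x := by
    funext x
    by_cases hx : x ∈ U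
    · exact fderiv_fun_mul (hχ.differentiable x) (differentiableAt_of_contDiffAt_two (hgx x hx))
    · rw [(hpz x hx).fderiv_eq, hz0 x hx, hz1 x hx]; simp
  have e2 : fderiv ℝ (fderiv ℝ fun x => χ x * g x) = fun x => 
      χ x • fderiv ℝ (fderiv ℝ g) x + (fderiv ℝ χ x).smulRight (fderiv ℝ g x) +
        (g x • fderiv ℝ (fderiv ℝ χ) x + (fderiv ℝ g x).smulRight (fderiv ℝ χ x)) := by
    funext x
    by_cases hx : x ∈ U
    · exact fderiv_fderiv_mul hχ.contDiff.contDiffAt (hgx x hx)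
    · have : fderiv ℝ (fun x => χ x * g x) =ᶠ[𝓝 x] fun _ => 0 := by
        rw [← hc0']; exact (hpz x hx).fderiv
      rw [this.fderiv_eq, hz0 x hx, hz1 x hx, hz2 x hx]; ext; simp
  have G0 : HB α (univ ∩ U) g B (3 * B) := by
    rw [univ_inter]
    exact (HB.of_fderiv h0 h1 hU hc hB (fun x hx => (differentiableAt_of_contDiffAt_two
      (hgx x hx)).differentiableWithinAt) g0 g1).mono le_rfl (by linarith)
  have G1 : HB α (univ ∩ U) (fderiv ℝ g) B (3 * B) := by
    rw [univ_inter]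
    exact (HB.of_fderiv h0 h1 hU hc hB (fun x hx => (differentiableAt_fderiv
      (hgx x hx)).differentiableWithinAt) g1 g2.bd).mono le_rfl (by linarith)
  have G2 : HB α (univ ∩ U) (fderiv ℝ (fderiv ℝ g)) B (3 * B) := by
    rw [univ_inter]
    exact g2.mono le_rfl (by linarith)
  have X0 : HB α univ χ c (3 * c) := (hχ.HB_fun h0 h1).mono le_rfl (by linarith)
  have X1 : HB α univ (fderiv ℝ χ) c (3 * c) := (hχ.HB_fderiv h0 h1).mono le_rfl (by linarith)
  have X2 : HB α univ (fderiv ℝ (fderiv ℝ χ)) c (3 * c) :=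
    hχ.HB_fderiv_fderiv.mono le_rfl (by linarith)
  have hcB : 0 ≤ c * B := by positivity
  have p0 := HB.cut (ContinuousLinearMap.lsmul ℝ ℝ) ContinuousLinearMap.opNorm_lsmul_le
    (by positivity) (by positivity) hB X0 G2 fun x _ hx => hz0 x hx
  have p1 := HB.cut (ContinuousLinearMap.smulRightL ℝ X (X →L[ℝ] ℝ))
    (ContinuousLinearMap.norm_smulRightL_le)
    (by positivity) (by positivity) hB X1 G1 fun x _ hx => hz1 x hx
  have p2 := HB.cut (ContinuousLinearMap.lsmul ℝ ℝ).flip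
    (by rw [ContinuousLinearMap.opNorm_flip]; exact ContinuousLinearMap.opNorm_lsmul_le)
    (by positivity) (by positivity) hB X2 G0 fun x _ hx => hz2 x hx
  have p3 := HB.cut (ContinuousLinearMap.smulRightL ℝ X (X →L[ℝ] ℝ)).flip
    (by rw [ContinuousLinearMap.opNorm_flip]; exact ContinuousLinearMap.norm_smulRightL_le)
    (by positivity) (by positivity) hB X1 G1 fun x _ hx => hz1 x hx
  have q := ((p0.add p1).add (p2.add p3)).mono (A' := 24 * c * B) (B' := 24 * c * B)
    (by linarith) (by linarith)
  refine ⟨hCD, fun x => ?_, fun x => ?_, fun x => ?_, fun x y => ?_⟩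
  · by_cases hx : x ∈ U
    · rw [abs_mul]
      have := mul_le_mul (hχ.b0 x) (g0 x hx) (abs_nonneg _) hc0
      linarith
    · simp [hz0 x hx]; positivity
  · rw [e1]
    by_cases hx : x ∈ U
    · refine (norm_add_le _ _).trans ?_
      rw [norm_smul, norm_smul]
      have := mul_le_mul (hχ.b0 x) (g1 x hx) (norm_nonneg _) hc0
      have := mul_le_mul (g0 x hx) (hχ.b1 x) (norm_nonneg _) hB
      simp only [Real.norm_eq_abs]
      linarith
    · simp [hz0 x hx, hz1 x hx]; positivity
  · rw [e2]; exact q.bd x (mem_univ _)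
  · rw [e2]; exact q.hd x (mem_univ _) y (mem_univ _)

end Calculus

section Corrector

set_option linter.unusedSectionVars false

variable {E : Type} [NormedAddCommGroup E] [InnerProductSpace ℝ E] [FiniteDimensional ℝ E]
  [MeasurableSpace E] [BorelSpace E]
  {G : Type} [NormedAddCommGroup G] [NormedSpace ℝ G] [CompleteSpace G]
  {α : ℝ} {F : E → ℝ} {M N : ℝ}

theorem norm_dilAvg_diag_sub_le (h0 : 0 < α) (h1 : α < 1) (hF : BddHolder α F M N) (hN : 0 ≤ N)
    (ρ : 𝓢(E, G)) (ℓ : E →L[ℝ] ℝ) (hℓ : ‖ℓ‖ ≤ 1) (x x' : E) :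
    ‖dilAvg ρ F x (ℓ x) - dilAvg ρ F x' (ℓ x')‖ ≤ N * ‖x - x'‖ ^ α * mass ρ := by
  rw [dilAvg, dilAvg, ← integral_sub (integrable_dilAvg (hF.continuous h0) hF.bound ρ x _)
    (integrable_dilAvg (hF.continuous h0) hF.bound ρ x' _)]
  simp only [← sub_smul]
  refine norm_integral_smul_le_mass ρ fun y => (hF.holder _ _).trans ?_
  have e : x + ℓ x • y - (x' + ℓ x' • y) = (x - x') + ℓ (x - x') • y := by
    rw [map_sub, sub_smul]; abel
  have h2 : ‖x + ℓ x • y - (x' + ℓ x' • y)‖ ≤ ‖x - x'‖ * (1 + ‖y‖) := by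
    rw [e]
    refine (norm_add_le _ _).trans ?_
    rw [norm_smul, mul_add, mul_one]
    gcongr
    exact (ℓ.le_of_opNorm_le hℓ _).trans (by rw [one_mul])
  have hy : (1 : ℝ) ≤ 1 + ‖y‖ := by linarith [norm_nonneg y]
  calc _ ≤ N * (‖x - x'‖ * (1 + ‖y‖)) ^ α := by gcongr
    _ = N * (‖x - x'‖ ^ α * (1 + ‖y‖) ^ α) := by
        rw [Real.mul_rpow (norm_nonneg _) (by linarith)]
    _ ≤ N * (‖x - x'‖ ^ α * (1 + ‖y‖)) := by
        gcongr
        simpa using Real.rpow_le_rpow_of_exponent_le hy h1.le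
    _ = _ := by ring

theorem dilAvg_zero_right (ρ : 𝓢(E, G)) (F : E → ℝ) (x : E) :
    dilAvg ρ F x 0 = F x • ∫ y, ρ y := by
  simp [dilAvg, integral_smul]

/-- Postcomposition with `g ↦ ℓ ⊗ g`. -/
noncomputable def tensorWeight (ℓ : E →L[ℝ] ℝ) (ρ : 𝓢(E, G)) : 𝓢(E, E →L[ℝ] G) :=
  ρ.postcompCLM (ContinuousLinearMap.smulRightL ℝ E G ℓ)

/-- The weight in the derivative of `x ↦ ℓ x • dilAvg ρ F x (ℓ x)`. -/
noncomputable def diagWeight (ℓ : E →L[ℝ] ℝ) (ρ : 𝓢(E, G)) : 𝓢(E, E →L[ℝ] G) :=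
  tensorWeight ℓ (ρ - eulerWeight ρ) - SchwartzMap.fderivCLM ℝ E G ρ

theorem dilAvg_sub_weight (hF : Continuous F) (hM : ∀ x, |F x| ≤ M) (ρ ρ' : 𝓢(E, G)) (x : E)
    (s : ℝ) : dilAvg (ρ - ρ' : 𝓢(E, G)) F x s = dilAvg ρ F x s - dilAvg ρ' F x s := by
  rw [dilAvg, dilAvg, dilAvg, ← integral_sub (integrable_dilAvg hF hM ρ x s)
    (integrable_dilAvg hF hM ρ' x s)]
  simp only [← smul_sub]; rfl

theorem dilAvg_tensorWeight (hF : Continuous F) (hM : ∀ x, |F x| ≤ M) (ℓ : E →L[ℝ] ℝ)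
    (ρ : 𝓢(E, G)) (x : E) (s : ℝ) :
    dilAvg (tensorWeight ℓ ρ) F x s = ℓ.smulRight (dilAvg ρ F x s) := by
  have e : ∀ g : G, ℓ.smulRight g = ContinuousLinearMap.smulRightL ℝ E G ℓ g := fun _ => rfl
  rw [dilAvg, dilAvg, e, ← ContinuousLinearMap.integral_comp_comm _ (integrable_dilAvg hF hM ρ x s)]
  simp [tensorWeight]

theorem integral_tensorWeight (ℓ : E →L[ℝ] ℝ) (ρ : 𝓢(E, G)) :
    ∫ y, tensorWeight ℓ ρ y = ℓ.smulRight (∫ y, ρ y) := by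
  simpa only [dilAvg_one] using dilAvg_tensorWeight (F := fun _ => 1) continuous_const (M := 1)
    (by simp) ℓ ρ 0 0

theorem dilAvg_diagWeight (hF : Continuous F) (hM : ∀ x, |F x| ≤ M) (ℓ : E →L[ℝ] ℝ)
    (ρ : 𝓢(E, G)) (x : E) (s : ℝ) :
    dilAvg (diagWeight ℓ ρ) F x s =
      ℓ.smulRight (dilAvg ρ F x s - dilAvg (eulerWeight ρ) F x s) -
        dilAvg (SchwartzMap.fderivCLM ℝ E G ρ) F x s := by
  rw [diagWeight, dilAvg_sub_weight hF hM, dilAvg_tensorWeight hF hM, dilAvg_sub_weight hF hM]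

theorem integral_diagWeight (ℓ : E →L[ℝ] ℝ) (ρ : 𝓢(E, G)) :
    ∫ y, diagWeight ℓ ρ y = ℓ.smulRight (∫ y, ρ y) := by
  have := dilAvg_diagWeight (F := fun _ => 1) continuous_const (M := 1) (by simp) ℓ ρ 0 0
  simpa only [dilAvg_one, integral_eulerWeight_eq_zero, integral_fderivCLM_eq_zero, sub_zero]
    using this

theorem hasFDerivAt_smul_dilAvg_diag (h0 : 0 < α) (h1 : α < 1) (hF : BddHolder α F M N)
    (hN : 0 ≤ N) (ρ : 𝓢(E, G)) (ℓ : E →L[ℝ] ℝ) (hℓ : ‖ℓ‖ ≤ 1) (x : E) :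
    HasFDerivAt (fun x => ℓ x • dilAvg ρ F x (ℓ x)) (dilAvg (diagWeight ℓ ρ) F x (ℓ x)) x := by
  by_cases hx : ℓ x = 0
  · have hc : Continuous fun x => dilAvg ρ F x (ℓ x) :=
      continuous_of_holder (N := N * mass ρ) h0 fun x y =>
        (norm_dilAvg_diag_sub_le h0 h1 hF hN ρ ℓ hℓ x y).trans_eq (by ring)
    have e : dilAvg (diagWeight ℓ ρ) F x (ℓ x) = ℓ.smulRight (dilAvg ρ F x (ℓ x)) := by
      rw [hx, dilAvg_zero_right, dilAvg_zero_right, integral_diagWeight]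
      ext y; simp [smul_smul, mul_comm]
    rw [e, hasFDerivAt_iff_isLittleO]
    have h2 : (fun y => dilAvg ρ F y (ℓ y) - dilAvg ρ F x (ℓ x)) =o[𝓝 x] fun _ => (1 : ℝ) := by
      rw [Asymptotics.isLittleO_one_iff]
      exact tendsto_sub_nhds_zero_iff.2 hc.continuousAt
    have hb : (fun y => ℓ (y - x)) =O[𝓝 x] fun y => ‖y - x‖ :=
      Asymptotics.isBigO_norm_right.2 (ℓ.isBigO_sub _ x)
    have h3 := hb.smul_isLittleO h2
    refine (h3.congr_left fun y => ?_).trans_isBigO (Asymptotics.isBigO_of_le _ fun y => ?_)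
    · simp [hx, smul_sub]
    · simp
  · have h := ℓ.hasFDerivAt.smul (dilAvg_hasFDerivAt_diag (hF.continuous h0) hF.bound ρ ℓ x hx)
    refine h.congr_fderiv ?_
    rw [dilAvg_diagWeight (hF.continuous h0) hF.bound]
    ext y
    simp [smul_smul, hx, smul_sub]
    abel

/-- A function vanishing on `ℓ = 0` whose second derivative there is `F ℓ ⊗ ℓ`, with bounds on the
strip `|ℓ| < 2`. -/
theorem strip_corrector (h0 : 0 < α) (h1 : α < 1) (ℓ : E →L[ℝ] ℝ) (hℓ : ‖ℓ‖ ≤ 1) :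
    ∃ C, 0 ≤ C ∧ ∀ (F : E → ℝ) (N : ℝ), BddHolder α F N N → ∃ w : E → ℝ, ContDiff ℝ 2 w ∧
      (∀ x, |ℓ x| < 2 → |w x| ≤ C * N) ∧ (∀ x, |ℓ x| < 2 → ‖fderiv ℝ w x‖ ≤ C * N) ∧
      HB α univ (fderiv ℝ (fderiv ℝ w)) (C * N) (C * N) ∧
      (∀ x, ℓ x = 0 → w x = 0 ∧ fderiv ℝ (fderiv ℝ w) x = F x • ℓ.smulRight ℓ) := by
  set γ := gaussian E
  set ρ₁ : 𝓢(E, E →L[ℝ] ℝ) := (2⁻¹ : ℝ) • (tensorWeight ℓ γ + diagWeight ℓ γ) with hρ₁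
  set ρ₂ : 𝓢(E, E →L[ℝ] E →L[ℝ] ℝ) := diagWeight ℓ ρ₁ with hρ₂
  have m0 := mass_nonneg γ
  have m1 := mass_nonneg ρ₁
  have m2 := mass_nonneg ρ₂
  refine ⟨2 * mass γ + 2 * mass ρ₁ + mass ρ₂, by positivity, fun F N hF => ?_⟩
  have hN := hF.M_nonneg
  have hFc := hF.continuous h0
  have d1 : ∀ x, HasFDerivAt (fun x => (2⁻¹ * ℓ x) * (ℓ x * dilAvg γ F x (ℓ x)))
      (ℓ x • dilAvg ρ₁ F x (ℓ x)) x := fun x => by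
    have h := ((ℓ.hasFDerivAt (x := x)).const_mul (2⁻¹ : ℝ)).mul
      (hasFDerivAt_smul_dilAvg_diag h0 h1 hF hN γ ℓ hℓ x)
    refine h.congr_fderiv ?_
    have e : dilAvg ρ₁ F x (ℓ x) = (2⁻¹ : ℝ) • (ℓ.smulRight (dilAvg γ F x (ℓ x)) +
        dilAvg (diagWeight ℓ γ) F x (ℓ x)) := by
      rw [← dilAvg_tensorWeight hFc hF.bound]
      simp only [dilAvg]
      rw [← integral_add (integrable_dilAvg hFc hF.bound _ x _)
        (integrable_dilAvg hFc hF.bound _ x _), ← integral_smul]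
      congr 1; ext1 y
      rw [hρ₁, _root_.smul_apply, _root_.add_apply, smul_comm, smul_add]
    rw [e]
    ext y
    simp
    ring
  have d2 := fun x => hasFDerivAt_smul_dilAvg_diag h0 h1 hF hN ρ₁ ℓ hℓ x
  have b3 : ∀ x y, ‖dilAvg ρ₂ F x (ℓ x) - dilAvg ρ₂ F y (ℓ y)‖ ≤ N * mass ρ₂ * ‖x - y‖ ^ α :=
    fun x y => (norm_dilAvg_diag_sub_le h0 h1 hF hN ρ₂ ℓ hℓ x y).trans_eq (by ring)
  have e1 : fderiv ℝ (fun x => (2⁻¹ * ℓ x) * (ℓ x * dilAvg γ F x (ℓ x))) = _ :=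
    funext fun x => (d1 x).fderiv
  have e2 : fderiv ℝ (fun x => ℓ x • dilAvg ρ₁ F x (ℓ x)) = _ :=
    funext fun x => (d2 x).fderiv
  refine ⟨fun x => (2⁻¹ * ℓ x) * (ℓ x * dilAvg γ F x (ℓ x)),
    contDiff_two_of_hasFDerivAt d1 d2 (continuous_of_holder h0 b3), fun x hx => ?_, fun x hx => ?_,
    ⟨fun x _ => ?_, fun x _ y _ => ?_⟩, fun x hx => ⟨by simp [hx], ?_⟩⟩
  · have h := norm_dilAvg_le γ hF.bound x (ℓ x)
    rw [Real.norm_eq_abs] at h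
    rw [abs_mul, abs_mul, abs_mul]
    calc |2⁻¹| * |ℓ x| * (|ℓ x| * |dilAvg γ F x (ℓ x)|) ≤ |2⁻¹| * 2 * (2 * (N * mass γ)) := by
          gcongr
      _ = 2 * mass γ * N := by norm_num; ring
      _ ≤ _ := by gcongr; linarith
  · rw [e1, norm_smul, Real.norm_eq_abs]
    have h := norm_dilAvg_le ρ₁ hF.bound x (ℓ x)
    calc |ℓ x| * ‖dilAvg ρ₁ F x (ℓ x)‖ ≤ 2 * (N * mass ρ₁) := by gcongr
      _ = 2 * mass ρ₁ * N := by ring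
      _ ≤ _ := by gcongr; linarith
  · rw [e1, e2]
    refine (norm_dilAvg_le ρ₂ hF.bound x (ℓ x)).trans ?_
    rw [mul_comm]; gcongr; linarith
  · rw [e1, e2]
    refine (b3 x y).trans ?_
    rw [mul_comm N]
    gcongr; linarith
  · rw [e1, e2]
    dsimp only
    rw [hx, dilAvg_zero_right, integral_diagWeight, hρ₁]
    congr 2
    have : ∫ y, ((2⁻¹ : ℝ) • (tensorWeight ℓ γ + diagWeight ℓ γ) : 𝓢(E, E →L[ℝ] ℝ)) y =
        (2⁻¹ : ℝ) • ((∫ y, tensorWeight ℓ γ y) + ∫ y, diagWeight ℓ γ y) := by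
      rw [← integral_add (SchwartzMap.integrable _) (SchwartzMap.integrable _), ← integral_smul]
      rfl
    rw [this, integral_tensorWeight, integral_diagWeight, integral_gaussian]
    ext y; simp; ring

/-- A smooth compactly supported function has `C^{2,α}` bounds. -/
theorem exists_C2B_of_compactSupport {X : Type} [NormedAddCommGroup X] [NormedSpace ℝ X]
    (h0 : 0 < α) (h1 : α < 1) {χ : X → ℝ} (hχ : ContDiff ℝ 3 χ) (hs : HasCompactSupport χ) :
    ∃ c, 0 ≤ c ∧ C2B α χ c c c c := by
  have d1 : ContDiff ℝ 2 (fderiv ℝ χ) := hχ.fderiv_right (by norm_num)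
  have d2 : ContDiff ℝ 1 (fderiv ℝ (fderiv ℝ χ)) := d1.fderiv_right (by norm_num)
  have d3 : Continuous (fderiv ℝ (fderiv ℝ (fderiv ℝ χ))) := d2.continuous_fderiv (by norm_num)
  obtain ⟨c0, k0⟩ := hs.exists_bound_of_continuous hχ.continuous
  obtain ⟨c1, k1⟩ := (hs.fderiv (𝕜 := ℝ)).exists_bound_of_continuous d1.continuous
  obtain ⟨c2, k2⟩ := ((hs.fderiv (𝕜 := ℝ)).fderiv (𝕜 := ℝ)).exists_bound_of_continuous d2.continuous
  obtain ⟨c3, k3⟩ := (((hs.fderiv (𝕜 := ℝ)).fderiv (𝕜 := ℝ)).fderiv (𝕜 := ℝ)).exists_bound_of_continuous d3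
  have q0 := (norm_nonneg _).trans (k0 0)
  have q1 := (norm_nonneg _).trans (k1 0)
  have q2 := (norm_nonneg _).trans (k2 0)
  have q3 := (norm_nonneg _).trans (k3 0)
  have hh := HB.of_fderiv h0 h1 isOpen_univ convex_univ q3
    (d2.differentiable (by norm_num)).differentiableOn (fun x _ => k2 x) fun x _ => k3 x
  refine ⟨c0 + c1 + 2 * c2 + c3, by positivity, hχ.of_le (by norm_num), fun x => ?_, fun x => ?_,
    fun x => ?_, fun x y => ?_⟩
  · exact (k0 x).trans (by linarith)
  · exact (k1 x).trans (by linarith)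
  · exact (k2 x).trans (by linarith)
  · exact (hh.hd x (mem_univ _) y (mem_univ _)).trans (by gcongr; linarith)

theorem boundary_corrector (h0 : 0 < α) (h1 : α < 1) (ℓ : E →L[ℝ] ℝ) (hℓ : ‖ℓ‖ ≤ 1) :
    ∃ C, 0 ≤ C ∧ ∀ (F : E → ℝ) (N : ℝ), BddHolder α F N N → ∃ w : E → ℝ,
      C2B α w (C * N) (C * N) (C * N) (C * N) ∧
      (∀ x, ℓ x = 0 → w x = 0 ∧ fderiv ℝ (fderiv ℝ w) x = F x • ℓ.smulRight ℓ) := by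
  obtain ⟨C, hC, H⟩ := strip_corrector h0 h1 ℓ hℓ
  let ζ : ContDiffBump (0 : ℝ) := ⟨2⁻¹, 1, by norm_num, by norm_num⟩
  obtain ⟨c, hc, hζ⟩ := exists_C2B_of_compactSupport h0 h1 (ζ.contDiff (n := 3)) ζ.hasCompactSupport
  have hζ' := (hζ.comp_clm h0.le hc ℓ hℓ)
  simp only [one_pow, Real.one_rpow, one_mul] at hζ'
  refine ⟨24 * c * C, by positivity, fun F N hF => ?_⟩
  have hN := hF.M_nonneg
  obtain ⟨w, w0, w1, w2, w3, w4⟩ := H F N hF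
  have hU : IsOpen {x : E | |ℓ x| < 2} := isOpen_lt (by fun_prop) continuous_const
  have hcv : Convex ℝ {x : E | |ℓ x| < 2} := by
    have : {x : E | |ℓ x| < 2} = ℓ ⁻¹' (Metric.ball 0 2) := by ext; simp
    rw [this]
    exact (convex_ball (0 : ℝ) 2).linear_preimage (ℓ : E →ₗ[ℝ] ℝ)
  have hsup : tsupport (fun x => ζ (ℓ x)) ⊆ {x : E | |ℓ x| < 2} := by
    have h2 : tsupport (fun x => ζ (ℓ x)) ⊆ {x : E | |ℓ x| ≤ 1} := by
      refine closure_minimal (fun x hx => ?_) (isClosed_le (by fun_prop) continuous_const)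
      have : ℓ x ∈ Function.support ζ := hx
      rw [ζ.support_eq] at this
      simpa using (le_of_lt this : dist (ℓ x) 0 ≤ _)
    exact h2.trans fun x (hx : |ℓ x| ≤ 1) => (by linarith : |ℓ x| < 2)
  have hcut := C2B.cutoff h0 h1 hU hcv hc (B := C * N) (by positivity) hζ' hsup w0.contDiffOn
    w1 w2 (w3.subset (subset_univ _))
  refine ⟨_, by simpa only [mul_assoc] using hcut, fun x hx => ⟨by simp [(w4 x hx).1], ?_⟩⟩
  have : (fun x => ζ (ℓ x) * w x) =ᶠ[𝓝 x] w := by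
    have : ∀ᶠ y in 𝓝 x, ℓ y ∈ Metric.ball (0 : ℝ) 2⁻¹ :=
      ℓ.continuous.continuousAt.eventually_mem (Metric.isOpen_ball.mem_nhds (by simp [hx]))
    filter_upwards [this] with y hy
    rw [ζ.one_of_mem_closedBall (Metric.ball_subset_closedBall hy), one_mul]
  rw [(this.fderiv (𝕜 := ℝ)).fderiv_eq]
  exact (w4 x hx).2

end Corrector

section HalfSpace

set_option linter.unusedSectionVars false

variable {E : Type} [NormedAddCommGroup E] [InnerProductSpace ℝ E] [FiniteDimensional ℝ E]
  [MeasurableSpace E] [BorelSpace E] {α : ℝ}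

theorem exists_segment_zero (ℓ : E →L[ℝ] ℝ) {x y : E} (hx : 0 ≤ ℓ x) (hy : ℓ y ≤ 0) :
    ∃ z, ℓ z = 0 ∧ ‖x - z‖ ≤ ‖x - y‖ ∧ ‖y - z‖ ≤ ‖x - y‖ := by
  have hz : (0 : ℝ) ∈ ℓ '' segment ℝ y x := by
    have hc : IsPreconnected (ℓ '' segment ℝ y x) :=
      ((convex_segment y x).isPreconnected).image _ ℓ.continuous.continuousOn
    exact hc.Icc_subset ⟨y, left_mem_segment ℝ y x, rfl⟩ ⟨x, right_mem_segment ℝ y x, rfl⟩ ⟨hy, hx⟩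
  obtain ⟨z, hz, h0⟩ := hz
  have hd := dist_add_dist_of_mem_segment hz
  simp only [dist_eq_norm] at hd
  refine ⟨z, h0, ?_, ?_⟩
  · rw [norm_sub_rev x z, norm_sub_rev x y]; linarith [norm_nonneg (y - z)]
  · rw [norm_sub_rev x y]; linarith [norm_nonneg (z - x)]

/-- The odd extension of a function vanishing on a hyperplane. -/
theorem odd_extension (h0 : 0 < α) (ℓ : E →L[ℝ] ℝ) (R : E ≃ₗᵢ[ℝ] E) (hR : ∀ x, ℓ (R x) = -ℓ x)
    (hRR : ∀ x, R (R x) = x) {g : E → ℝ} {N : ℝ} (hg : BddHolder α g N N)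
    (hz : ∀ x, ℓ x = 0 → g x = 0) :
    ∃ f : E → ℝ, BddHolder α f (2 * N) (2 * N) ∧ (∀ x, 0 ≤ ℓ x → f x = g x) ∧
      ∀ x, f (R x) = -f x := by
  have hN := hg.M_nonneg
  have hgR : ∀ x y, |g (R x) - g (R y)| ≤ N * ‖x - y‖ ^ α := fun x y => by
    have := hg.holder (R x) (R y)
    rwa [← map_sub, R.norm_map] at this
  have key : ∀ x y, 0 ≤ ℓ x → ℓ y < 0 → |g x + g (R y)| ≤ 2 * N * ‖x - y‖ ^ α := by
    intro x y hx hy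
    obtain ⟨z, z0, z1, z2⟩ := exists_segment_zero ℓ hx hy.le
    have e1 := hg.holder x z
    have e2 := hgR y z
    rw [hz z z0, sub_zero] at e1
    rw [hz (R z) (by rw [hR, z0, neg_zero]), sub_zero] at e2
    calc _ ≤ |g x| + |g (R y)| := abs_add_le _ _
      _ ≤ N * ‖x - z‖ ^ α + N * ‖y - z‖ ^ α := add_le_add e1 e2
      _ ≤ N * ‖x - y‖ ^ α + N * ‖x - y‖ ^ α := by gcongr
      _ = _ := by ring
  classical
  refine ⟨fun x => if 0 ≤ ℓ x then g x else -g (R x), ⟨fun x => ?_, fun x y => ?_⟩,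
    fun x hx => if_pos hx, fun x => ?_⟩
  · split_ifs
    · linarith [hg.bound x]
    · rw [abs_neg]; linarith [hg.bound (R x)]
  · have h2 : N * ‖x - y‖ ^ α ≤ 2 * N * ‖x - y‖ ^ α := by gcongr; linarith
    split_ifs with h h' h'
    · exact (hg.holder x y).trans h2
    · rw [sub_neg_eq_add]; exact key x y h (not_le.1 h')
    · rw [← neg_add', abs_neg, add_comm, norm_sub_rev]; exact key y x h' (not_le.1 h)
    · rw [← neg_sub', abs_neg]; exact (hgR x y).trans h2
  · dsimp only
    rw [hR, hRR]
    rcases lt_trichotomy (ℓ x) 0 with h | h | h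
    · rw [if_pos (by linarith), if_neg (by linarith), neg_neg]
    · rw [if_pos (by linarith), if_pos h.ge, hz x h, hz (R x) (by rw [hR, h, neg_zero]), neg_zero]
    · rw [if_neg (by linarith), if_pos h.le]

theorem BddHolder.of_C2B_laplacian {ι : Type} [Fintype ι] (b : OrthonormalBasis ι ℝ E) 
    (h0 : 0 < α) (h1 : α < 1) {F w : E → ℝ} {N B : ℝ} (hF : BddHolder α F N N)
    (hw : C2B α w B B B B) :
    BddHolder α (fun x => F x - (w x - ∑ i, fderiv ℝ (fderiv ℝ w) x (b i) (b i)))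
      (N + (3 + Fintype.card ι) * B) (N + (3 + Fintype.card ι) * B) := by
  have hB : 0 ≤ B := (norm_nonneg _).trans (hw.b1 0)
  have h1 : HB α univ (fun x => ∑ i, fderiv ℝ (fderiv ℝ w) x (b i) (b i))
      (∑ _ : ι, B) (∑ _ : ι, B) := by
    refine HB.sum _ fun i _ => ⟨fun x _ => ?_, fun x _ y _ => ?_⟩
    · refine ((fderiv ℝ (fderiv ℝ w) x).le_opNorm₂ _ _).trans ?_
      simpa using hw.b2 x
    · rw [← _root_.sub_apply, ← _root_.sub_apply]
      refine ((fderiv ℝ (fderiv ℝ w) x - fderiv ℝ (fderiv ℝ w) y).le_opNorm₂ _ _).trans ?_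
      simpa using hw.b3 x y
  have h2 : HB α univ F N N := ⟨fun x _ => hF.bound x, fun x _ y _ => hF.holder x y⟩
  have h3 := h2.sub ((hw.HB_fun h0 ‹α < 1›).sub h1)
  simp only [Finset.sum_const, Finset.card_univ, nsmul_eq_mul] at h3
  have h4 := h3.mono (A' := N + (3 + Fintype.card ι) * B) (B' := N + (3 + Fintype.card ι) * B)
    (by linarith) (by linarith)
  exact ⟨fun x => h4.bd x (mem_univ _), fun x y => h4.hd x (mem_univ _) y (mem_univ _)⟩

theorem sum_bilin_basis_eq {ι κ : Type} [Fintype ι] [Fintype κ] (b₀ : OrthonormalBasis ι ℝ E)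
    (b : OrthonormalBasis κ ℝ E) (T : E →L[ℝ] E →L[ℝ] ℝ) :
    ∑ i, T (b₀ i) (b₀ i) = ∑ j, T (b j) (b j) := by
  have h1 : ∀ x y, T x y = ∑ j, inner ℝ (b j) x * T (b j) y := fun x y => by
    conv_lhs => rw [← b.sum_repr' x]
    simp only [map_sum, map_smul, _root_.sum_apply, _root_.smul_apply, smul_eq_mul]
  have h2 : ∀ x y, T x y = ∑ i, inner ℝ (b₀ i) y * T x (b₀ i) := fun x y => by
    conv_lhs => rw [← b₀.sum_repr' y]
    simp only [map_sum, map_smul, smul_eq_mul]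
  rw [Finset.sum_congr rfl fun i _ => h1 (b₀ i) (b₀ i),
    Finset.sum_congr rfl fun j _ => h2 (b j) (b j)]
  simp only [real_inner_comm]
  exact Finset.sum_comm

theorem half_space_solver (h0 : 0 < α) (h1 : α < 1) (e : E) (he : ‖e‖ = 1) :
    ∃ C, 0 ≤ C ∧ ∀ (F : E → ℝ) (N : ℝ), BddHolder α F N N → ∃ v : E → ℝ,
      C2B α v (C * N) (C * N) (C * N) (C * N) ∧
      (∀ {ι : Type} [Fintype ι] (b : OrthonormalBasis ι ℝ E) (x : E), 0 ≤ inner ℝ e x →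
        v x - ∑ i, fderiv ℝ (fderiv ℝ v) x (b i) (b i) = F x) ∧
      ∀ x, inner ℝ e x = 0 → v x = 0 := by
  obtain ⟨C₁, hC₁, H₁⟩ := boundary_corrector (E := E) h0 h1 (innerSL ℝ e)
    (by rw [innerSL_apply_norm, he])
  obtain ⟨C₂, hC₂, H₂⟩ := whole_space_solver E h0 h1
  set b₀ := stdOrthonormalBasis ℝ E
  set d : ℝ := ((Fintype.card (Fin (Module.finrank ℝ E)) : ℕ) : ℝ) with hd
  have hd0 : 0 ≤ d := by positivity
  refine ⟨C₁ + C₂ * (2 * (1 + (3 + d) * C₁)), by positivity, fun F N hF => ?_⟩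
  have hN := hF.M_nonneg
  obtain ⟨w, hw, hw'⟩ := H₁ (fun x => -F x) N ⟨fun x => by simpa using hF.bound x, fun x y => by
    rw [← neg_sub', abs_neg]; exact hF.holder x y⟩
  have hlapb : ∀ {ι : Type} [Fintype ι] (b : OrthonormalBasis ι ℝ E) x, innerSL ℝ e x = 0 →
      ∑ i, fderiv ℝ (fderiv ℝ w) x (b i) (b i) = -F x := fun b x hx => by
    rw [(hw' x hx).2]
    have := b.sum_sq_inner_left e
    simp only [_root_.smul_apply, ContinuousLinearMap.smulRight_apply, innerSL_apply_apply,
      smul_eq_mul, ← Finset.mul_sum]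
    rw [he] at this
    simp only [← pow_two, this]
    ring
  set g : E → ℝ := fun x => F x - (w x - ∑ i, fderiv ℝ (fderiv ℝ w) x (b₀ i) (b₀ i)) with hg
  have hgB : BddHolder α g _ _ := BddHolder.of_C2B_laplacian b₀ h0 h1 hF hw
  have hgz : ∀ x, innerSL ℝ e x = 0 → g x = 0 := fun x hx => by
    simp only [hg]
    rw [hlapb b₀ x hx, (hw' x hx).1]; ring
  set R : E ≃ₗᵢ[ℝ] E := (ℝ ∙ e)ᗮ.reflection with hRdef
  have hRR : ∀ x, R (R x) = x := fun x => Submodule.reflection_reflection _ x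
  have hRe : R e = -e := Submodule.reflection_orthogonalComplement_singleton_eq_neg e
  have hR : ∀ x, innerSL ℝ e (R x) = -innerSL ℝ e x := fun x => by
    have : inner ℝ (R e) (R x) = inner ℝ e x := R.inner_map_map e x
    rw [hRe, inner_neg_left] at this
    simp only [innerSL_apply_apply]; linarith
  have hR0 : ∀ x, inner ℝ e x = 0 → R x = x := fun x hx =>
    Submodule.reflection_mem_subspace_eq_self (Submodule.mem_orthogonal_singleton_iff_inner_right.2 hx)
  obtain ⟨f, hf, hfg, hfR⟩ := odd_extension h0 (innerSL ℝ e) R hR hRR hgB hgz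
  obtain ⟨W, hW, hWeq⟩ := H₂ f _ hf
  set B := C₂ * (2 * (N + (3 + d) * (C₁ * N))) with hB
  have hB0 : 0 ≤ B := (abs_nonneg _).trans (hW.b0 0)
  let Rc : E →L[ℝ] E := (R.toContinuousLinearEquiv : E →L[ℝ] E)
  have hRn : ‖Rc‖ ≤ 1 := ContinuousLinearMap.opNorm_le_bound _ zero_le_one fun x => by
    rw [one_mul]; exact (R.norm_map x).le
  have hWR := hW.comp_clm h0.le hB0 Rc hRn
  simp only [one_pow, Real.one_rpow, one_mul] at hWR
  have hV1 := hW.smul (2⁻¹ : ℝ)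
  have hV2 := hWR.smul (-2⁻¹ : ℝ)
  have hV := hV1.add hV2
  have hv := hw.add hV
  refine ⟨_, hv.mono ?_ ?_ ?_ ?_, fun {ι} _ b x hx => ?_, fun x hx => ?_⟩
  iterate 4
    · rw [abs_neg, abs_of_pos (by norm_num : (0 : ℝ) < 2⁻¹), hB]
      apply le_of_eq; ring
  · rw [hw.fderiv_fderiv_add hV, hV1.fderiv_fderiv_add hV2, hW.fderiv_fderiv_smul,
      hWR.fderiv_fderiv_smul]
    have hx' : 0 ≤ innerSL ℝ e x := hx
    have q1 := hWeq b x
    have q2 := hWeq (b.map R) (R x)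
    rw [hfR, hfg x hx'] at q2
    rw [hfg x hx', hg] at q1
    rw [hg] at q2
    have q3 : ∑ i, fderiv ℝ (fderiv ℝ w) x (b₀ i) (b₀ i) =
        ∑ i, fderiv ℝ (fderiv ℝ w) x (b i) (b i) := by
      have := sum_bilin_basis_eq b₀ b (fderiv ℝ (fderiv ℝ w) x)
      exact this
    simp only [OrthonormalBasis.map_apply] at q2
    simp only [_root_.add_apply, _root_.smul_apply, smul_eq_mul, Finset.sum_add_distrib,
      ← Finset.mul_sum, fderiv_fderiv_comp_clm Rc hW.contDiff]
    have q4 : ∀ y, Rc y = R y := fun _ => rfl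
    simp only [q4]
    simp only [q3] at q1 q2
    linarith
  · have q4 : Rc x = x := hR0 x hx
    simp only [q4, (hw' x hx).1]
    ring

end HalfSpace

section Model

set_option linter.unusedSectionVars false

variable {E : Type} [NormedAddCommGroup E] [InnerProductSpace ℝ E] [FiniteDimensional ℝ E]
  {ι : Type} [Fintype ι]

/-- The operator that is diagonal in an orthonormal basis. -/
noncomputable def diagOp (b : OrthonormalBasis ι ℝ E) (c : ι → ℝ) : E →L[ℝ] E :=
  ∑ k, c k • (innerSL ℝ (b k)).smulRight (b k)

theorem diagOp_apply (b : OrthonormalBasis ι ℝ E) (c : ι → ℝ) (x : E) :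
    diagOp b c x = ∑ k, (c k * inner ℝ (b k) x) • b k := by
  simp [diagOp, _root_.sum_apply, smul_smul]

theorem inner_diagOp (b : OrthonormalBasis ι ℝ E) (c : ι → ℝ) (k : ι) (x : E) :
    inner ℝ (b k) (diagOp b c x) = c k * inner ℝ (b k) x := by
  rw [diagOp_apply, b.orthonormal.inner_right_fintype]

theorem diagOp_diagOp (b : OrthonormalBasis ι ℝ E) {c c' : ι → ℝ} (h : ∀ k, c k * c' k = 1)
    (x : E) : diagOp b c (diagOp b c' x) = x := by
  rw [diagOp_apply]
  simp only [inner_diagOp, ← mul_assoc, h, one_mul]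
  exact b.sum_repr' x

theorem inner_diagOp_left (b : OrthonormalBasis ι ℝ E) (c : ι → ℝ) (x y : E) :
    inner ℝ (diagOp b c x) y = inner ℝ x (diagOp b c y) := by
  rw [← b.sum_inner_mul_inner, ← b.sum_inner_mul_inner x]
  refine Finset.sum_congr rfl fun k _ => ?_
  rw [inner_diagOp, real_inner_comm, inner_diagOp, real_inner_comm x]
  ring

theorem norm_diagOp_le (b : OrthonormalBasis ι ℝ E) {c : ι → ℝ} {M : ℝ} (hM : 0 ≤ M)
    (h : ∀ k, |c k| ≤ M) : ‖diagOp b c‖ ≤ M := by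
  refine ContinuousLinearMap.opNorm_le_bound _ hM fun x => ?_
  refine le_of_sq_le_sq ?_ (by positivity)
  rw [← b.sum_sq_norm_inner_right, mul_pow, ← b.sum_sq_norm_inner_right x, Finset.mul_sum]
  refine Finset.sum_le_sum fun k _ => ?_
  rw [inner_diagOp, norm_mul, mul_pow, Real.norm_eq_abs]
  gcongr
  exact h k

variable {n : ℕ} [NeZero n]

local notation "𝔼" => EuclideanSpace ℝ (Fin n)

/-- The standard basis vectors of Euclidean space. -/
noncomputable abbrev stdE (i : Fin n) : EuclideanSpace ℝ (Fin n) := EuclideanSpace.single i 1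

theorem inner_stdE (i : Fin n) (x : 𝔼) : inner ℝ (stdE i) x = x i := by
  simp [stdE, EuclideanSpace.inner_single_left]

theorem exists_eigenbasis {lam Lam : ℝ} {a : Fin n → Fin n → ℝ}
    (hs : ∀ i j, a i j = a j i) (hb : ∀ i j, |a i j| ≤ Lam)
    (he : ∀ ξ : Fin n → ℝ, lam * ∑ i, ξ i ^ 2 ≤ ∑ i, ∑ j, a i j * ξ i * ξ j) :
    ∃ (b : OrthonormalBasis (Fin n) ℝ 𝔼) (μ : Fin n → ℝ),
      (∀ k l, ∑ i, ∑ j, a i j * b k i * b l j = if k = l then μ l else 0) ∧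
      ∀ k, lam ≤ μ k ∧ μ k ≤ n ^ 2 * Lam := by
  have hA : (Matrix.of a).IsHermitian := by
    ext i j; simp [hs i j]
  have hkl : ∀ k l, ∑ i, ∑ j, a i j * hA.eigenvectorBasis k i * hA.eigenvectorBasis l j =
      if k = l then hA.eigenvalues l else 0 := fun k l => by
    have h := hA.mulVec_eigenvectorBasis l
    have h' : ∀ i, ∑ j, a i j * hA.eigenvectorBasis l j =
        hA.eigenvalues l * hA.eigenvectorBasis l i := fun i => by
      simpa [Matrix.mulVec, dotProduct] using congrFun h i
    have h2 := orthonormal_iff_ite.1 hA.eigenvectorBasis.orthonormal k l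
    calc _ = ∑ i, hA.eigenvectorBasis k i * ∑ j, a i j * hA.eigenvectorBasis l j := by
          refine Finset.sum_congr rfl fun i _ => ?_
          rw [Finset.mul_sum]
          exact Finset.sum_congr rfl fun j _ => by ring
      _ = hA.eigenvalues l * inner ℝ (hA.eigenvectorBasis k) (hA.eigenvectorBasis l) := by
          simp only [h', PiLp.inner_apply, Finset.mul_sum]
          refine Finset.sum_congr rfl fun i _ => ?_
          simp; ring
      _ = _ := by rw [h2]; split_ifs <;> simp
  have hn : ∀ k, ∑ i, hA.eigenvectorBasis k i ^ 2 = 1 := fun k => by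
    have := hA.eigenvectorBasis.orthonormal.1 k
    rw [← EuclideanSpace.real_norm_sq_eq, this, one_pow]
  refine ⟨hA.eigenvectorBasis, hA.eigenvalues, hkl, fun k => ⟨?_, ?_⟩⟩
  · have := he (hA.eigenvectorBasis k)
    rwa [hn, mul_one, hkl k k, if_pos rfl] at this
  · have := hkl k k
    rw [if_pos rfl] at this
    have h1 : ∀ i, |hA.eigenvectorBasis k i| ≤ 1 := fun i => by
      have := PiLp.norm_apply_le (hA.eigenvectorBasis k) i
      rwa [hA.eigenvectorBasis.orthonormal.1 k] at this
    rw [← this]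
    calc _ ≤ ∑ _i : Fin n, ∑ _j : Fin n, Lam := by
          refine Finset.sum_le_sum fun i _ => Finset.sum_le_sum fun j _ => ?_
          refine (le_abs_self _).trans ?_
          rw [abs_mul, abs_mul]
          calc _ ≤ Lam * 1 * 1 := by
                have := (abs_nonneg _).trans (hb i j)
                gcongr
                exacts [hb i j, h1 i, h1 j]
            _ = Lam := by ring
      _ = _ := by simp; ring

/-- A linear change of variables preserving the half space that turns a constant coefficient
elliptic operator into the Laplacian. -/
theorem exists_normal_form {lam : ℝ} (hlam : 0 < lam) (Lam : ℝ) :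
    ∃ K : ℝ, 1 ≤ K ∧ ∀ a : Fin n → Fin n → ℝ, (∀ i j, a i j = a j i) → (∀ i j, |a i j| ≤ Lam) →
      (∀ ξ : Fin n → ℝ, lam * ∑ i, ξ i ^ 2 ≤ ∑ i, ∑ j, a i j * ξ i * ξ j) →
      ∃ (P Q : 𝔼 →L[ℝ] 𝔼) (κ : ℝ) (b : OrthonormalBasis (Fin n) ℝ 𝔼), ‖P‖ ≤ K ∧ ‖Q‖ ≤ K ∧
        (∀ x, Q (P x) = x) ∧ 0 < κ ∧ (∀ x, P x 0 = κ * x 0) ∧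
        ∀ T : 𝔼 →L[ℝ] 𝔼 →L[ℝ] ℝ,
          ∑ i, ∑ j, a i j * T (P (stdE i)) (P (stdE j)) = ∑ k, T (b k) (b k) := by
  refine ⟨max 1 (max (√lam)⁻¹ √(n ^ 2 * Lam)), le_max_left _ _, fun a hs hb he => ?_⟩
  obtain ⟨b, μ, hμ, hμ'⟩ := exists_eigenbasis hs hb he
  have hμ0 : ∀ k, 0 < √(μ k) := fun k => Real.sqrt_pos.2 (hlam.trans_le (hμ' k).1)
  set Q₀ := diagOp b fun k => √(μ k) with hQ₀
  set P₀ := diagOp b fun k => (√(μ k))⁻¹ with hP₀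
  have hQP : ∀ x, Q₀ (P₀ x) = x := diagOp_diagOp b fun k => mul_inv_cancel₀ (hμ0 k).ne'
  have hPQ : ∀ x, P₀ (Q₀ x) = x := diagOp_diagOp b fun k => inv_mul_cancel₀ (hμ0 k).ne'
  have hQe : Q₀ (stdE 0) ≠ 0 := fun h => by
    have := hPQ (stdE 0)
    rw [h, map_zero] at this
    have := congrArg (fun x : 𝔼 => x 0) this
    simp [stdE] at this
  set w : 𝔼 := ‖Q₀ (stdE 0)‖⁻¹ • Q₀ (stdE 0) with hw
  have hw1 : ‖w‖ = ‖(stdE 0 : 𝔼)‖ := by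
    rw [hw, norm_smul, norm_inv, norm_norm, inv_mul_cancel₀ (norm_ne_zero_iff.2 hQe)]
    simp [stdE]
  set R : 𝔼 ≃ₗᵢ[ℝ] 𝔼 := (ℝ ∙ (w - stdE 0))ᗮ.reflection with hR
  have hRw : R w = stdE 0 := Submodule.reflection_sub hw1
  have hRR : ∀ x, R (R x) = x := fun x => Submodule.reflection_reflection _ x
  let Rc : 𝔼 →L[ℝ] 𝔼 := (R.toContinuousLinearEquiv : 𝔼 →L[ℝ] 𝔼)
  have hRn : ‖Rc‖ ≤ 1 := ContinuousLinearMap.opNorm_le_bound _ zero_le_one fun x => by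
    rw [one_mul]; exact (R.norm_map x).le
  refine ⟨Rc ∘L P₀, Q₀ ∘L Rc, ‖Q₀ (stdE 0)‖⁻¹, b.map R, ?_, ?_, fun x => ?_,
    inv_pos.2 (norm_pos_iff.2 hQe), fun x => ?_, fun T => ?_⟩
  · refine (ContinuousLinearMap.opNorm_comp_le _ _).trans ?_
    have : ‖P₀‖ ≤ (√lam)⁻¹ := norm_diagOp_le b (by positivity) fun k => by
      rw [abs_of_pos (inv_pos.2 (hμ0 k))]
      exact inv_anti₀ (Real.sqrt_pos.2 hlam) (Real.sqrt_le_sqrt (hμ' k).1)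
    calc _ ≤ 1 * (√lam)⁻¹ := by gcongr
      _ ≤ _ := by rw [one_mul]; exact (le_max_left _ _).trans (le_max_right _ _)
  · refine (ContinuousLinearMap.opNorm_comp_le _ _).trans ?_
    have : ‖Q₀‖ ≤ √(n ^ 2 * Lam) := norm_diagOp_le b (by positivity) fun k => by
      rw [abs_of_pos (hμ0 k)]
      exact Real.sqrt_le_sqrt (hμ' k).2
    calc _ ≤ √(n ^ 2 * Lam) * 1 := by gcongr
      _ ≤ _ := by rw [mul_one]; exact (le_max_right _ _).trans (le_max_right _ _)
  · change Q₀ (R (R (P₀ x))) = x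
    rw [hRR, hQP]
  · change (R (P₀ x)) 0 = _
    have e1 : inner ℝ (R w) (R (P₀ x)) = ‖Q₀ (stdE 0)‖⁻¹ * inner ℝ (stdE 0) x := by
      rw [R.inner_map_map, hw, real_inner_smul_left, inner_diagOp_left, hQP]
    rwa [hRw, inner_stdE, inner_stdE] at e1
  · change ∑ i, ∑ j, a i j * T (R (P₀ (stdE i))) (R (P₀ (stdE j))) = ∑ k, T (R (b k)) (R (b k))
    have hP : ∀ i, R (P₀ (stdE i)) = ∑ k, ((√(μ k))⁻¹ * b k i) • R (b k) := fun i => by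
      rw [hP₀, diagOp_apply, map_sum]
      refine Finset.sum_congr rfl fun k _ => ?_
      rw [real_inner_comm, inner_stdE, map_smul]
    have h1 : ∀ i j, a i j * T (R (P₀ (stdE i))) (R (P₀ (stdE j))) =
        ∑ k, ∑ l, (√(μ k))⁻¹ * (√(μ l))⁻¹ * T (R (b k)) (R (b l)) *
          (a i j * b k i * b l j) := fun i j => by
      rw [hP i, hP j]
      simp only [map_sum, map_smul, _root_.sum_apply, _root_.smul_apply, smul_eq_mul,
        Finset.mul_sum]
      rw [Finset.sum_comm]
      refine Finset.sum_congr rfl fun k _ => Finset.sum_congr rfl fun l _ => by ring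
    simp only [h1]
    calc _ = ∑ k, ∑ l, (√(μ k))⁻¹ * (√(μ l))⁻¹ * T (R (b k)) (R (b l)) *
          ∑ i, ∑ j, a i j * b k i * b l j := by
          simp only [Finset.mul_sum]
          rw [Finset.sum_congr rfl fun i _ => Finset.sum_comm, Finset.sum_comm]
          refine Finset.sum_congr rfl fun k _ => ?_
          rw [Finset.sum_congr rfl fun i _ => Finset.sum_comm, Finset.sum_comm]
      _ = _ := by
          refine Finset.sum_congr rfl fun k _ => ?_
          simp only [hμ, mul_ite, mul_zero, Finset.sum_ite_eq, Finset.mem_univ, if_true]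
          have := (hμ0 k).ne'
          have h2 := Real.mul_self_sqrt (hlam.trans_le (hμ' k).1).le
          field_simp
          rw [pow_two, h2]; ring

/-- The model problem: the resolvent equation of a constant coefficient elliptic operator on a
half space, with bounds uniform in the spectral parameter. -/
theorem model_solver {α : ℝ} (h0 : 0 < α) (h1 : α < 1) {lam : ℝ} (hlam : 0 < lam) (Lam : ℝ) :
    ∃ C, 0 ≤ C ∧ ∀ a : Fin n → Fin n → ℝ, (∀ i j, a i j = a j i) → (∀ i j, |a i j| ≤ Lam) →
      (∀ ξ : Fin n → ℝ, lam * ∑ i, ξ i ^ 2 ≤ ∑ i, ∑ j, a i j * ξ i * ξ j) →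
      ∀ s, 1 ≤ s → ∀ (F : 𝔼 → ℝ) (N : ℝ), BddHolder α F (N * s ^ (-α)) N →
      ∃ v : 𝔼 → ℝ, C2B α v (C * N * s ^ (-α) / s ^ 2) (C * N * s ^ (-α) / s) (C * N * s ^ (-α))
          (C * N) ∧
        (∀ x, 0 ≤ x 0 → s ^ 2 * v x -
          ∑ i, ∑ j, a i j * fderiv ℝ (fderiv ℝ v) x (stdE i) (stdE j) = F x) ∧
        ∀ x, x 0 = 0 → v x = 0 := by
  obtain ⟨K, hK, HK⟩ := exists_normal_form (n := n) hlam Lam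
  obtain ⟨C, hC, H⟩ := half_space_solver h0 h1 (stdE (0 : Fin n) : 𝔼) (by simp [stdE])
  refine ⟨C * K ^ α * K ^ 2 * K ^ α, by positivity, fun a hs hb he s hs1 F N hF => ?_⟩
  obtain ⟨P, Q, κ, b, hP, hQ, hQP, hκ, hPx, hT⟩ := HK a hs hb he
  have hs0 : 0 < s := by linarith
  have hsα : 0 < s ^ (-α) := Real.rpow_pos_of_pos hs0 _
  have hN : 0 ≤ N := by
    have := hF.M_nonneg
    exact nonneg_of_mul_nonneg_left this hsα
  have hKα : 1 ≤ K ^ α := Real.one_le_rpow hK h0.le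
  have hF' : BddHolder α (fun y => F (Q (s⁻¹ • y))) (N * K ^ α * s ^ (-α)) (N * K ^ α * s ^ (-α)) := by
    refine ⟨fun y => (hF.bound _).trans ?_, fun x y => (hF.holder _ _).trans ?_⟩
    · gcongr; exact le_mul_of_one_le_right hN hKα
    · rw [← map_sub, ← smul_sub]
      have : ‖Q (s⁻¹ • (x - y))‖ ≤ K * s⁻¹ * ‖x - y‖ := by
        refine (Q.le_opNorm _).trans ?_
        rw [norm_smul, norm_inv, Real.norm_of_nonneg hs0.le, mul_assoc]
        gcongr
      calc _ ≤ N * (K * s⁻¹ * ‖x - y‖) ^ α := by gcongr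
        _ = _ := by
          rw [Real.mul_rpow (by positivity) (norm_nonneg _), Real.mul_rpow (by positivity)
            (by positivity), Real.inv_rpow hs0.le, Real.rpow_neg hs0.le]
          ring
  obtain ⟨V, hV, hVeq, hV0⟩ := H _ _ hF'
  set m := s ^ (-α) with hm
  have hLn : ‖s • P‖ ≤ s * K := by
    rw [norm_smul, Real.norm_of_nonneg hs0.le]; gcongr
  have hVP := hV.comp_clm h0.le (by positivity) (s • P) hLn
  have hv := hVP.smul (s ^ 2)⁻¹
  refine ⟨_, hv.mono ?_ ?_ ?_ ?_, fun x hx => ?_, fun x hx => ?_⟩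
  · rw [abs_of_pos (by positivity)]
    calc _ = C * K ^ α * 1 * 1 * N * m / s ^ 2 := by ring
      _ ≤ _ := by
        gcongr
        exact one_le_pow₀ hK
  · rw [abs_of_pos (by positivity)]
    calc _ = C * K ^ α * K * 1 * N * m / s := by field_simp
      _ ≤ _ := by
        gcongr
        exact le_self_pow₀ hK (by norm_num)
  · rw [abs_of_pos (by positivity)]
    calc _ = C * K ^ α * K ^ 2 * 1 * N * m := by field_simp
      _ ≤ _ := by
        gcongr
  · rw [abs_of_pos (by positivity), Real.mul_rpow hs0.le (by positivity)]
    have : s ^ α * m = 1 := by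
      rw [hm, ← Real.rpow_add hs0]; simp
    calc _ = C * K ^ α * K ^ 2 * K ^ α * N * (s ^ α * m) := by field_simp
      _ ≤ _ := by rw [this, mul_one]
  · rw [hVP.fderiv_fderiv_smul]
    have hD : ∀ h k, fderiv ℝ (fderiv ℝ fun x => V ((s • P) x)) x h k =
        s ^ 2 * fderiv ℝ (fderiv ℝ V) ((s • P) x) (P h) (P k) := fun h k => by
      rw [fderiv_fderiv_comp_clm (s • P) hV.contDiff]
      simp only [_root_.smul_apply, map_smul, smul_eq_mul]
      ring
    have hD' : ∀ h k, ((s ^ 2)⁻¹ • fderiv ℝ (fderiv ℝ fun x => V ((s • P) x)) x) h k =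
        fderiv ℝ (fderiv ℝ V) ((s • P) x) (P h) (P k) := fun h k => by
      rw [_root_.smul_apply, _root_.smul_apply, hD, smul_eq_mul, inv_mul_cancel_left₀ (by positivity)]
    simp only [hD']
    have hx' : 0 ≤ inner ℝ (stdE (0 : Fin n) : 𝔼) ((s • P) x) := by
      rw [inner_stdE]
      simp only [_root_.smul_apply, PiLp.smul_apply, smul_eq_mul, hPx]
      positivity
    have q := hVeq b _ hx'
    rw [← hT] at q
    have q2 : s⁻¹ • ((s • P) x) = P x := by
      rw [_root_.smul_apply, smul_smul, inv_mul_cancel₀ hs0.ne', one_smul]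
    rw [q2, hQP] at q
    rw [← q, mul_inv_cancel_left₀ (by positivity)]
  · rw [hV0, mul_zero]
    rw [inner_stdE]
    simp only [_root_.smul_apply, PiLp.smul_apply, smul_eq_mul, hPx, hx, mul_zero]

end Model

section HBscalar

set_option linter.unusedSectionVars false

variable {X : Type} [NormedAddCommGroup X] [NormedSpace ℝ X] {α : ℝ} {S U : Set X}

theorem HB.cutmul {f g : X → ℝ} {A B A' B' : ℝ} (hB : 0 ≤ B) (hB' : 0 ≤ B') (hA' : 0 ≤ A')
    (hf : HB α S f A B) (hg : HB α (S ∩ U) g A' B') (hU : ∀ x ∈ S, x ∉ U → f x = 0) :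
    HB α S (fun x => f x * g x) (A * A') (B * A' + A * B') :=
  HB.cut (ContinuousLinearMap.mul ℝ ℝ) (ContinuousLinearMap.opNorm_mul_le ℝ ℝ) hB hB' hA' hf hg hU

theorem HB.mul {f g : X → ℝ} {A B A' B' : ℝ} (hB : 0 ≤ B) (hB' : 0 ≤ B') (hA' : 0 ≤ A')
    (hf : HB α S f A B) (hg : HB α S g A' B') :
    HB α S (fun x => f x * g x) (A * A') (B * A' + A * B') :=
  HB.cutmul (U := univ) hB hB' hA' hf (by simpa using hg) (by simp)

/-- Bounded Hölder continuous functions on a set. -/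
def IsHB (α : ℝ) (S : Set X) (f : X → ℝ) : Prop := ∃ c, 0 ≤ c ∧ HB α S f c c

theorem HB.isHB {f : X → ℝ} {A B : ℝ} (h : HB α S f A B) : IsHB α S f :=
  ⟨max 0 (max A B), le_max_left _ _, h.mono ((le_max_left _ _).trans (le_max_right _ _))
    ((le_max_right _ _).trans (le_max_right _ _))⟩

theorem IsHB.congr {f g : X → ℝ} (h : IsHB α S f) (hg : ∀ x ∈ S, g x = f x) : IsHB α S g := by
  obtain ⟨c, hc, h⟩ := h
  exact (h.congr hg).isHB

theorem IsHB.add {f g : X → ℝ} (hf : IsHB α S f) (hg : IsHB α S g) :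
    IsHB α S fun x => f x + g x := by
  obtain ⟨c, hc, hf⟩ := hf
  obtain ⟨d, hd, hg⟩ := hg
  exact (hf.add hg).isHB

theorem IsHB.neg {f : X → ℝ} (hf : IsHB α S f) : IsHB α S fun x => -f x := by
  obtain ⟨c, hc, hf⟩ := hf
  exact hf.neg.isHB

theorem IsHB.sub {f g : X → ℝ} (hf : IsHB α S f) (hg : IsHB α S g) :
    IsHB α S fun x => f x - g x := by
  simpa only [sub_eq_add_neg] using hf.add hg.neg

theorem IsHB.cutmul {f g : X → ℝ} (hf : IsHB α S f) (hg : IsHB α (S ∩ U) g)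
    (hU : ∀ x ∈ S, x ∉ U → f x = 0) : IsHB α S fun x => f x * g x := by
  obtain ⟨c, hc, hf⟩ := hf
  obtain ⟨d, hd, hg⟩ := hg
  exact (HB.cutmul hc hd hd hf hg hU).isHB

theorem IsHB.mul {f g : X → ℝ} (hf : IsHB α S f) (hg : IsHB α S g) :
    IsHB α S fun x => f x * g x :=
  IsHB.cutmul (U := univ) hf (by simpa using hg) (by simp)

theorem IsHB.const (c : ℝ) : IsHB α S fun _ => c := (HB.const c).isHB

theorem IsHB.sum {ι : Type} (s : Finset ι) {f : ι → X → ℝ} (hf : ∀ i ∈ s, IsHB α S (f i)) :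
    IsHB α S fun x => ∑ i ∈ s, f i x := by
  choose! c hc h using hf
  exact (HB.sum s h).isHB

/-- Extension of a bounded Hölder function with the same bounds. -/
theorem HB.exists_extension (h0 : 0 < α) (h1 : α ≤ 1) {f : X → ℝ} {A B : ℝ} (hA : 0 ≤ A)
    (hB : 0 ≤ B) (hf : HB α S f A B) : ∃ F : X → ℝ, BddHolder α F A B ∧ ∀ x ∈ S, F x = f x := by
  rcases S.eq_empty_or_nonempty with rfl | ⟨x₀, hx₀⟩
  · exact ⟨fun _ => 0, ⟨fun _ => by simpa using hA, fun _ _ => by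
      simpa using mul_nonneg hB (Real.rpow_nonneg (norm_nonneg _) _)⟩, by simp⟩
  have : Nonempty S := ⟨⟨x₀, hx₀⟩⟩
  set G : X → ℝ := fun x => ⨅ t : S, (f t + B * ‖x - t‖ ^ α) with hG
  have tri : ∀ x y z : X, ‖x - z‖ ^ α ≤ ‖x - y‖ ^ α + ‖y - z‖ ^ α := fun x y z =>
    (Real.rpow_le_rpow (norm_nonneg _) (norm_sub_le_norm_sub_add_norm_sub x y z) h0.le).trans
      (Real.rpow_add_le_add_rpow (norm_nonneg _) (norm_nonneg _) h0.le h1)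
  have hbdd : ∀ x : X, BddBelow (range fun t : S => f t + B * ‖x - (t : X)‖ ^ α) := fun x => by
    refine ⟨-A, ?_⟩
    rintro _ ⟨t, rfl⟩
    have := (abs_le.1 (hf.bd t t.2)).1
    have : 0 ≤ B * ‖x - t‖ ^ α := by positivity
    dsimp only
    linarith
  have hle : ∀ x y, G x ≤ G y + B * ‖x - y‖ ^ α := fun x y => by
    rw [← sub_le_iff_le_add]
    refine le_ciInf fun t => ?_
    have := ciInf_le (hbdd x) t
    have h2 := mul_le_mul_of_nonneg_left (tri x y t) hB
    simp only [hG]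
    linarith
  have hGS : ∀ x ∈ S, G x = f x := fun x hx => by
    refine le_antisymm ?_ (le_ciInf fun t => ?_)
    · refine (ciInf_le (hbdd x) ⟨x, hx⟩).trans ?_
      simp [Real.zero_rpow h0.ne']
    · have := (abs_le.1 (hf.hd x hx t t.2)).2
      linarith
  refine ⟨fun x => max (-A) (min A (G x)), ⟨fun x => ?_, fun x y => ?_⟩, fun x hx => ?_⟩
  · exact abs_le.2 ⟨le_max_left _ _, max_le (by linarith) (min_le_left _ _)⟩
  · have h2 : |G x - G y| ≤ B * ‖x - y‖ ^ α := abs_sub_le_iff.2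
      ⟨by linarith [hle x y], by have := hle y x; rw [norm_sub_rev] at this; linarith⟩
    refine le_trans ?_ h2
    refine (abs_max_sub_max_le_max _ _ _ _).trans (max_le (by simp) ?_)
    exact (abs_min_sub_min_le_max _ _ _ _).trans (max_le (by simp) le_rfl)
  · have := abs_le.1 (hf.bd x hx)
    simp only [hGS x hx]
    rw [min_eq_right this.2, max_eq_right this.1]

/-- Sums with bounded overlap. -/
theorem HB.sum_overlap {ι : Type} (s : Finset ι) {f : ι → X → ℝ} {A B : ℝ} (hA : 0 ≤ A)
    (hB : 0 ≤ B) (hf : ∀ i ∈ s, HB α S (f i) A B) (V : ι → Set X)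
    (hV : ∀ i ∈ s, ∀ x ∈ S, x ∉ V i → f i x = 0) {m : ℕ}
    (hm : ∀ x ∈ S, ∀ t ⊆ s, (∀ i ∈ t, x ∈ V i) → t.card ≤ m) :
    HB α S (fun x => ∑ i ∈ s, f i x) (m * A) (2 * m * B) := by
  classical
  have hcard : ∀ x ∈ S, (((s.filter fun i => x ∈ V i).card : ℕ) : ℝ) ≤ m := fun x hx =>
    Nat.cast_le.2 (hm x hx _ (Finset.filter_subset _ _) fun i hi => (Finset.mem_filter.1 hi).2)
  refine ⟨fun x hx => ?_, fun x hx y hy => ?_⟩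
  · have h1 : ∑ i ∈ s, f i x = ∑ i ∈ s.filter (fun i => x ∈ V i), f i x := by
      refine (Finset.sum_subset (Finset.filter_subset _ _) fun i hi hi' => ?_).symm
      exact hV i hi x hx fun h => hi' (Finset.mem_filter.2 ⟨hi, h⟩)
    rw [h1]
    refine (norm_sum_le_of_le _ fun i hi => (hf i (Finset.mem_filter.1 hi).1).bd x hx).trans ?_
    rw [Finset.sum_const, nsmul_eq_mul]
    exact mul_le_mul_of_nonneg_right (hcard x hx) hA
  · rw [← Finset.sum_sub_distrib]
    have h1 : ∑ i ∈ s, (f i x - f i y) = ∑ i ∈ s.filter (fun i => x ∈ V i) ∪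
        s.filter (fun i => y ∈ V i), (f i x - f i y) := by
      refine (Finset.sum_subset (Finset.union_subset (Finset.filter_subset _ _)
        (Finset.filter_subset _ _)) fun i hi hi' => ?_).symm
      rw [Finset.mem_union, not_or] at hi'
      rw [hV i hi x hx fun h => hi'.1 (Finset.mem_filter.2 ⟨hi, h⟩),
        hV i hi y hy fun h => hi'.2 (Finset.mem_filter.2 ⟨hi, h⟩), sub_zero]
    rw [h1]
    refine (norm_sum_le_of_le _ fun i hi => (hf i ?_).hd x hx y hy).trans ?_
    · rcases Finset.mem_union.1 hi with h | h <;> exact (Finset.mem_filter.1 h).1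
    rw [Finset.sum_const, nsmul_eq_mul, ← mul_assoc]
    gcongr
    have := Finset.card_union_le (s.filter fun i => x ∈ V i) (s.filter fun i => y ∈ V i)
    calc _ ≤ (((s.filter fun i => x ∈ V i).card + (s.filter fun i => y ∈ V i).card : ℕ) : ℝ) :=
          Nat.cast_le.2 this
      _ ≤ _ := by push_cast; linarith [hcard x hx, hcard y hy]

end HBscalar

section Neumann

set_option linter.unusedSectionVars false

variable {n : ℕ} {α : ℝ}

local notation "𝔼" => EuclideanSpace ℝ (Fin n)

/-- A second order linear differential operator. -/
noncomputable def Lop (a : EuclideanSpace ℝ (Fin n) → Fin n → Fin n → ℝ)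
    (b : EuclideanSpace ℝ (Fin n) → Fin n → ℝ) (c : EuclideanSpace ℝ (Fin n) → ℝ)
    (u : EuclideanSpace ℝ (Fin n) → ℝ) (x : EuclideanSpace ℝ (Fin n)) : ℝ :=
  ∑ i, ∑ j, a x i j * fderiv ℝ (fderiv ℝ u) x (stdE i) (stdE j) +
    ∑ i, b x i * fderiv ℝ u x (stdE i) + c x * u x

variable {a : EuclideanSpace ℝ (Fin n) → Fin n → Fin n → ℝ}
    {b : EuclideanSpace ℝ (Fin n) → Fin n → ℝ} {c : EuclideanSpace ℝ (Fin n) → ℝ}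

theorem Lop_add {u v : 𝔼 → ℝ} {x : 𝔼} (hu : ContDiffAt ℝ 2 u x) (hv : ContDiffAt ℝ 2 v x) :
    Lop a b c (fun y => u y + v y) x = Lop a b c u x + Lop a b c v x := by
  have h1 : fderiv ℝ (fun y => u y + v y) =ᶠ[𝓝 x] fun y => fderiv ℝ u y + fderiv ℝ v y := by
    filter_upwards [eventually_contDiffAt hu, eventually_contDiffAt hv] with y h2 h3
    exact fderiv_fun_add (differentiableAt_of_contDiffAt_two h2)
      (differentiableAt_of_contDiffAt_two h3)
  have h2 := h1.fderiv_eq (𝕜 := ℝ)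
  rw [fderiv_fun_add (𝕜 := ℝ) (differentiableAt_fderiv hu) (differentiableAt_fderiv hv)] at h2
  simp only [Lop, h2, h1.eq_of_nhds, _root_.add_apply, mul_add, Finset.sum_add_distrib]
  ring

theorem Lop_smul {u : 𝔼 → ℝ} {x : 𝔼} (hu : ContDiffAt ℝ 2 u x) (t : ℝ) :
    Lop a b c (fun y => t * u y) x = t * Lop a b c u x := by
  have h1 : fderiv ℝ (fun y => t * u y) =ᶠ[𝓝 x] fun y => t • fderiv ℝ u y := by
    filter_upwards [eventually_contDiffAt hu] with y h2
    exact fderiv_const_mul (differentiableAt_of_contDiffAt_two h2) t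
  have h2 := h1.fderiv_eq (𝕜 := ℝ)
  rw [fderiv_fun_const_smul (𝕜 := ℝ) (R := ℝ) (differentiableAt_fderiv hu)] at h2
  simp only [Lop, h2, h1.eq_of_nhds, _root_.smul_apply, smul_eq_mul, mul_add, Finset.mul_sum]
  congr 1
  · congr 1
    · exact Finset.sum_congr rfl fun i _ => Finset.sum_congr rfl fun j _ => by ring
    · exact Finset.sum_congr rfl fun i _ => by ring
  · ring

/-- Convergence of the Neumann series: an approximate solution operator gives exact solutions. -/
theorem neumann_series (hα : 0 < α) {K Z : Set 𝔼} {P : (𝔼 → ℝ) → ℝ → Prop} {C C₂ θ : ℝ}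
    (hθ : 0 ≤ θ) (hθ1 : θ < 1)
    (hsolve : ∀ f A, 0 ≤ A → P f A → ∃ u : 𝔼 → ℝ, C2B α u (C * A) (C * A) (C * A) (C * A) ∧
      (∀ x ∈ Z, u x = 0) ∧ P (fun x => f x - Lop a b c u x) (θ * A))
    (hbd : ∀ f A, P f A → ∀ x ∈ K, |f x| ≤ C₂ * A) {f : 𝔼 → ℝ} {A : ℝ} (hA : 0 ≤ A) (hf : P f A) :
    ∃ u : 𝔼 → ℝ, C2B α u (C * A / (1 - θ)) (C * A / (1 - θ)) (C * A / (1 - θ)) (C * A / (1 - θ)) ∧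
      (∀ x ∈ Z, u x = 0) ∧ ∀ x ∈ K, Lop a b c u x = f x := by
  choose! S hS1 hS2 hS3 using hsolve
  let r : ℕ → 𝔼 → ℝ := fun k => Nat.rec f
    (fun k g => fun x => g x - Lop a b c (S g (θ ^ k * A)) x) k
  have hr : ∀ k, P (r k) (θ ^ k * A) := fun k => by
    induction k with
    | zero => simpa [r] using hf
    | succ k ih =>
      have := hS3 _ _ (by positivity) ih
      rw [← mul_assoc, ← pow_succ'] at this
      exact this
  set u : ℕ → 𝔼 → ℝ := fun k => S (r k) (θ ^ k * A) with hu
  have hrs : ∀ k x, r (k + 1) x = r k x - Lop a b c (u k) x := fun k x => rfl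
  have huB : ∀ k, C2B α (u k) (C * A * θ ^ k) (C * A * θ ^ k) (C * A * θ ^ k) (C * A * θ ^ k) :=
    fun k => by
      have := hS1 _ _ (by positivity) (hr k)
      rwa [show C * (θ ^ k * A) = C * A * θ ^ k by ring] at this
  have hsum : Summable fun k => C * A * θ ^ k := (summable_geometric_of_lt_one hθ hθ1).mul_left _
  have htsum : ∑' k, C * A * θ ^ k = C * A / (1 - θ) := by
    rw [tsum_mul_left, tsum_geometric_of_lt_one hθ hθ1]; rfl
  have s0 : ∀ x, Summable fun k => u k x := fun x =>
    Summable.of_norm_bounded hsum fun k => (huB k).b0 x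
  have s1 : ∀ x, Summable fun k => fderiv ℝ (u k) x := fun x =>
    Summable.of_norm_bounded hsum fun k => (huB k).b1 x
  have s2 : ∀ x, Summable fun k => fderiv ℝ (fderiv ℝ (u k)) x := fun x =>
    Summable.of_norm_bounded hsum fun k => (huB k).b2 x
  have d1 : ∀ x, HasFDerivAt (fun x => ∑' k, u k x) (∑' k, fderiv ℝ (u k) x) x := fun x =>
    hasFDerivAt_tsum hsum (fun k x => ((huB k).differentiable x).hasFDerivAt)
      (fun k x => (huB k).b1 x) (s0 0) x
  have d2 : ∀ x, HasFDerivAt (fun x => ∑' k, fderiv ℝ (u k) x)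
      (∑' k, fderiv ℝ (fderiv ℝ (u k)) x) x := fun x =>
    hasFDerivAt_tsum hsum (fun k x => ((huB k).differentiable_fderiv x).hasFDerivAt)
      (fun k x => (huB k).b2 x) (s1 0) x
  have e1 : fderiv ℝ (fun x => ∑' k, u k x) = fun x => ∑' k, fderiv ℝ (u k) x :=
    funext fun x => (d1 x).fderiv
  have e2 : fderiv ℝ (fun x => ∑' k, fderiv ℝ (u k) x) =
    fun x => ∑' k, fderiv ℝ (fderiv ℝ (u k)) x := funext fun x => (d2 x).fderiv
  refine ⟨fun x => ∑' k, u k x, ?_, fun x hx => ?_, fun x hx => ?_⟩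
  · rw [← htsum]
    refine C2B.of_hasFDerivAt hα d1 d2 (fun x => ?_) (fun x => ?_) (fun x => ?_) fun x y => ?_
    · rw [← Real.norm_eq_abs]
      exact tsum_of_norm_bounded hsum.hasSum fun k => (huB k).b0 x
    · exact tsum_of_norm_bounded hsum.hasSum fun k => (huB k).b1 x
    · exact tsum_of_norm_bounded hsum.hasSum fun k => (huB k).b2 x
    · rw [← (s2 x).tsum_sub (s2 y), ← tsum_mul_right]
      exact tsum_of_norm_bounded (hsum.mul_right _).hasSum fun k => (huB k).b3 x y
  · have : ∀ k, u k x = 0 := fun k => hS2 _ _ (by positivity) (hr k) x hx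
    simp [this]
  · have hL : HasSum (fun k => Lop a b c (u k) x) (Lop a b c (fun x => ∑' k, u k x) x) := by
      simp only [Lop, e1, e2]
      refine ((hasSum_sum fun i _ => hasSum_sum fun j _ => ?_).add
        (hasSum_sum fun i _ => ?_)).add ((s0 x).hasSum.mul_left _)
      · refine HasSum.mul_left _ ?_
        have := ((ContinuousLinearMap.apply ℝ ℝ (stdE j)).comp
          (ContinuousLinearMap.apply ℝ (𝔼 →L[ℝ] ℝ) (stdE i))).hasSum (s2 x).hasSum
        exact this
      · exact ((ContinuousLinearMap.apply ℝ ℝ (stdE i)).hasSum (s1 x).hasSum).mul_left _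
    have hpart : ∀ k, ∑ j ∈ Finset.range k, Lop a b c (u j) x = f x - r k x := fun k => by
      induction k with
      | zero => simp [r]
      | succ k ih => rw [Finset.sum_range_succ, ih, hrs]; ring
    have hr0 : Tendsto (fun k => r k x) atTop (𝓝 0) := by
      refine squeeze_zero_norm (a := fun k => C₂ * (θ ^ k * A)) (fun k => hbd _ _ (hr k) x hx) ?_
      have := ((tendsto_pow_atTop_nhds_zero_of_lt_one hθ hθ1).mul_const A).const_mul C₂
      simpa using this
    have h1 := hL.tendsto_sum_nat
    simp only [hpart] at h1
    have h2 := (tendsto_const_nhds (x := f x)).sub hr0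
    rw [sub_zero] at h2
    exact tendsto_nhds_unique h1 h2

end Neumann

section MaxPrinciple

set_option linter.unusedSectionVars false

theorem fderiv_fderiv_nonpos_of_isLocalMax {X : Type} [NormedAddCommGroup X] [NormedSpace ℝ X]
    {u : X → ℝ} {x : X} (hu : ContDiffAt ℝ 2 u x) (hx : IsLocalMax u x) (v : X) :
    fderiv ℝ (fderiv ℝ u) x v v ≤ 0 := by
  by_contra! hpos
  have hl : ∀ t : ℝ, HasDerivAt (fun t : ℝ => x + t • v) v t := fun t => by
    simpa using ((hasDerivAt_id t).smul_const v).const_add x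
  have hl0 : Tendsto (fun t : ℝ => x + t • v) (𝓝 0) (𝓝 x) := by
    have := (hl 0).continuousAt.tendsto
    simpa using this
  set g : ℝ → ℝ := fun t => u (x + t • v) with hg
  have hx0 : x + (0 : ℝ) • v = x := by simp
  have h1 : deriv g =ᶠ[𝓝 0] fun t => fderiv ℝ u (x + t • v) v := by
    filter_upwards [hl0.eventually (eventually_contDiffAt hu)] with t ht
    have h := (differentiableAt_of_contDiffAt_two ht).hasFDerivAt
    have h' : HasDerivAt g (fderiv ℝ u (x + t • v) v) t :=
      HasFDerivAt.comp_hasDerivAt (f := fun t : ℝ => x + t • v) t h (hl t)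
    exact h'.deriv
  have h2 : deriv (deriv g) 0 = fderiv ℝ (fderiv ℝ u) x v v := by
    rw [h1.deriv_eq]
    have hd : HasFDerivAt (fderiv ℝ u) (fderiv ℝ (fderiv ℝ u) x) (x + (0 : ℝ) • v) := by
      rw [hx0]; exact (differentiableAt_fderiv hu).hasFDerivAt
    have h' : HasDerivAt (fun t : ℝ => fderiv ℝ u (x + t • v))
        (fderiv ℝ (fderiv ℝ u) x v) 0 :=
      HasFDerivAt.comp_hasDerivAt (f := fun t : ℝ => x + t • v) 0 hd (hl 0)
    have := h'.clm_apply (hasDerivAt_const (0 : ℝ) v)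
    simpa using this.deriv
  have hmax : IsLocalMax g 0 := by
    have : ∀ᶠ t in 𝓝 (0 : ℝ), u (x + t • v) ≤ u x := hl0.eventually hx
    filter_upwards [this] with t ht
    simpa [hg] using ht
  have hmin : IsLocalMin g 0 := by
    refine isLocalMin_of_deriv_deriv_pos (by rwa [h2]) hmax.deriv_eq_zero ?_
    have h3 : ContinuousAt u (x + (0 : ℝ) • v) := by rw [hx0]; exact hu.continuousAt
    exact ContinuousAt.comp (f := fun t : ℝ => x + t • v) h3 (hl 0).continuousAt
  have hconst : g =ᶠ[𝓝 0] fun _ => g 0 := by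
    filter_upwards [hmax, hmin] with t h3 h4
    exact le_antisymm h3 h4
  have : deriv g =ᶠ[𝓝 0] deriv fun _ => g 0 := hconst.deriv
  rw [this.deriv_eq] at h2
  simp at h2
  linarith

variable {n : ℕ}

local notation "𝔼" => EuclideanSpace ℝ (Fin n)

open scoped MatrixOrder in
theorem sum_mul_nonpos_of_posSemidef {a : Fin n → Fin n → ℝ} (hs : ∀ i j, a i j = a j i)
    (ha : ∀ ξ : Fin n → ℝ, 0 ≤ ∑ i, ∑ j, a i j * ξ i * ξ j) {H : 𝔼 →L[ℝ] 𝔼 →L[ℝ] ℝ}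
    (hH : ∀ v, H v v ≤ 0) : ∑ i, ∑ j, a i j * H (stdE i) (stdE j) ≤ 0 := by
  have hA : (Matrix.of a).PosSemidef := by
    refine Matrix.PosSemidef.of_dotProduct_mulVec_nonneg ?_ fun ξ => ?_
    · ext i j
      simp [hs i j]
    · have := ha ξ
      have e : star ξ ⬝ᵥ (Matrix.of a).mulVec ξ = ∑ i, ξ i * ∑ j, a i j * ξ j := rfl
      rw [e]
      refine this.trans_eq ?_
      simp only [Finset.mul_sum]
      exact Finset.sum_congr rfl fun i _ => Finset.sum_congr rfl fun j _ => by ring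
  obtain ⟨B, hB1, hB2⟩ : ∃ B : Matrix (Fin n) (Fin n) ℝ, B.IsHermitian ∧ B * B = Matrix.of a :=
    ⟨CFC.sqrt (Matrix.of a), (Matrix.nonneg_iff_posSemidef.1 (CFC.sqrt_nonneg _)).isHermitian,
      CFC.sqrt_mul_sqrt_self _ hA.nonneg⟩
  have hab : ∀ i j, a i j = ∑ k, B k i * B k j := fun i j => by
    have := congrFun (congrFun hB2 i) j
    rw [Matrix.mul_apply] at this
    rw [← Matrix.of_apply a, ← this]
    refine Finset.sum_congr rfl fun k _ => ?_
    have := hB1.apply i k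
    simp at this
    rw [this]
  have : ∑ i, ∑ j, a i j * H (stdE i) (stdE j) =
      ∑ k, H (∑ i, B k i • stdE i) (∑ j, B k j • stdE j) := by
    simp only [map_sum, map_smul, _root_.sum_apply, _root_.smul_apply, smul_eq_mul, hab,
      Finset.sum_mul, Finset.mul_sum]
    rw [Finset.sum_congr rfl fun i _ => Finset.sum_comm, Finset.sum_comm]
    refine Finset.sum_congr rfl fun k _ => ?_
    rw [Finset.sum_comm]
    exact Finset.sum_congr rfl fun i _ => Finset.sum_congr rfl fun j _ => by ring
  rw [this]
  exact Finset.sum_nonpos fun k _ => hH _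

theorem max_principle {a : 𝔼 → Fin n → Fin n → ℝ} {b : 𝔼 → Fin n → ℝ} {c : 𝔼 → ℝ}
    {Ω : Set 𝔼} (hΩ : IsOpen Ω) (hb : Bornology.IsBounded Ω) {w : 𝔼 → ℝ}
    (hwc : ContinuousOn w (closure Ω)) (hw : ∀ x ∈ Ω, ContDiffAt ℝ 2 w x)
    (hs : ∀ x i j, a x i j = a x j i)
    (ha : ∀ x ∈ Ω, ∀ ξ : Fin n → ℝ, 0 ≤ ∑ i, ∑ j, a x i j * ξ i * ξ j) (hc : ∀ x ∈ Ω, c x ≤ 0)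
    (hL : ∀ x ∈ Ω, 0 < Lop a b c w x) (hbd : ∀ x ∈ frontier Ω, w x ≤ 0) :
    ∀ x ∈ closure Ω, w x ≤ 0 := by
  intro x hx
  obtain ⟨z, hz, hmax⟩ := hb.isCompact_closure.exists_isMaxOn ⟨x, hx⟩ hwc
  refine (hmax hx).trans ?_
  by_contra! hpos
  have hzΩ : z ∈ Ω := by
    by_contra h
    exact absurd (hbd z ⟨hz, by rwa [hΩ.interior_eq]⟩) hpos.not_ge
  have hloc : IsLocalMax w z := hmax.isLocalMax (mem_of_superset (hΩ.mem_nhds hzΩ) subset_closure)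
  have h1 : fderiv ℝ w z = 0 := hloc.fderiv_eq_zero
  have h2 := hL z hzΩ
  have h3 := sum_mul_nonpos_of_posSemidef (hs z) (ha z hzΩ)
    (fun v => fderiv_fderiv_nonpos_of_isLocalMax (hw z hzΩ) hloc v)
  have h4 := mul_nonpos_of_nonpos_of_nonneg (hc z hzΩ) hpos.le
  simp only [Lop, h1, _root_.zero_apply, mul_zero, Finset.sum_const_zero, add_zero] at h2
  linarith

theorem exists_barrier [NeZero n] {Ω : Set 𝔼} (hb : Bornology.IsBounded Ω) {lam : ℝ} (hlam : 0 < lam)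
    {a : 𝔼 → Fin n → Fin n → ℝ} {b : 𝔼 → Fin n → ℝ} {c : 𝔼 → ℝ}
    (ha : ∀ x ∈ Ω, ∀ ξ : Fin n → ℝ, lam * ∑ i, ξ i ^ 2 ≤ ∑ i, ∑ j, a x i j * ξ i * ξ j)
    {B : ℝ} (hB : ∀ x ∈ Ω, ∀ i, |b x i| ≤ B) (hc : ∀ x ∈ Ω, c x ≤ 0) :
    ∃ (q : 𝔼 → ℝ) (Q : ℝ), ContDiff ℝ 2 q ∧ (∀ x ∈ closure Ω, 1 ≤ q x) ∧
      (∀ x ∈ closure Ω, q x ≤ Q) ∧ ∀ x ∈ Ω, Lop a b c q x ≤ -1 := by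
  obtain ⟨R, hR⟩ := hb.closure.exists_norm_le
  set β : ℝ := (max B 0 + 1) / lam with hβ
  have hβ0 : 0 < β := by positivity
  set κ : ℝ := Real.exp (β * R) / β with hκ
  have hκ0 : 0 < κ := by positivity
  have hx0 : ∀ x ∈ closure Ω, |x 0| ≤ R := fun x hx =>
    (PiLp.norm_apply_le x 0).trans (hR x hx)
  let l : 𝔼 →L[ℝ] ℝ := EuclideanSpace.proj 0
  have hl : ∀ y, l y = y 0 := fun _ => rfl
  set q : 𝔼 → ℝ := fun x => 1 + κ * (Real.exp (β * R) - Real.exp (β * x 0)) with hq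
  have d0 : ∀ x : 𝔼, HasFDerivAt (fun x : 𝔼 => Real.exp (β * x 0))
      (Real.exp (β * x 0) • (β • l)) x := fun x => (l.hasFDerivAt.const_mul β).exp
  have d1 : ∀ x, HasFDerivAt q (-(κ * β * Real.exp (β * x 0)) • l) x := fun x => by
    refine ((((d0 x).const_sub _).const_mul κ).const_add 1).congr_fderiv ?_
    ext y; simp; ring
  have e1 : fderiv ℝ q = fun x => (-(κ * β * Real.exp (β * x 0))) • l :=
    funext fun x => (d1 x).fderiv
  have e2 : ∀ x h k, fderiv ℝ (fderiv ℝ q) x h k = -(κ * β ^ 2 * Real.exp (β * x 0)) * h 0 * k 0 :=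
    fun x h k => by
      have h := (((d0 x).const_mul (-(κ * β))).smul_const l).fderiv
      simp only [neg_mul] at h e1
      rw [e1, h]
      simp only [ContinuousLinearMap.smulRight_apply, _root_.smul_apply, smul_eq_mul, hl]
      ring
  have hexp : ∀ x ∈ closure Ω, Real.exp (β * x 0) ≤ Real.exp (β * R) := fun x hx =>
    Real.exp_le_exp.2 (mul_le_mul_of_nonneg_left (abs_le.1 (hx0 x hx)).2 hβ0.le)
  have hq1 : ∀ x ∈ closure Ω, 1 ≤ q x := fun x hx => by
    have := mul_nonneg hκ0.le (sub_nonneg.2 (hexp x hx))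
    simp only [hq]; linarith
  refine ⟨q, 1 + κ * Real.exp (β * R), ?_, hq1, fun x hx => ?_, fun x hx => ?_⟩
  · have : ContDiff ℝ 2 fun x : 𝔼 => x 0 := l.contDiff
    exact contDiff_const.add (contDiff_const.mul (contDiff_const.sub
      (Real.contDiff_exp.comp (contDiff_const.mul this))))
  · simp only [hq]
    have := mul_pos hκ0 (Real.exp_pos (β * x 0))
    linarith
  · have hs : ∀ g : Fin n → ℝ, ∑ i, g i * (stdE i : 𝔼) 0 = g 0 := fun g => by
      rw [Finset.sum_eq_single 0]
      · simp
      · intro i _ hi; simp [hi.symm]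
      · simp
    have h00 : lam ≤ a x 0 0 := by
      have := ha x hx (Pi.single 0 1)
      simpa [Pi.single_apply, ite_pow] using this
    have hL : Lop a b c q x = c x * q x - κ * Real.exp (β * x 0) *
        (a x 0 0 * β ^ 2 + b x 0 * β) := by
      have t1 : ∑ i, ∑ j, a x i j * fderiv ℝ (fderiv ℝ q) x (stdE i) (stdE j) =
          -(κ * β ^ 2 * Real.exp (β * x 0)) * a x 0 0 := by
        rw [← hs fun i => -(κ * β ^ 2 * Real.exp (β * x 0)) * a x i 0]
        refine Finset.sum_congr rfl fun i _ => ?_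
        rw [← hs fun j => -(κ * β ^ 2 * Real.exp (β * x 0)) * a x i j, Finset.sum_mul]
        refine Finset.sum_congr rfl fun j _ => ?_
        rw [e2]; ring
      have t2 : ∑ i, b x i * fderiv ℝ q x (stdE i) = -(κ * β * Real.exp (β * x 0)) * b x 0 := by
        rw [← hs fun i => -(κ * β * Real.exp (β * x 0)) * b x i]
        refine Finset.sum_congr rfl fun i _ => ?_
        rw [e1]
        simp only [_root_.smul_apply, smul_eq_mul, hl]
        ring
      rw [Lop, t1, t2]; ring
    rw [hL]
    have hb0 : -max B 0 ≤ b x 0 := by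
      have := (abs_le.1 (hB x hx 0)).1
      linarith [le_max_left B 0]
    have hk1 : β ≤ a x 0 0 * β ^ 2 + b x 0 * β := by
      have h5 : lam * β = max B 0 + 1 := by rw [hβ]; field_simp
      nlinarith [mul_le_mul_of_nonneg_right h00 (sq_nonneg β),
        mul_le_mul_of_nonneg_right hb0 hβ0.le, congrArg (· * β) h5]
    have hk2 : 1 ≤ κ * Real.exp (β * x 0) * β := by
      have h6 : κ * Real.exp (β * x 0) * β = Real.exp (β * R + β * x 0) := by
        rw [Real.exp_add, hκ]; field_simp
      rw [h6]
      refine Real.one_le_exp ?_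
      have := (abs_le.1 (hx0 x (subset_closure hx))).1
      nlinarith
    have hk3 := mul_le_mul_of_nonneg_left hk1 (by positivity : 0 ≤ κ * Real.exp (β * x 0))
    have := mul_nonpos_of_nonpos_of_nonneg (hc x hx)
      (zero_le_one.trans (hq1 x (subset_closure hx)))
    linarith

variable {a : EuclideanSpace ℝ (Fin n) → Fin n → Fin n → ℝ}
    {b : EuclideanSpace ℝ (Fin n) → Fin n → ℝ} {c q : EuclideanSpace ℝ (Fin n) → ℝ}
    {Ω : Set (EuclideanSpace ℝ (Fin n))} {Q : ℝ}

theorem le_barrier (hΩ : IsOpen Ω) (hb : Bornology.IsBounded Ω)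
    (hs : ∀ x i j, a x i j = a x j i)
    (ha : ∀ x ∈ Ω, ∀ ξ : Fin n → ℝ, 0 ≤ ∑ i, ∑ j, a x i j * ξ i * ξ j) (hc : ∀ x ∈ Ω, c x ≤ 0)
    (hq : ContDiff ℝ 2 q) (hq1 : ∀ x ∈ closure Ω, 1 ≤ q x) (hqQ : ∀ x ∈ closure Ω, q x ≤ Q)
    (hLq : ∀ x ∈ Ω, Lop a b c q x ≤ -1) {u : 𝔼 → ℝ} (huc : ContinuousOn u (closure Ω))
    (hu : ∀ x ∈ Ω, ContDiffAt ℝ 2 u x) (hu0 : ∀ x ∈ frontier Ω, u x = 0) {μ A : ℝ} (hμ : 0 ≤ μ)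
    (hA : 0 ≤ A) (hQ : 0 < Q) (hf : ∀ x ∈ Ω, μ * u x - Lop a b c u x ≤ A * q x) :
    ∀ x ∈ closure Ω, u x ≤ A / (μ + 1 / Q) * q x := by
  have hd : 0 < μ + 1 / Q := by positivity
  have key : ∀ t, A / (μ + 1 / Q) < t → ∀ x ∈ closure Ω, u x ≤ t * q x := fun t ht x hx => by
    have ht0 : 0 < t := (div_nonneg hA hd.le).trans_lt ht
    have := max_principle (a := a) (b := b) (c := fun x => c x - μ) hΩ hb
      (w := fun x => u x + (-t) * q x)
      (huc.add (continuousOn_const.mul hq.continuous.continuousOn))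
      (fun x hx => (hu x hx).add (contDiffAt_const.mul hq.contDiffAt)) hs ha
      (fun x hx => by linarith [hc x hx]) (fun x hx => ?_) (fun x hx => ?_) x hx
    · linarith
    · rw [Lop_add (hu x hx) (contDiffAt_const.mul hq.contDiffAt), Lop_smul hq.contDiffAt]
      have e : ∀ v : 𝔼 → ℝ, Lop a b (fun x => c x - μ) v x = Lop a b c v x - μ * v x :=
        fun v => by simp only [Lop]; ring
      rw [e, e]
      have h1 := hq1 x (subset_closure hx)
      have h2 := hqQ x (subset_closure hx)
      have h3 : q x * (1 / Q) ≤ 1 := by rw [mul_one_div, div_le_one hQ]; exact h2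
      have h4 : A < t * (μ + 1 / Q) := (div_lt_iff₀ hd).1 ht
      have h5 := mul_lt_mul_of_pos_right h4 (zero_lt_one.trans_le h1)
      have h6 := mul_le_mul_of_nonneg_left h3 ht0.le
      have h7 := mul_le_mul_of_nonneg_left (hLq x hx) ht0.le
      have h8 := hf x hx
      nlinarith
    · have h1 := hq1 x (frontier_subset_closure hx)
      simp only [hu0 x hx]
      nlinarith
  intro x hx
  refine le_of_forall_pos_le_add fun ε hε => ?_
  have h1 := zero_lt_one.trans_le (hq1 x hx)
  have := key (A / (μ + 1 / Q) + ε / q x) (by linarith [div_pos hε h1]) x hx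
  rwa [add_mul, div_mul_cancel₀ _ h1.ne'] at this

end MaxPrinciple

section Charts

set_option linter.unusedSectionVars false

theorem norm_fderiv_fderiv_sub_le {X Y : Type} [NormedAddCommGroup X] [NormedSpace ℝ X]
    [NormedAddCommGroup Y] [NormedSpace ℝ Y] (f : X → Y) (x y : X) :
    ‖fderiv ℝ (fderiv ℝ f) x - fderiv ℝ (fderiv ℝ f) y‖ ≤
      ‖iteratedFDeriv ℝ 2 f x - iteratedFDeriv ℝ 2 f y‖ := by
  refine ContinuousLinearMap.opNorm_le_bound₂ _ (norm_nonneg _) fun h k => ?_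
  have h1 := (iteratedFDeriv ℝ 2 f x - iteratedFDeriv ℝ 2 f y).le_opNorm ![h, k]
  rw [Fin.prod_univ_two, _root_.sub_apply, iteratedFDeriv_two_apply,
    iteratedFDeriv_two_apply] at h1
  simpa [mul_assoc] using h1

variable {n : ℕ} [NeZero n] {α : ℝ}

local notation "𝔼" => EuclideanSpace ℝ (Fin n)

/-- A map that flattens the boundary of `Ω` in a ball, with quantitative bounds. -/
structure Chart (α : ℝ) (Ω : Set (EuclideanSpace ℝ (Fin n))) (x : EuclideanSpace ℝ (Fin n))
    (r C : ℝ) (ψ : EuclideanSpace ℝ (Fin n) → EuclideanSpace ℝ (Fin n)) : Prop where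
  contDiffOn : ContDiffOn ℝ 2 ψ (Metric.ball x r)
  b1 : ∀ y ∈ Metric.ball x r, ‖fderiv ℝ ψ y‖ ≤ C
  b2 : ∀ y ∈ Metric.ball x r, ‖fderiv ℝ (fderiv ℝ ψ) y‖ ≤ C
  b3 : ∀ y ∈ Metric.ball x r, ∀ z ∈ Metric.ball x r,
    ‖fderiv ℝ (fderiv ℝ ψ) y - fderiv ℝ (fderiv ℝ ψ) z‖ ≤ C * ‖y - z‖ ^ α
  anti : ∀ y ∈ Metric.ball x r, ∀ z ∈ Metric.ball x r, ‖y - z‖ ≤ C * ‖ψ y - ψ z‖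
  nonneg : ∀ y ∈ Metric.ball x r, y ∈ closure Ω → 0 ≤ ψ y 0
  zero : ∀ y ∈ Metric.ball x r, y ∈ frontier Ω → ψ y 0 = 0

theorem Chart.mono {Ω : Set 𝔼} {x x' : 𝔼} {r r' C C' : ℝ} {ψ : 𝔼 → 𝔼} (h : Chart α Ω x r C ψ)
    (hb : Metric.ball x' r' ⊆ Metric.ball x r) (hC : C ≤ C') : Chart α Ω x' r' C' ψ where
  contDiffOn := h.contDiffOn.mono hb
  b1 y hy := (h.b1 y (hb hy)).trans hC
  b2 y hy := (h.b2 y (hb hy)).trans hC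
  b3 y hy z hz := (h.b3 y (hb hy) z (hb hz)).trans (by gcongr)
  anti y hy z hz := (h.anti y (hb hy) z (hb hz)).trans (by gcongr)
  nonneg y hy := h.nonneg y (hb hy)
  zero y hy := h.zero y (hb hy)

theorem exists_chart_interior {Ω : Set 𝔼} (hΩ : IsOpen Ω) {x : 𝔼} (hx : x ∈ Ω) :
    ∃ r C ψ, 0 < r ∧ Chart α Ω x r C ψ := by
  obtain ⟨r, hr, hb⟩ := Metric.isOpen_iff.1 hΩ x hx
  have e1 : fderiv ℝ (fun y : 𝔼 => y + (‖x‖ + r) • stdE 0) = fun _ => ContinuousLinearMap.id ℝ 𝔼 :=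
    funext fun y => ((hasFDerivAt_id y).add_const _).fderiv
  refine ⟨r, 1, fun y => y + (‖x‖ + r) • stdE 0, hr, ⟨?_, fun y _ => ?_, fun y _ => ?_,
    fun y _ z _ => ?_, fun y _ z _ => ?_, fun y hy _ => ?_, fun y hy hy' => ?_⟩⟩
  · exact (contDiff_id.add contDiff_const).contDiffOn
  · rw [e1]; exact ContinuousLinearMap.norm_id_le
  · rw [e1, fderiv_fun_const]; simp
  · rw [e1, fderiv_fun_const]; simp [Real.rpow_nonneg]
  · simp
  · have h1 := (abs_le.1 (PiLp.norm_apply_le y 0)).1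
    have h2 : ‖y‖ ≤ ‖x‖ + r := by
      have := norm_le_norm_add_norm_sub' y x
      rw [mem_ball_iff_norm] at hy
      linarith
    simp
    linarith
  · rw [hΩ.frontier_eq] at hy'
    exact absurd (hb hy) hy'.2

theorem exists_strict_left_inverse {x : 𝔼} {B D : Set 𝔼} {ψ ψinv : 𝔼 → 𝔼}
    (hB : IsOpen B) (hx : x ∈ B) (hbij : BijOn ψ B D) (hinv : InvOn ψinv ψ B D)
    (hψ : ContDiffOn ℝ 2 ψ B) (hψinv : ContDiffOn ℝ 2 ψinv D) :
    ∃ L G : 𝔼 →L[ℝ] 𝔼, HasStrictFDerivAt ψ L x ∧ ∀ v, G (L v) = v := by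
  have hBx := hB.mem_nhds hx
  have hstrict := (hψ.contDiffAt hBx).hasStrictFDerivAt two_ne_zero
  have hG := ((hψinv.differentiableOn two_ne_zero) (ψ x) (hbij.mapsTo hx)).hasFDerivWithinAt
  refine ⟨fderiv ℝ ψ x, fderivWithin ℝ ψinv D (ψ x), hstrict, fun v => ?_⟩
  have h1 : HasFDerivWithinAt (ψinv ∘ ψ) _ B x :=
    hG.comp x hstrict.hasFDerivAt.hasFDerivWithinAt hbij.mapsTo
  have h2 := h1.hasFDerivAt hBx
  have h3 : ψinv ∘ ψ =ᶠ[𝓝 x] id := by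
    filter_upwards [hBx] with y hy using hinv.1 hy
  exact congrArg (fun T : 𝔼 →L[ℝ] 𝔼 => T v)
    ((h2.congr_of_eventuallyEq h3.symm).unique (hasFDerivAt_id x))

theorem exists_chart_boundary {Ω : Set 𝔼} {x : 𝔼} {B D : Set 𝔼} {ψ ψinv : 𝔼 → 𝔼}
    (hB : IsOpen B) (hx : x ∈ B) (hbij : BijOn ψ B D) (hinv : InvOn ψinv ψ B D)
    (hpos : ψ '' (B ∩ Ω) ⊆ {x | 0 < x 0}) (hzero : ψ '' (B ∩ frontier Ω) ⊆ {x | x 0 = 0})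
    (hψ : ContDiffOn ℝ 2 ψ B) {M : ℝ}
    (hM : ∀ y ∈ B, ∀ z ∈ B, ‖iteratedFDerivWithin ℝ 2 ψ B y - iteratedFDerivWithin ℝ 2 ψ B z‖ ≤
      M * dist y z ^ α) (hψinv : ContDiffOn ℝ 2 ψinv D) :
    ∃ r C, 0 < r ∧ Chart α Ω x r C ψ := by
  have hBx := hB.mem_nhds hx
  have hcx : ContDiffAt ℝ 2 ψ x := hψ.contDiffAt hBx
  obtain ⟨L, G, hL, hGL⟩ := exists_strict_left_inverse hB hx hbij hinv hψ hψinv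
  set ε : ℝ := 1 / (2 * (‖G‖ + 1)) with hε
  have hε0 : 0 < ε := by positivity
  have hst : ∀ᶠ p : 𝔼 × 𝔼 in 𝓝 x ×ˢ 𝓝 x,
      ‖ψ p.1 - ψ p.2 - L (p.1 - p.2)‖ ≤ ε * ‖p.1 - p.2‖ := by
    rw [← nhds_prod_eq]
    exact hL.isLittleO.bound hε0
  obtain ⟨t, ht, hst⟩ := (eventually_prod_self_iff
    (r := fun y z => ‖ψ y - ψ z - L (y - z)‖ ≤ ε * ‖y - z‖)).1 hst
  have hc1 : ContinuousAt (fun y => ‖fderiv ℝ ψ y‖) x := (differentiableAt_fderiv hcx).continuousAt.norm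
  have hc2 : ContinuousAt (fun y => ‖fderiv ℝ (fderiv ℝ ψ) y‖) x := by
    have h1 : ContDiffAt ℝ 1 (fderiv ℝ ψ) x := hcx.fderiv_right (m := 1) (by norm_num)
    exact (h1.fderiv_right (m := 0) (by norm_num)).continuousAt.norm
  have e1 := hc1.eventually_lt_const (lt_add_one _)
  have e2 := hc2.eventually_lt_const (lt_add_one _)
  obtain ⟨r, hr, hball⟩ := Metric.mem_nhds_iff.1
    (inter_mem (inter_mem hBx ht) (inter_mem e1 e2))
  set C₁ := ‖fderiv ℝ ψ x‖ + 1
  set C₂ := ‖fderiv ℝ (fderiv ℝ ψ) x‖ + 1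
  refine ⟨r, max (max C₁ C₂) (max M (2 * ‖G‖)), hr, hψ.mono fun y hy => (hball hy).1.1,
    fun y hy => ?_, fun y hy => ?_, fun y hy z hz => ?_, fun y hy z hz => ?_, fun y hy hy' => ?_,
    fun y hy hy' => hzero ⟨y, ⟨(hball hy).1.1, hy'⟩, rfl⟩⟩
  · exact (hball hy).2.1.le.trans ((le_max_left _ _).trans (le_max_left _ _))
  · exact (hball hy).2.2.le.trans ((le_max_right _ _).trans (le_max_left _ _))
  · have h1 := hM y (hball hy).1.1 z (hball hz).1.1
    rw [iteratedFDerivWithin_of_isOpen 2 hB (hball hy).1.1,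
      iteratedFDerivWithin_of_isOpen 2 hB (hball hz).1.1, dist_eq_norm] at h1
    refine (norm_fderiv_fderiv_sub_le ψ y z).trans (h1.trans ?_)
    gcongr
    exact (le_max_left _ _).trans (le_max_right _ _)
  · have h1 : ‖ψ y - ψ z - L (y - z)‖ ≤ ε * ‖y - z‖ := hst y (hball hy).1.2 z (hball hz).1.2
    have h2 : ‖y - z‖ ≤ ‖G‖ * (‖ψ y - ψ z‖ + ε * ‖y - z‖) := by
      calc ‖y - z‖ = ‖G (L (y - z))‖ := by rw [hGL]
        _ ≤ ‖G‖ * ‖L (y - z)‖ := G.le_opNorm _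
        _ ≤ _ := by
          gcongr
          have := norm_sub_norm_le (L (y - z)) (ψ y - ψ z)
          rw [norm_sub_rev (L (y - z))] at this
          linarith
    have h3 : ‖G‖ * ε ≤ 1 / 2 := by
      rw [hε, mul_one_div, div_le_div_iff₀ (by positivity) two_pos]
      linarith
    have h4 : ‖y - z‖ ≤ 2 * ‖G‖ * ‖ψ y - ψ z‖ := by
      nlinarith [mul_le_mul_of_nonneg_right h3 (norm_nonneg (y - z))]
    refine h4.trans ?_
    gcongr
    exact (le_max_right _ _).trans (le_max_right _ _)
  · have h1 := (hball hy).1.1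
    rw [closure_eq_self_union_frontier] at hy'
    rcases hy' with h | h
    · exact (show 0 < ψ y 0 from hpos ⟨y, ⟨h1, h⟩, rfl⟩).le
    · exact (show ψ y 0 = 0 from hzero ⟨y, ⟨h1, h⟩, rfl⟩).ge

/-- Charts with uniform constants exist near all points of the closure. -/
theorem exists_uniform_chart {Ω : Set 𝔼} (hb : Bornology.IsBounded Ω)
    (h : ∀ x ∈ closure Ω, ∃ r C ψ, 0 < r ∧ Chart α Ω x r C ψ) :
    ∃ R C, 0 < R ∧ ∀ x ∈ closure Ω, ∀ r ≤ R, ∃ ψ, Chart α Ω x r C ψ := by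
  refine hb.isCompact_closure.induction_on (p := fun s => ∃ R C : ℝ, 0 < R ∧ ∀ x ∈ s, ∀ r ≤ R,
    ∃ ψ, Chart α Ω x r C ψ) ?_ ?_ ?_ ?_
  · exact ⟨1, 0, one_pos, by simp⟩
  · rintro s t hst ⟨R, C, hR, H⟩
    exact ⟨R, C, hR, fun x hx => H x (hst hx)⟩
  · rintro s t ⟨R, C, hR, H⟩ ⟨R', C', hR', H'⟩
    refine ⟨min R R', max C C', lt_min hR hR', ?_⟩
    rintro x (hx | hx) r hr
    · obtain ⟨ψ, hψ⟩ := H x hx r (hr.trans (min_le_left _ _))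
      exact ⟨ψ, hψ.mono subset_rfl (le_max_left _ _)⟩
    · obtain ⟨ψ, hψ⟩ := H' x hx r (hr.trans (min_le_right _ _))
      exact ⟨ψ, hψ.mono subset_rfl (le_max_right _ _)⟩
  · intro x hx
    obtain ⟨r, C, ψ, hr, hψ⟩ := h x hx
    refine ⟨Metric.ball x (r / 2), mem_nhdsWithin_of_mem_nhds (Metric.ball_mem_nhds x (by positivity)),
      r / 2, C, by positivity, fun y hy s hs => ⟨ψ, hψ.mono ?_ le_rfl⟩⟩
    refine Metric.ball_subset_ball' ?_
    rw [Metric.mem_ball] at hy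
    linarith

end Charts

section ChartCalculus

set_option linter.unusedSectionVars false

variable {n : ℕ} [NeZero n] {α : ℝ}

local notation "𝔼" => EuclideanSpace ℝ (Fin n)

theorem eq_sum_smul_stdE (w : 𝔼) : w = ∑ k, w k • stdE k := by
  ext i
  simp [stdE, Finset.sum_apply, Pi.single_apply]

theorem clm_apply_eq_sum {Y : Type} [NormedAddCommGroup Y] [NormedSpace ℝ Y] (T : 𝔼 →L[ℝ] Y)
    (w : 𝔼) : T w = ∑ k, w k • T (stdE k) := by
  conv_lhs => rw [eq_sum_smul_stdE w, map_sum]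
  simp only [map_smul]

theorem clm_apply_apply_eq_sum (T : 𝔼 →L[ℝ] 𝔼 →L[ℝ] ℝ) (w w' : 𝔼) :
    T w w' = ∑ k, ∑ l, w k * w' l * T (stdE k) (stdE l) := by
  rw [clm_apply_eq_sum T w, _root_.sum_apply]
  refine Finset.sum_congr rfl fun k _ => ?_
  rw [_root_.smul_apply, clm_apply_eq_sum, smul_eq_mul, Finset.mul_sum]
  exact Finset.sum_congr rfl fun l _ => by rw [smul_eq_mul]; ring

theorem norm_bilin_le_sum (T : 𝔼 →L[ℝ] 𝔼 →L[ℝ] ℝ) : ‖T‖ ≤ ∑ i, ∑ j, |T (stdE i) (stdE j)| := by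
  refine ContinuousLinearMap.opNorm_le_bound₂ _ (by positivity) fun w w' => ?_
  rw [clm_apply_apply_eq_sum, Finset.sum_mul, Finset.sum_mul]
  refine norm_sum_le_of_le _ fun i _ => ?_
  rw [Finset.sum_mul, Finset.sum_mul]
  refine norm_sum_le_of_le _ fun j _ => ?_
  rw [norm_mul, norm_mul]
  have h1 := PiLp.norm_apply_le w i
  have h2 := PiLp.norm_apply_le w' j
  rw [mul_comm, mul_assoc]
  rw [Real.norm_eq_abs]
  gcongr

theorem HB.of_components {X : Type} [NormedAddCommGroup X] [NormedSpace ℝ X] {S : Set X}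
    {T : X → 𝔼 →L[ℝ] 𝔼 →L[ℝ] ℝ} {A B : ℝ}
    (h : ∀ i j, HB α S (fun x => T x (stdE i) (stdE j)) A B) :
    HB α S T (n ^ 2 * A) (n ^ 2 * B) := by
  refine ⟨fun x hx => ?_, fun x hx y hy => ?_⟩
  · refine (norm_bilin_le_sum _).trans ((Finset.sum_le_sum fun i _ => Finset.sum_le_sum fun j _ =>
      (h i j).bd x hx).trans (le_of_eq ?_))
    simp; ring
  · refine (norm_bilin_le_sum _).trans ((Finset.sum_le_sum fun i _ => Finset.sum_le_sum fun j _ =>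
      (h i j).hd x hx y hy).trans (le_of_eq ?_))
    simp; ring

variable {Ω : Set (EuclideanSpace ℝ (Fin n))} {z : EuclideanSpace ℝ (Fin n)} {r C : ℝ}
  {ψ : EuclideanSpace ℝ (Fin n) → EuclideanSpace ℝ (Fin n)}

theorem Chart.contDiffAt (h : Chart α Ω z r C ψ) {x : 𝔼} (hx : x ∈ Metric.ball z r) :
    ContDiffAt ℝ 2 ψ x := h.contDiffOn.contDiffAt (Metric.isOpen_ball.mem_nhds hx)

theorem Chart.injOn (h : Chart α Ω z r C ψ) : InjOn ψ (Metric.ball z r) := fun x hx y hy hxy => by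
  have := h.anti x hx y hy
  rw [hxy, sub_self, norm_zero, mul_zero] at this
  exact sub_eq_zero.1 (norm_le_zero_iff.1 this)

theorem Chart.lipschitz (h : Chart α Ω z r C ψ) {x y : 𝔼} (hx : x ∈ Metric.ball z r)
    (hy : y ∈ Metric.ball z r) : ‖ψ x - ψ y‖ ≤ C * ‖x - y‖ :=
  (convex_ball z r).norm_image_sub_le_of_norm_fderiv_le
    (fun _ hw => differentiableAt_of_contDiffAt_two (h.contDiffAt hw)) h.b1 hy hx

theorem Chart.le_fderiv (h : Chart α Ω z r C ψ) (hr : 0 < r) (v : 𝔼) :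
    ‖v‖ ≤ C * ‖fderiv ℝ ψ z v‖ := by
  have hz := Metric.mem_ball_self (x := z) hr
  have h1 := (differentiableAt_of_contDiffAt_two (h.contDiffAt hz)).hasFDerivAt
  have hl : HasDerivAt (fun t : ℝ => z + t • v) v 0 := by
    simpa using ((hasDerivAt_id (0 : ℝ)).smul_const v).const_add z
  have h2 : HasDerivAt (fun t : ℝ => ψ (z + t • v)) (fderiv ℝ ψ z v) 0 := by
    have h1' : HasFDerivAt ψ (fderiv ℝ ψ z) (z + (0 : ℝ) • v) := by simpa using h1
    exact HasFDerivAt.comp_hasDerivAt (f := fun t : ℝ => z + t • v) 0 h1' hl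
  have h3 := (h2.tendsto_slope_zero.norm).const_mul C
  refine ge_of_tendsto h3 ?_
  have h4 : ∀ᶠ t : ℝ in 𝓝[≠] 0, z + t • v ∈ Metric.ball z r := by
    refine nhdsWithin_le_nhds (hl.continuousAt.eventually_mem (Metric.isOpen_ball.mem_nhds ?_))
    simpa using hr
  filter_upwards [h4, self_mem_nhdsWithin] with t ht ht0
  have h5 := h.anti _ ht _ hz
  simp only [zero_add, zero_smul, add_zero]
  rw [add_sub_cancel_left, norm_smul] at h5
  rw [norm_smul, norm_inv, mul_left_comm, inv_mul_eq_div, le_div_iff₀ (norm_pos_iff.2 ht0), mul_comm]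
  exact h5

/-- Ellipticity is preserved by changes of variables. -/
theorem elliptic_transform {a : Fin n → Fin n → ℝ} {lam : ℝ} (hlam : 0 < lam)
    (ha : ∀ ξ : Fin n → ℝ, lam * ∑ i, ξ i ^ 2 ≤ ∑ i, ∑ j, a i j * ξ i * ξ j) {L : 𝔼 →L[ℝ] 𝔼}
    (hC : 0 < C) (hL : ∀ v, ‖v‖ ≤ C * ‖L v‖) (ξ : Fin n → ℝ) :
    lam / C ^ 2 * ∑ i, ξ i ^ 2 ≤
      ∑ k, ∑ l, (∑ i, ∑ j, a i j * (L (stdE i) k * L (stdE j) l)) * ξ k * ξ l := by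
  set η : Fin n → ℝ := fun i => ∑ k, L (stdE i) k * ξ k with hη
  have e1 : ∑ k, ∑ l, (∑ i, ∑ j, a i j * (L (stdE i) k * L (stdE j) l)) * ξ k * ξ l =
      ∑ i, ∑ j, a i j * η i * η j := by
    simp only [hη, Finset.sum_mul, Finset.mul_sum]
    rw [show (∑ k, ∑ l, ∑ i, ∑ j, a i j * (L (stdE i) k * L (stdE j) l) * ξ k * ξ l) =
      ∑ k, ∑ i, ∑ l, ∑ j, a i j * (L (stdE i) k * L (stdE j) l) * ξ k * ξ l from
        Finset.sum_congr rfl fun k _ => Finset.sum_comm, Finset.sum_comm]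
    refine Finset.sum_congr rfl fun i _ => ?_
    rw [show (∑ k, ∑ l, ∑ j, a i j * (L (stdE i) k * L (stdE j) l) * ξ k * ξ l) =
      ∑ k, ∑ j, ∑ l, a i j * (L (stdE i) k * L (stdE j) l) * ξ k * ξ l from
        Finset.sum_congr rfl fun k _ => Finset.sum_comm, Finset.sum_comm]
    refine Finset.sum_congr rfl fun j _ => ?_
    rw [Finset.sum_comm]
    refine Finset.sum_congr rfl fun l _ => Finset.sum_congr rfl fun k _ => ?_
    ring
  rw [e1]
  refine le_trans ?_ (ha η)
  rw [div_mul_eq_mul_div, mul_div_assoc]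
  refine mul_le_mul_of_nonneg_left ?_ hlam.le
  rw [div_le_iff₀ (by positivity)]
  have hinj : Function.Injective (L : 𝔼 →ₗ[ℝ] 𝔼) := by
    rw [← LinearMap.ker_eq_bot, LinearMap.ker_eq_bot']
    intro v hv
    have := hL v
    rw [show L v = 0 from hv, norm_zero, mul_zero] at this
    exact norm_le_zero_iff.1 this
  obtain ⟨v, hv⟩ := (LinearMap.injective_iff_surjective.1 hinj) (WithLp.toLp 2 ξ)
  have hv' : L v = WithLp.toLp 2 ξ := hv
  have hLk : ∀ k, L v k = ξ k := fun k => by rw [hv']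
  have e2 : ∑ k, ξ k ^ 2 = ∑ i, v i * η i := by
    have : ∀ k, ξ k = ∑ i, v i * L (stdE i) k := fun k => by
      rw [← hLk k, clm_apply_eq_sum L v]
      simp [Finset.sum_apply]
    simp only [hη, Finset.mul_sum]
    rw [Finset.sum_comm]
    refine Finset.sum_congr rfl fun k _ => ?_
    rw [pow_two]
    nth_rewrite 1 [this k]
    rw [Finset.sum_mul]
    exact Finset.sum_congr rfl fun i _ => by ring
  have e3 : (∑ i, v i * η i) ^ 2 ≤ (∑ i, v i ^ 2) * ∑ i, η i ^ 2 :=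
    Finset.sum_mul_sq_le_sq_mul_sq _ _ _
  have e4 : ∑ i, v i ^ 2 ≤ C ^ 2 * ∑ k, ξ k ^ 2 := by
    have h1 := hL v
    have h2 := mul_self_le_mul_self (norm_nonneg _) h1
    have h3 := EuclideanSpace.real_norm_sq_eq v
    have h4 := EuclideanSpace.real_norm_sq_eq (L v)
    simp only [hLk] at h4
    rw [← h3, ← h4]
    nlinarith
  rw [← e2] at e3
  rcases (Finset.sum_nonneg fun k _ => sq_nonneg (ξ k) : 0 ≤ ∑ k, ξ k ^ 2).eq_or_lt with h | h
  · rw [← h]; positivity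
  · have h5 : 0 ≤ ∑ i, η i ^ 2 := by positivity
    have h6 := mul_le_mul_of_nonneg_right e4 h5
    nlinarith

theorem HB.apply_stdE {X : Type} [NormedAddCommGroup X] [NormedSpace ℝ X] {S : Set X} {Y : Type}
    [NormedAddCommGroup Y] [NormedSpace ℝ Y] {T : X → 𝔼 →L[ℝ] Y} {A B : ℝ} (h : HB α S T A B)
    (i : Fin n) : HB α S (fun x => T x (stdE i)) A B := by
  have key : ∀ T : 𝔼 →L[ℝ] Y, ‖T (stdE i)‖ ≤ ‖T‖ := fun T => by
    simpa using T.le_opNorm (stdE i)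
  exact ⟨fun x hx => (key _).trans (h.bd x hx), fun x hx y hy => (key (T x - T y)).trans
    (h.hd x hx y hy)⟩

theorem HB.coord {X : Type} [NormedAddCommGroup X] [NormedSpace ℝ X] {S : Set X} {f : X → 𝔼}
    {A B : ℝ} (h : HB α S f A B) (k : Fin n) : HB α S (fun x => f x k) A B :=
  ⟨fun x hx => (PiLp.norm_apply_le _ _).trans (h.bd x hx),
    fun x hx y hy => (PiLp.norm_apply_le (f x - f y) k).trans (h.hd x hx y hy)⟩

theorem Chart.HB_fderiv (h : Chart α Ω z r C ψ) (h0 : 0 < α) (h1 : α < 1) (hC : 0 ≤ C) (i k : Fin n) :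
    HB α (Metric.ball z r) (fun x => fderiv ℝ ψ x (stdE i) k) C (3 * C) := by
  refine ((HB.of_fderiv h0 h1 Metric.isOpen_ball (convex_ball z r) hC ?_ h.b1 h.b2).mono le_rfl
    (by linarith)).apply_stdE i |>.coord k
  exact fun x hx => (differentiableAt_fderiv (h.contDiffAt hx)).differentiableWithinAt

theorem Chart.HB_fderiv_fderiv (h : Chart α Ω z r C ψ) (i j k : Fin n) :
    HB α (Metric.ball z r) (fun x => fderiv ℝ (fderiv ℝ ψ) x (stdE i) (stdE j) k) C C :=
  ((HB.mk h.b2 h.b3).apply_stdE i).apply_stdE j |>.coord k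

theorem Chart.HB_comp (h : Chart α Ω z r C ψ) (h0 : 0 < α) (h1 : α < 1) (hC : 1 ≤ C) {Y : Type}
    [NormedAddCommGroup Y] [NormedSpace ℝ Y] {f : 𝔼 → Y} {A B : ℝ} (hB : 0 ≤ B)
    (hf : HB α univ f A B) : HB α (Metric.ball z r) (fun x => f (ψ x)) A (B * C) := by
  refine (HB.comp h0.le hB (zero_le_one.trans hC) hf (mapsTo_univ _ _)
    fun x hx y hy => h.lipschitz hx hy).mono le_rfl ?_
  gcongr
  simpa using Real.rpow_le_rpow_of_exponent_le hC h1.le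

theorem Chart.fderiv_comp (h : Chart α Ω z r C ψ) {v : 𝔼 → ℝ} (hv : ContDiff ℝ 2 v) {x : 𝔼}
    (hx : x ∈ Metric.ball z r) (i : Fin n) :
    fderiv ℝ (fun y => v (ψ y)) x (stdE i) =
      ∑ k, fderiv ℝ ψ x (stdE i) k * fderiv ℝ v (ψ x) (stdE k) := by
  have h1 : fderiv ℝ (fun y => v (ψ y)) x = (fderiv ℝ v (ψ x)).comp (fderiv ℝ ψ x) :=
    _root_.fderiv_comp x (hv.differentiable (by norm_num) _)
      (differentiableAt_of_contDiffAt_two (h.contDiffAt hx))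
  rw [h1, ContinuousLinearMap.comp_apply, clm_apply_eq_sum]
  rfl

theorem Chart.fderiv_fderiv_comp (h : Chart α Ω z r C ψ) {v : 𝔼 → ℝ} (hv : ContDiff ℝ 2 v) {x : 𝔼}
    (hx : x ∈ Metric.ball z r) (i j : Fin n) :
    fderiv ℝ (fderiv ℝ fun y => v (ψ y)) x (stdE i) (stdE j) =
      ∑ k, ∑ l, fderiv ℝ ψ x (stdE i) k * fderiv ℝ ψ x (stdE j) l *
          fderiv ℝ (fderiv ℝ v) (ψ x) (stdE k) (stdE l) +
        ∑ k, fderiv ℝ (fderiv ℝ ψ) x (stdE i) (stdE j) k * fderiv ℝ v (ψ x) (stdE k) := by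
  rw [Schauder.fderiv_fderiv_comp hv.contDiffAt (h.contDiffAt hx), clm_apply_apply_eq_sum,
    clm_apply_eq_sum (fderiv ℝ v (ψ x))]
  rfl

/-- Transplanting by a chart and cutting off is bounded on `C^{2,α}`. -/
theorem Chart.C2B_cutoff (h : Chart α Ω z r C ψ) (h0 : 0 < α) (h1 : α < 1) (hC : 1 ≤ C) {χ : 𝔼 → ℝ}
    {d : ℝ} (hd : 0 ≤ d) (hχ : C2B α χ d d d d) (hs : tsupport χ ⊆ Metric.ball z r) :
    ∃ M, 0 ≤ M ∧ ∀ v B, 0 ≤ B → C2B α v B B B B →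
      C2B α (fun x => χ x * v (ψ x)) (M * B) (M * B) (M * B) (M * B) := by
  have hC0 : 0 ≤ C := zero_le_one.trans hC
  set m : ℝ := n ^ 2 * (n ^ 2 * (7 * C ^ 3) + n * (4 * C ^ 2)) with hm
  have hm0 : 0 ≤ m := by positivity
  refine ⟨24 * d * max C m, by positivity, fun v B hB hv => ?_⟩
  rw [mul_assoc]
  have hmB : 0 ≤ max C m * B := by positivity
  have hCB : C * B ≤ max C m * B := by gcongr; exact le_max_left _ _
  have hd1 : HB α univ (fderiv ℝ v) B (3 * B) := (hv.HB_fderiv h0 h1).mono le_rfl (by linarith)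
  refine C2B.cutoff h0 h1 Metric.isOpen_ball (convex_ball z r) hd hmB hχ hs
    (hv.contDiff.comp_contDiffOn h.contDiffOn) (fun x hx => (hv.b0 _).trans ?_)
    (fun x hx => ?_) ((HB.of_components (A := (n ^ 2 * (7 * C ^ 3) + n * (4 * C ^ 2)) * B)
      (B := (n ^ 2 * (7 * C ^ 3) + n * (4 * C ^ 2)) * B) fun i j => ?_).mono ?_ ?_)
  · nlinarith
  · have h2 : fderiv ℝ (fun y => v (ψ y)) x = (fderiv ℝ v (ψ x)).comp (fderiv ℝ ψ x) :=
      _root_.fderiv_comp x (hv.differentiable _)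
        (differentiableAt_of_contDiffAt_two (h.contDiffAt hx))
    rw [h2]
    refine (ContinuousLinearMap.opNorm_comp_le _ _).trans (le_trans ?_ hCB)
    rw [mul_comm]
    exact mul_le_mul (h.b1 x hx) (hv.b1 _) (norm_nonneg _) hC0
  · refine HB.congr ?_ fun x hx => h.fderiv_fderiv_comp hv.contDiff hx i j
    have t1 : ∀ k l, HB α (Metric.ball z r) (fun x => fderiv ℝ ψ x (stdE i) k *
        fderiv ℝ ψ x (stdE j) l * fderiv ℝ (fderiv ℝ v) (ψ x) (stdE k) (stdE l))
        (7 * C ^ 3 * B) (7 * C ^ 3 * B) := fun k l => by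
      refine (HB.mul (by positivity) (by positivity) hB (HB.mul (by positivity) (by positivity) hC0
        (h.HB_fderiv h0 h1 hC0 i k) (h.HB_fderiv h0 h1 hC0 j l)) (((h.HB_comp h0 h1 hC hB
          hv.HB_fderiv_fderiv).apply_stdE k).apply_stdE l)).mono ?_ ?_
      · nlinarith [mul_nonneg (pow_nonneg hC0 2) hB, mul_nonneg (pow_nonneg hC0 3) hB,
          mul_nonneg (mul_nonneg (pow_nonneg hC0 2) hB) (sub_nonneg.2 hC)]
      · nlinarith [mul_nonneg (pow_nonneg hC0 2) hB, mul_nonneg (pow_nonneg hC0 3) hB,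
          mul_nonneg (mul_nonneg (pow_nonneg hC0 2) hB) (sub_nonneg.2 hC)]
    have t2 : ∀ k, HB α (Metric.ball z r) (fun x => fderiv ℝ (fderiv ℝ ψ) x (stdE i) (stdE j) k *
        fderiv ℝ v (ψ x) (stdE k)) (4 * C ^ 2 * B) (4 * C ^ 2 * B) := fun k => by
      refine (HB.mul hC0 (by positivity) hB (h.HB_fderiv_fderiv i j k) ((h.HB_comp h0 h1 hC
        (by positivity) hd1).apply_stdE k)).mono ?_ ?_
      · nlinarith [mul_nonneg hC0 hB, mul_nonneg (mul_nonneg hC0 hB) (sub_nonneg.2 hC)]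
      · nlinarith [mul_nonneg hC0 hB, mul_nonneg (mul_nonneg hC0 hB) (sub_nonneg.2 hC)]
    refine ((HB.sum _ fun k _ => HB.sum _ fun l _ => t1 k l).add (HB.sum _ fun k _ => t2 k)).mono
      (le_of_eq ?_) (le_of_eq ?_) <;> · simp; ring
  · rw [← mul_assoc]; gcongr; exact le_max_right _ _
  · rw [← mul_assoc]; gcongr; exact le_max_right _ _

end ChartCalculus

section LocalSolver

set_option linter.unusedSectionVars false

variable {n : ℕ} [NeZero n] {α : ℝ}

local notation "𝔼" => EuclideanSpace ℝ (Fin n)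

theorem IsHB.exists_common {X ι : Type} [NormedAddCommGroup X] [NormedSpace ℝ X] [Fintype ι]
    {S : Set X} {f : ι → X → ℝ} (hf : ∀ i, IsHB α S (f i)) :
    ∃ h, 0 ≤ h ∧ ∀ i, HB α S (f i) h h := by
  choose h h0 hh using hf
  have h1 : ∀ i, h i ≤ ∑ i, h i := fun i =>
    Finset.single_le_sum (fun i _ => h0 i) (Finset.mem_univ i)
  exact ⟨∑ i, h i, Finset.sum_nonneg fun i _ => h0 i, fun i => (hh i).mono (h1 i) (h1 i)⟩

/-- The leading coefficients after a change of variables with differential `L`. -/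
noncomputable def pushCoeff (a : Fin n → Fin n → ℝ)
    (L : EuclideanSpace ℝ (Fin n) →L[ℝ] EuclideanSpace ℝ (Fin n)) (k l : Fin n) : ℝ :=
  ∑ i, ∑ j, a i j * (L (stdE i) k * L (stdE j) l)

/-- The first order coefficients after a change of variables and multiplication by a cutoff. -/
noncomputable def pushDrift (a : EuclideanSpace ℝ (Fin n) → Fin n → Fin n → ℝ)
    (b : EuclideanSpace ℝ (Fin n) → Fin n → ℝ) (χ : EuclideanSpace ℝ (Fin n) → ℝ)
    (ψ : EuclideanSpace ℝ (Fin n) → EuclideanSpace ℝ (Fin n)) (k : Fin n)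
    (x : EuclideanSpace ℝ (Fin n)) : ℝ :=
  ∑ i, ∑ j, a x i j * (χ x * fderiv ℝ (fderiv ℝ ψ) x (stdE i) (stdE j) k +
      fderiv ℝ χ x (stdE i) * fderiv ℝ ψ x (stdE j) k +
      fderiv ℝ χ x (stdE j) * fderiv ℝ ψ x (stdE i) k) +
    ∑ i, b x i * (χ x * fderiv ℝ ψ x (stdE i) k)

variable {Ω : Set (EuclideanSpace ℝ (Fin n))} {z : EuclideanSpace ℝ (Fin n)} {r C : ℝ}
  {ψ : EuclideanSpace ℝ (Fin n) → EuclideanSpace ℝ (Fin n)}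
  {a : EuclideanSpace ℝ (Fin n) → Fin n → Fin n → ℝ}
  {b : EuclideanSpace ℝ (Fin n) → Fin n → ℝ} {c : EuclideanSpace ℝ (Fin n) → ℝ}

theorem Chart.Lop_cutoff (h : Chart α Ω z r C ψ) {v χ : 𝔼 → ℝ} (hv : ContDiff ℝ 2 v)
    (hχ : ContDiff ℝ 2 χ) {x : 𝔼} (hx : x ∈ Metric.ball z r) :
    Lop a b c (fun y => χ y * v (ψ y)) x =
      ∑ k, ∑ l, χ x * pushCoeff (a x) (fderiv ℝ ψ x) k l *
          fderiv ℝ (fderiv ℝ v) (ψ x) (stdE k) (stdE l) +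
        ∑ k, pushDrift a b χ ψ k x * fderiv ℝ v (ψ x) (stdE k) + Lop a b c χ x * v (ψ x) := by
  have hg : ContDiffAt ℝ 2 (fun y => v (ψ y)) x := hv.contDiffAt.comp x (h.contDiffAt hx)
  have h1 : fderiv ℝ (fun y => χ y * v (ψ y)) x =
      χ x • fderiv ℝ (fun y => v (ψ y)) x + v (ψ x) • fderiv ℝ χ x :=
    fderiv_fun_mul (hχ.differentiable (by norm_num) x) (differentiableAt_of_contDiffAt_two hg)
  have t2 : ∀ i j, a x i j * fderiv ℝ (fderiv ℝ fun y => χ y * v (ψ y)) x (stdE i) (stdE j) =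
      ∑ k, ∑ l, χ x * (a x i j * (fderiv ℝ ψ x (stdE i) k * fderiv ℝ ψ x (stdE j) l)) *
        fderiv ℝ (fderiv ℝ v) (ψ x) (stdE k) (stdE l) +
      ∑ k, a x i j * (χ x * fderiv ℝ (fderiv ℝ ψ) x (stdE i) (stdE j) k +
        fderiv ℝ χ x (stdE i) * fderiv ℝ ψ x (stdE j) k +
        fderiv ℝ χ x (stdE j) * fderiv ℝ ψ x (stdE i) k) * fderiv ℝ v (ψ x) (stdE k) +
      a x i j * fderiv ℝ (fderiv ℝ χ) x (stdE i) (stdE j) * v (ψ x) := fun i j => by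
    rw [fderiv_fderiv_mul hχ.contDiffAt hg]
    simp only [_root_.add_apply, _root_.smul_apply, ContinuousLinearMap.smulRight_apply,
      smul_eq_mul, h.fderiv_comp hv hx, h.fderiv_fderiv_comp hv hx]
    simp only [mul_add, add_mul, Finset.mul_sum, Finset.sum_mul, Finset.sum_add_distrib]
    simp only [mul_assoc, mul_comm, mul_left_comm]
    ring
  have t1 : ∀ i, b x i * fderiv ℝ (fun y => χ y * v (ψ y)) x (stdE i) =
      ∑ k, b x i * (χ x * fderiv ℝ ψ x (stdE i) k) * fderiv ℝ v (ψ x) (stdE k) +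
        b x i * fderiv ℝ χ x (stdE i) * v (ψ x) := fun i => by
    rw [h1]
    simp only [_root_.add_apply, _root_.smul_apply, smul_eq_mul, h.fderiv_comp hv hx, mul_add,
      Finset.mul_sum]
    congr 1
    · exact Finset.sum_congr rfl fun k _ => by ring
    · ring
  simp only [Lop, t2, t1, pushCoeff, pushDrift, Finset.sum_add_distrib, add_mul (b := c x * χ x),
    add_mul _ _ (v (ψ x)), add_mul _ _ (fderiv ℝ v (ψ x) (stdE _)), Finset.sum_mul, Finset.mul_sum]
  have s1 : ∀ f : Fin n → Fin n → Fin n → Fin n → ℝ,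
      ∑ i, ∑ j, ∑ k, ∑ l, f i j k l = ∑ k, ∑ l, ∑ i, ∑ j, f i j k l := fun f => by
    rw [show (∑ i, ∑ j, ∑ k, ∑ l, f i j k l) = ∑ i, ∑ k, ∑ j, ∑ l, f i j k l from
      Finset.sum_congr rfl fun i _ => Finset.sum_comm, Finset.sum_comm]
    refine Finset.sum_congr rfl fun k _ => ?_
    rw [show (∑ i, ∑ j, ∑ l, f i j k l) = ∑ i, ∑ l, ∑ j, f i j k l from
      Finset.sum_congr rfl fun i _ => Finset.sum_comm, Finset.sum_comm]
  have s2 : ∀ f : Fin n → Fin n → Fin n → ℝ,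
      ∑ i, ∑ j, ∑ k, f i j k = ∑ k, ∑ i, ∑ j, f i j k := fun f => by
    rw [show (∑ i, ∑ j, ∑ k, f i j k) = ∑ i, ∑ k, ∑ j, f i j k from
      Finset.sum_congr rfl fun i _ => Finset.sum_comm, Finset.sum_comm]
  rw [s1 fun i j k l => χ x * (a x i j * (fderiv ℝ ψ x (stdE i) k * fderiv ℝ ψ x (stdE j) l)) *
      fderiv ℝ (fderiv ℝ v) (ψ x) (stdE k) (stdE l),
    s2 fun i j k => a x i j * (χ x * fderiv ℝ (fderiv ℝ ψ) x (stdE i) (stdE j) k +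
      fderiv ℝ χ x (stdE i) * fderiv ℝ ψ x (stdE j) k +
      fderiv ℝ χ x (stdE j) * fderiv ℝ ψ x (stdE i) k) * fderiv ℝ v (ψ x) (stdE k),
    Finset.sum_comm (f := fun i k => b x i * (χ x * fderiv ℝ ψ x (stdE i) k) *
      fderiv ℝ v (ψ x) (stdE k))]
  ring

/-- Hölder functions near a point are right-hand sides in a chart. -/
theorem Chart.exists_pullback (h : Chart α Ω z r C ψ) (h0 : 0 < α) (h1 : α < 1) (hC : 1 ≤ C)
    {K : Set 𝔼} {g : 𝔼 → ℝ} {A B : ℝ} (hA : 0 ≤ A) (hB : 0 ≤ B) (hg : HB α K g A B) :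
    ∃ F : 𝔼 → ℝ, BddHolder α F A (B * C) ∧ ∀ x ∈ K ∩ Metric.ball z r, F (ψ x) = g x := by
  set p := Function.invFunOn ψ (K ∩ Metric.ball z r) with hp
  have hinj : InjOn ψ (K ∩ Metric.ball z r) := h.injOn.mono inter_subset_right
  have hpx : ∀ x ∈ K ∩ Metric.ball z r, p (ψ x) = x := fun x hx =>
    hinj.leftInvOn_invFunOn hx
  have hF : HB α (ψ '' (K ∩ Metric.ball z r)) (fun y => g (p y)) A (B * C ^ α) := by
    refine HB.comp h0.le hB (zero_le_one.trans hC) hg ?_ ?_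
    · rintro _ ⟨x, hx, rfl⟩
      rw [hpx x hx]
      exact hx.1
    · rintro _ ⟨x, hx, rfl⟩ _ ⟨y, hy, rfl⟩
      rw [hpx x hx, hpx y hy]
      exact h.anti x hx.2 y hy.2
  have hF' : HB α (ψ '' (K ∩ Metric.ball z r)) (fun y => g (p y)) A (B * C) := by
    refine hF.mono le_rfl ?_
    gcongr
    simpa using Real.rpow_le_rpow_of_exponent_le hC h1.le
  obtain ⟨F, hF1, hF2⟩ := HB.exists_extension h0 h1.le hA
    (mul_nonneg hB (zero_le_one.trans hC)) hF'
  exact ⟨F, hF1, fun x hx => by rw [hF2 _ (mem_image_of_mem ψ hx), hpx x hx]⟩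

theorem pushCoeff_symm {a : Fin n → Fin n → ℝ} (ha : ∀ i j, a i j = a j i) (L : 𝔼 →L[ℝ] 𝔼)
    (k l : Fin n) : pushCoeff a L k l = pushCoeff a L l k := by
  rw [pushCoeff, pushCoeff, Finset.sum_comm]
  refine Finset.sum_congr rfl fun i _ => Finset.sum_congr rfl fun j _ => ?_
  rw [ha, mul_comm (L (stdE j) k)]

theorem Chart.HB_pushCoeff (h : Chart α Ω z r C ψ) (h0 : 0 < α) (h1 : α < 1) (hC : 0 ≤ C)
    {K : Set 𝔼} {Lam : ℝ} (hLam : 0 ≤ Lam) (ha : ∀ i j, HB α K (fun x => a x i j) Lam Lam)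
    (k l : Fin n) : HB α (K ∩ Metric.ball z r) (fun x => pushCoeff (a x) (fderiv ℝ ψ x) k l)
      (n ^ 2 * (Lam * C ^ 2)) (n ^ 2 * (7 * Lam * C ^ 2)) := by
  have t : ∀ i j, HB α (K ∩ Metric.ball z r) (fun x => a x i j * (fderiv ℝ ψ x (stdE i) k *
      fderiv ℝ ψ x (stdE j) l)) (Lam * C ^ 2) (7 * Lam * C ^ 2) := fun i j =>
    (HB.mul hLam (by positivity) (by positivity) ((ha i j).subset inter_subset_left)
      ((HB.mul (by positivity) (by positivity) hC (h.HB_fderiv h0 h1 hC i k)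
        (h.HB_fderiv h0 h1 hC j l)).subset inter_subset_right)).mono (by linarith) (by linarith)
  refine (HB.sum _ fun i _ => HB.sum _ fun j _ => t i j).mono (le_of_eq ?_) (le_of_eq ?_) <;>
  · simp; ring

theorem C2B.isHB_fderiv (h0 : 0 < α) (h1 : α < 1) {χ : 𝔼 → ℝ} {d₀ d₁ d₂ d₃ : ℝ}
    (hχ : C2B α χ d₀ d₁ d₂ d₃) (K : Set 𝔼) (i : Fin n) :
    IsHB α K fun x => fderiv ℝ χ x (stdE i) :=
  (((hχ.HB_fderiv h0 h1).apply_stdE i).subset (subset_univ K)).isHB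

theorem C2B.isHB_fun (h0 : 0 < α) (h1 : α < 1) {χ : 𝔼 → ℝ} {d₀ d₁ d₂ d₃ : ℝ}
    (hχ : C2B α χ d₀ d₁ d₂ d₃) (K : Set 𝔼) : IsHB α K χ :=
  ((hχ.HB_fun h0 h1).subset (subset_univ K)).isHB

/-- Coefficients with Hölder regularity on `K` map `C^{2,α}` to Hölder functions on `K`. -/
theorem C2B.isHB_Lop (h0 : 0 < α) (h1 : α < 1) {K : Set 𝔼}
    (ha : ∀ i j, IsHB α K fun x => a x i j) (hb : ∀ i, IsHB α K fun x => b x i) (hc : IsHB α K c)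
    {χ : 𝔼 → ℝ} {d₀ d₁ d₂ d₃ : ℝ} (hχ : C2B α χ d₀ d₁ d₂ d₃) : IsHB α K (Lop a b c χ) := by
  refine ((IsHB.sum _ fun i _ => IsHB.sum _ fun j _ => (ha i j).mul ?_).add
    (IsHB.sum _ fun i _ => (hb i).mul (hχ.isHB_fderiv h0 h1 K i))).add
    (hc.mul (hχ.isHB_fun h0 h1 K))
  exact (((hχ.HB_fderiv_fderiv.apply_stdE i).apply_stdE j).subset (subset_univ K)).isHB

theorem Chart.isHB_pushDrift (h : Chart α Ω z r C ψ) (h0 : 0 < α) (h1 : α < 1) (hC : 0 ≤ C)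
    {K : Set 𝔼} (ha : ∀ i j, IsHB α K fun x => a x i j) (hb : ∀ i, IsHB α K fun x => b x i)
    {χ : 𝔼 → ℝ} {d₀ d₁ d₂ d₃ : ℝ} (hχ : C2B α χ d₀ d₁ d₂ d₃)
    (hs : ∀ x ∉ Metric.ball z r, χ x = 0) (hs' : ∀ x ∉ Metric.ball z r, fderiv ℝ χ x = 0)
    (k : Fin n) : IsHB α K (pushDrift a b χ ψ k) := by
  have e1 : ∀ i, IsHB α (K ∩ Metric.ball z r) fun x => fderiv ℝ ψ x (stdE i) k := fun i =>
    ((h.HB_fderiv h0 h1 hC i k).subset inter_subset_right).isHB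
  have e2 : ∀ i j, IsHB α (K ∩ Metric.ball z r) fun x =>
      fderiv ℝ (fderiv ℝ ψ) x (stdE i) (stdE j) k := fun i j =>
    ((h.HB_fderiv_fderiv i j k).subset inter_subset_right).isHB
  have e3 : ∀ i j, IsHB α K fun x => fderiv ℝ χ x (stdE i) * fderiv ℝ ψ x (stdE j) k :=
    fun i j => (hχ.isHB_fderiv h0 h1 K i).cutmul (e1 j) fun x _ hx => by rw [hs' x hx]; rfl
  refine (IsHB.sum _ fun i _ => IsHB.sum _ fun j _ => (ha i j).mul ((IsHB.add ?_ (e3 i j)).add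
    (e3 j i))).add (IsHB.sum _ fun i _ => (hb i).mul ?_)
  · exact (hχ.isHB_fun h0 h1 K).cutmul (e2 i j) fun x _ hx => hs x hx
  · exact (hχ.isHB_fun h0 h1 K).cutmul (e1 i) fun x _ hx => hs x hx

set_option maxHeartbeats 1600000 in
/-- Approximate local solvability with an error that is small for small balls. -/
theorem local_solver (h0 : 0 < α) (h1 : α < 1) {lam : ℝ} (hlam : 0 < lam) {Lam : ℝ}
    (hLam : 0 ≤ Lam) {C : ℝ} (hC : 1 ≤ C) :
    ∃ C₁, 0 ≤ C₁ ∧ ∀ (Ω : Set 𝔼) (a : 𝔼 → Fin n → Fin n → ℝ) (b : 𝔼 → Fin n → ℝ) (c : 𝔼 → ℝ),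
      (∀ x ∈ closure Ω, ∀ i j, a x i j = a x j i) →
      (∀ x ∈ closure Ω, ∀ ξ : Fin n → ℝ,
        lam * ∑ i, ξ i ^ 2 ≤ ∑ i, ∑ j, a x i j * ξ i * ξ j) →
      (∀ i j, HB α (closure Ω) (fun x => a x i j) Lam Lam) →
      (∀ i, IsHB α (closure Ω) fun x => b x i) → IsHB α (closure Ω) c →
      ∀ z ∈ closure Ω, ∀ r, 0 < r → ∀ ψ, Chart α Ω z r C ψ →
      ∀ (χ θ : 𝔼 → ℝ) (d : ℝ), C2B α χ d d d d → C2B α θ d d d d → (∀ x, |χ x| ≤ 1) →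
      (∀ x, |θ x| ≤ 1) → tsupport χ ⊆ Metric.ball z r → (∀ x, θ x ≠ 0 → χ x = 1) →
      ∀ᶠ s : ℝ in atTop, ∃ M, 0 ≤ M ∧ ∀ (f : 𝔼 → ℝ) (A : ℝ), 0 ≤ A →
        HB α (closure Ω) f (s ^ (-α) * A) A → ∃ u : 𝔼 → ℝ,
          C2B α u (M * A) (M * A) (M * A) (M * A) ∧ (∀ x ∈ frontier Ω, u x = 0) ∧
          (∀ x ∉ Metric.ball z r, s ^ 2 * u x - Lop a b c u x - θ x * f x = 0) ∧
          HB α (closure Ω) (fun x => s ^ 2 * u x - Lop a b c u x - θ x * f x)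
            (C₁ * r ^ α * (s ^ (-α) * A)) (C₁ * r ^ α * A) := by
  have hC0 : 0 < C := zero_lt_one.trans_le hC
  obtain ⟨C₀, hC₀, H⟩ := model_solver (n := n) h0 h1 (lam := lam / C ^ 2) (by positivity)
    (n ^ 2 * (Lam * C ^ 2))
  set κ : ℝ := C₀ * (2 * C) with hκ
  set q : ℝ := n ^ 2 * (7 * Lam * C ^ 2) with hq
  set k₁ : ℝ := κ * (1 + 3 * C + q * C) with hk₁
  have hκ0 : 0 ≤ κ := by positivity
  have hq0 : 0 ≤ q := by positivity
  have hk₁0 : 0 ≤ k₁ := by positivity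
  refine ⟨(n ^ 2 + n + 1) * k₁, by positivity, ?_⟩
  intro Ω a b c hs he ha hb hc z hz r hr ψ hψ χ θ d hχ hθ hχ1 hθ1 hsupp hχθ
  have hd : 0 ≤ d := (abs_nonneg _).trans (hχ.b0 0)
  have hzU : z ∈ Metric.ball z r := Metric.mem_ball_self hr
  have haI : ∀ i j, IsHB α (closure Ω) fun x => a x i j := fun i j => (ha i j).isHB
  have hχev : ∀ x ∉ Metric.ball z r, χ =ᶠ[𝓝 x] fun _ => 0 := fun x hx =>
    notMem_tsupport_iff_eventuallyEq.1 fun h => hx (hsupp h)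
  have hχ0 : ∀ x ∉ Metric.ball z r, χ x = 0 := fun x hx => (hχev x hx).eq_of_nhds
  have hχ' : ∀ x ∉ Metric.ball z r, fderiv ℝ χ x = 0 := fun x hx => by
    rw [(hχev x hx).fderiv_eq (𝕜 := ℝ)]; simp
  have hLχ : ∀ u : 𝔼 → ℝ, ∀ x, (u =ᶠ[𝓝 x] fun _ => 0) → Lop a b c u x = 0 := fun u x hu => by
    have h2 : fderiv ℝ u =ᶠ[𝓝 x] fun _ => 0 := by
      filter_upwards [hu.fderiv (𝕜 := ℝ)] with y hy
      rw [hy]; simp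
    have h3 := h2.fderiv_eq (𝕜 := ℝ)
    simp [Lop, h3, h2.eq_of_nhds, hu.eq_of_nhds]
  have hθ0 : ∀ x ∉ Metric.ball z r, θ x = 0 := fun x hx => by
    by_contra h
    have := hχθ x h
    rw [hχ0 x hx] at this
    exact zero_ne_one this
  have hpc := hψ.HB_pushCoeff h0 h1 hC0.le hLam ha
  set D : Fin n → Fin n → 𝔼 → ℝ := fun k l x => χ x *
    (pushCoeff (a x) (fderiv ℝ ψ x) k l - pushCoeff (a z) (fderiv ℝ ψ z) k l) with hD
  have hD0 : ∀ k l, ∀ x ∈ closure Ω, ‖D k l x‖ ≤ q * r ^ α := fun k l x hx => by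
    by_cases hxU : x ∈ Metric.ball z r
    · have h2 := (hpc k l).hd x ⟨hx, hxU⟩ z ⟨hz, hzU⟩
      rw [hD, norm_mul]
      refine (mul_le_of_le_one_left (norm_nonneg _) (hχ1 x)).trans (h2.trans ?_)
      gcongr
      exact (mem_ball_iff_norm.1 hxU).le
    · simp only [hD, hχ0 x hxU, zero_mul, norm_zero]; positivity
  have hDH : ∀ p : Fin n × Fin n, IsHB α (closure Ω) (D p.1 p.2) := fun p =>
    (hχ.isHB_fun h0 h1 _).cutmul ((hpc p.1 p.2).isHB.sub (IsHB.const _)) fun x _ hx => hχ0 x hx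
  obtain ⟨hh₁, hh₁0, hDH⟩ := IsHB.exists_common hDH
  obtain ⟨hh₂, hh₂0, hβH⟩ := IsHB.exists_common fun k =>
    hψ.isHB_pushDrift h0 h1 hC0.le haI hb hχ hχ0 hχ' k
  obtain ⟨hh₃, hh₃0, hmH⟩ := hχ.isHB_Lop h0 h1 haI hb hc
  set h := hh₁ + hh₂ + hh₃ with hh
  have hh0 : 0 ≤ h := by positivity
  obtain ⟨M, hM0, hM⟩ := hψ.C2B_cutoff h0 h1 hC hd hχ hsupp
  have lim : Tendsto (fun s : ℝ => s ^ (-α)) atTop (𝓝 0) := tendsto_rpow_neg_atTop h0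
  have hrα : 0 < r ^ α := Real.rpow_pos_of_pos hr _
  have ev1 : ∀ᶠ s : ℝ in atTop, h * s ^ (-α) < r ^ α := by
    have := lim.const_mul h
    rw [mul_zero] at this
    exact this.eventually_lt_const hrα
  have ev2 : ∀ᶠ s : ℝ in atTop, 3 * d * s ^ (-α) < 1 := by
    have := lim.const_mul (3 * d)
    rw [mul_zero] at this
    exact this.eventually_lt_const one_pos
  filter_upwards [ev1, ev2, eventually_ge_atTop 1] with s hs1 hs2 hs3
  have hs0 : 0 < s := by linarith
  set t := s ^ (-α) with ht
  have ht0 : 0 < t := Real.rpow_pos_of_pos hs0 _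
  have ht1 : t ≤ 1 := Real.rpow_le_one_of_one_le_of_nonpos hs3 (by linarith)
  set σ := s⁻¹ with hσ
  have hσ0 : 0 < σ := by positivity
  have hσt : σ ≤ t := by
    rw [hσ, ← Real.rpow_neg_one]
    exact Real.rpow_le_rpow_of_exponent_le hs3 (by linarith)
  refine ⟨M * κ, by positivity, fun f A hA hf => ?_⟩
  have hθf : HB α (closure Ω) (fun x => θ x * f x) (t * A) (2 * A) := by
    have hθH : HB α (closure Ω) θ 1 (3 * d) := ⟨fun x _ => hθ1 x, fun x _ y _ =>
      ((hθ.HB_fun h0 h1).hd x trivial y trivial).trans (by gcongr; linarith)⟩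
    refine (HB.mul (by positivity) hA (by positivity) hθH hf).mono (by linarith) ?_
    nlinarith
  obtain ⟨F, hF, hFψ⟩ := hψ.exists_pullback h0 h1 hC (by positivity) (by positivity) hθf
  have hF' : BddHolder α F (2 * A * C * t) (2 * A * C) :=
    ⟨fun x => (hF.bound x).trans (by nlinarith [mul_nonneg ht0.le hA]), hF.holder⟩
  obtain ⟨v, hv, hveq, hv0⟩ := H (pushCoeff (a z) (fderiv ℝ ψ z))
    (pushCoeff_symm (hs z hz) _) (fun k l => (hpc k l).bd z ⟨hz, hzU⟩)
    (elliptic_transform hlam (he z hz) hC0 (hψ.le_fderiv hr)) s hs3 F (2 * A * C) hF'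
  have hv : C2B α v (κ * A * (t * σ)) (κ * A * (t * σ)) (κ * A * t) (κ * A) := by
    have e : C₀ * (2 * A * C) = κ * A := by rw [hκ]; ring
    rw [e] at hv
    refine hv.mono ?_ (le_of_eq ?_) le_rfl le_rfl
    · rw [div_eq_mul_inv, mul_assoc]
      gcongr
      rw [hσ]
      exact inv_anti₀ hs0 (by nlinarith)
    · rw [hσ]; ring
  have hκA : 0 ≤ κ * A := by positivity
  have hσ1 : σ ≤ 1 := hσt.trans ht1
  have htσ : t * σ ≤ t := mul_le_of_le_one_right ht0.le hσ1
  have hvB : C2B α v (κ * A) (κ * A) (κ * A) (κ * A) := by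
    refine hv.mono ?_ ?_ ?_ le_rfl <;>
    · refine mul_le_of_le_one_right hκA ?_
      nlinarith
  have hu := hM v _ hκA hvB
  rw [← mul_assoc] at hu
  have heq : ∀ x ∈ closure Ω, s ^ 2 * (χ x * v (ψ x)) - Lop a b c (fun y => χ y * v (ψ y)) x -
      θ x * f x = -(∑ k, ∑ l, D k l x * fderiv ℝ (fderiv ℝ v) (ψ x) (stdE k) (stdE l) +
        ∑ k, pushDrift a b χ ψ k x * fderiv ℝ v (ψ x) (stdE k) + Lop a b c χ x * v (ψ x)) := by
    intro x hx
    by_cases hxU : x ∈ Metric.ball z r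
    · have h2 := hveq (ψ x) (hψ.nonneg x hxU hx)
      rw [hFψ x ⟨hx, hxU⟩] at h2
      have h3 : χ x * (θ x * f x) = θ x * f x := by
        by_cases hθx : θ x = 0
        · simp [hθx]
        · rw [hχθ x hθx, one_mul]
      rw [hψ.Lop_cutoff hv.contDiff hχ.contDiff hxU, ← h3, ← h2]
      simp only [hD, mul_sub, sub_mul, Finset.sum_sub_distrib, Finset.mul_sum, mul_assoc]
      ring
    · have hu0 : (fun y => χ y * v (ψ y)) =ᶠ[𝓝 x] fun _ => 0 := by
        filter_upwards [hχev x hxU] with y hy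
        rw [hy, zero_mul]
      rw [hLχ _ x hu0, hLχ _ x (hχev x hxU)]
      simp [hD, pushDrift, hχ0 x hxU, hχ' x hxU, hθ0 x hxU]
  refine ⟨fun x => χ x * v (ψ x), hu, fun x hx => ?_, fun x hxU => ?_, ?_⟩
  · show χ x * v (ψ x) = 0
    by_cases hxU : x ∈ Metric.ball z r
    · rw [hv0 _ (hψ.zero x hxU hx), mul_zero]
    · rw [hχ0 x hxU, zero_mul]
  · have hu0 : (fun y => χ y * v (ψ y)) =ᶠ[𝓝 x] fun _ => 0 := by
      filter_upwards [hχev x hxU] with y hy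
      rw [hy, zero_mul]
    show s ^ 2 * (χ x * v (ψ x)) - Lop a b c (fun y => χ y * v (ψ y)) x - θ x * f x = 0
    rw [hLχ _ x hu0, hχ0 x hxU, hθ0 x hxU]
    ring
  · have tA0 : 0 ≤ t * A := by positivity
    have hht : h * t ≤ r ^ α := hs1.le
    have hsub : closure Ω ∩ Metric.ball z r ⊆ Metric.ball z r := inter_subset_right
    have hκt : κ * A * (t * σ) ≤ κ * A * t := by gcongr
    have hv0' : HB α univ v (κ * A * (t * σ)) (3 * (κ * A * t)) :=
      (hv.HB_fun h0 h1).mono le_rfl (by linarith)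
    have hv1' : HB α univ (fderiv ℝ v) (κ * A * (t * σ)) (3 * (κ * A * t)) :=
      (hv.HB_fderiv h0 h1).mono le_rfl (by linarith)
    have v0 : HB α (closure Ω ∩ Metric.ball z r) (fun x => v (ψ x)) (κ * A * (t * σ))
        (3 * (κ * A * t) * C) :=
      (hψ.HB_comp h0 h1 hC (by positivity) hv0').subset hsub
    have v1 : ∀ k, HB α (closure Ω ∩ Metric.ball z r) (fun x => fderiv ℝ v (ψ x) (stdE k))
        (κ * A * (t * σ)) (3 * (κ * A * t) * C) := fun k =>
      ((hψ.HB_comp h0 h1 hC (by positivity) hv1').subset hsub).apply_stdE k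
    have v2 : ∀ k l, HB α (closure Ω ∩ Metric.ball z r)
        (fun x => fderiv ℝ (fderiv ℝ v) (ψ x) (stdE k) (stdE l)) (κ * A * t) (κ * A * C) :=
      fun k l => (((hψ.HB_comp h0 h1 hC hκA hv.HB_fderiv_fderiv).subset hsub).apply_stdE
        k).apply_stdE l
    have low : ∀ (β w : 𝔼 → ℝ), HB α (closure Ω) β h h →
        HB α (closure Ω ∩ Metric.ball z r) w (κ * A * (t * σ)) (3 * (κ * A * t) * C) →
        (∀ x ∉ Metric.ball z r, β x = 0) →
        HB α (closure Ω) (fun x => β x * w x) (k₁ * r ^ α * (t * A)) (k₁ * r ^ α * A) := by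
      intro β w hβ hw hβ0
      have hX : κ * A * (h * t) ≤ κ * A * r ^ α := by gcongr
      have hY : 0 ≤ κ * A * r ^ α := by positivity
      have hk : k₁ * r ^ α * A = κ * A * r ^ α * (1 + 3 * C + q * C) := by rw [hk₁]; ring
      have hqC : 0 ≤ q * C := by positivity
      refine (HB.cutmul hh0 (by positivity) (by positivity) hβ hw fun x _ hx => hβ0 x hx).mono ?_ ?_
      · calc h * (κ * A * (t * σ)) = κ * A * (h * t) * σ := by ring
          _ ≤ κ * A * r ^ α * t := by gcongr
          _ ≤ κ * A * r ^ α * t * (1 + 3 * C + q * C) :=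
            le_mul_of_one_le_right (by positivity) (by linarith)
          _ = _ := by rw [hk₁]; ring
      · rw [hk]
        calc h * (κ * A * (t * σ)) + h * (3 * (κ * A * t) * C) =
            κ * A * (h * t) * σ + κ * A * (h * t) * (3 * C) := by ring
          _ ≤ κ * A * r ^ α * 1 + κ * A * r ^ α * (3 * C) := by gcongr
          _ ≤ _ := by nlinarith [mul_nonneg hY hqC]
    have top : ∀ k l, HB α (closure Ω)
        (fun x => D k l x * fderiv ℝ (fderiv ℝ v) (ψ x) (stdE k) (stdE l))
        (k₁ * r ^ α * (t * A)) (k₁ * r ^ α * A) := by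
      intro k l
      have hX : κ * A * (h * t) ≤ κ * A * r ^ α := by gcongr
      have hh1 : hh₁ ≤ h := by rw [hh]; linarith
      have hDkl : HB α (closure Ω) (D k l) (q * r ^ α) h := ⟨hD0 k l, fun x hx y hy =>
        ((hDH (k, l)).hd x hx y hy).trans (by gcongr)⟩
      refine (HB.cutmul hh0 (by positivity) (by positivity) hDkl (v2 k l) fun x _ hx => by
        simp only [hD, hχ0 x hx, zero_mul]).mono ?_ ?_
      · calc q * r ^ α * (κ * A * t) = κ * (q * 1) * r ^ α * (t * A) := by ring
          _ ≤ κ * (1 + 3 * C + q * C) * r ^ α * (t * A) := by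
            gcongr
            nlinarith
          _ = _ := by rw [hk₁]
      · calc h * (κ * A * t) + q * r ^ α * (κ * A * C) =
            κ * A * (h * t) + κ * A * r ^ α * (q * C) := by ring
          _ ≤ κ * A * r ^ α + κ * A * r ^ α * (q * C) := by gcongr
          _ ≤ κ * A * r ^ α * (1 + 3 * C + q * C) := by
            have : 0 ≤ κ * A * r ^ α * (3 * C) := by positivity
            linarith
          _ = _ := by rw [hk₁]; ring
    have mid : ∀ k, HB α (closure Ω) (fun x => pushDrift a b χ ψ k x * fderiv ℝ v (ψ x) (stdE k))
        (k₁ * r ^ α * (t * A)) (k₁ * r ^ α * A) := fun k => by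
      have hh2 : hh₂ ≤ h := by rw [hh]; linarith
      exact low _ _ ((hβH k).mono hh2 hh2) (v1 k) fun x hx => by
        simp [pushDrift, hχ0 x hx, hχ' x hx]
    have bot : HB α (closure Ω) (fun x => Lop a b c χ x * v (ψ x))
        (k₁ * r ^ α * (t * A)) (k₁ * r ^ α * A) := by
      have hh3 : hh₃ ≤ h := by rw [hh]; linarith
      exact low _ _ (hmH.mono hh3 hh3) v0 fun x hx => hLχ _ x (hχev x hx)
    refine HB.congr ((((HB.sum _ fun k _ => HB.sum _ fun l _ => top k l).add
      (HB.sum _ fun k _ => mid k)).add bot).neg.mono (le_of_eq ?_) (le_of_eq ?_)) heq <;>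
    · simp; ring

end LocalSolver

section FirstNeumann

set_option linter.unusedSectionVars false

variable {n : ℕ} {α : ℝ}

local notation "𝔼" => EuclideanSpace ℝ (Fin n)

theorem exists_separated_net {K : Set 𝔼} (hK : IsCompact K) {r : ℝ} (hr : 0 < r) :
    ∃ s : Finset 𝔼, (∀ z ∈ s, z ∈ K) ∧ (∀ c ∈ s, ∀ d ∈ s, c ≠ d → r / 2 ≤ ‖c - d‖) ∧
      ∀ x ∈ K, ∃ z ∈ s, x ∈ Metric.ball z (5 / 8 * r) := by
  classical
  obtain ⟨t, htK, htf, hcov⟩ := hK.finite_cover_balls (e := r / 8) (by positivity)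
  lift t to Finset 𝔼 using htf
  obtain ⟨s, hs⟩ := ((t.powerset.filter fun s => ∀ c ∈ s, ∀ d ∈ s, c ≠ d →
    r / 2 ≤ ‖c - d‖)).exists_maximal ⟨∅, by simp⟩
  have hs1 := Finset.mem_filter.1 hs.prop
  have hst := Finset.mem_powerset.1 hs1.1
  refine ⟨s, fun z hz => htK (hst hz), hs1.2, fun x hx => ?_⟩
  obtain ⟨y, hy, hxy⟩ := mem_iUnion₂.1 (hcov hx)
  have hxy : ‖x - y‖ < r / 8 := mem_ball_iff_norm.1 hxy
  by_contra! hcon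
  have hfar : ∀ z ∈ s, r / 2 ≤ ‖y - z‖ := fun z hz => by
    have h1 := hcon z hz
    rw [mem_ball_iff_norm, not_lt] at h1
    have h2 := norm_sub_le_norm_sub_add_norm_sub x y z
    linarith
  have hys : y ∉ s := fun h => by
    have := hfar y h
    simp at this
    linarith
  have hins : insert y s ∈ t.powerset.filter fun s => ∀ c ∈ s, ∀ d ∈ s, c ≠ d →
      r / 2 ≤ ‖c - d‖ := by
    refine Finset.mem_filter.2 ⟨Finset.mem_powerset.2 (Finset.insert_subset hy hst), ?_⟩
    intro c hc d hd hcd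
    rcases Finset.mem_insert.1 hc with hc' | hc' <;> rcases Finset.mem_insert.1 hd with hd' | hd'
    · exact absurd (hc'.trans hd'.symm) hcd
    · rw [hc']; exact hfar d hd'
    · rw [norm_sub_rev, hd']; exact hfar c hc'
    · exact hs1.2 c hc' d hd' hcd
  exact hys (hs.le_of_ge hins (Finset.subset_insert y s) (Finset.mem_insert_self y s))

theorem card_le_of_separated_of_mem_ball {s : Finset 𝔼} {r : ℝ} (hr : 0 < r)
    (hs : ∀ c ∈ s, ∀ d ∈ s, c ≠ d → r / 2 ≤ ‖c - d‖) (x : 𝔼) (t : Finset 𝔼) (ht : t ⊆ s)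
    (hx : ∀ z ∈ t, x ∈ Metric.ball z r) : t.card ≤ 5 ^ n := by
  classical
  have hinj : Function.Injective fun z : 𝔼 => (2 / r) • (z - x) := fun z w h => by
    have := smul_right_injective 𝔼 (r := 2 / r) (by positivity) h
    simpa using this
  have h := Besicovitch.card_le_of_separated (t.image fun z : 𝔼 => (2 / r) • (z - x)) ?_ ?_
  · rwa [Finset.card_image_of_injective _ hinj, finrank_euclideanSpace_fin] at h
  · intro c hc
    obtain ⟨z, hz, rfl⟩ := Finset.mem_image.1 hc
    have h1 : ‖x - z‖ < r := mem_ball_iff_norm.1 (hx z hz)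
    rw [norm_smul, Real.norm_of_nonneg (by positivity), norm_sub_rev, div_mul_eq_mul_div,
      div_le_iff₀ hr]
    linarith
  · intro c hc d hd hcd
    obtain ⟨z, hz, rfl⟩ := Finset.mem_image.1 hc
    obtain ⟨w, hw, rfl⟩ := Finset.mem_image.1 hd
    have h1 := hs z (ht hz) w (ht hw) fun h => hcd (by rw [h])
    rw [← smul_sub, sub_sub_sub_cancel_right, norm_smul, Real.norm_of_nonneg (by positivity),
      div_mul_eq_mul_div, le_div_iff₀ hr]
    linarith

theorem exists_cutoffs (h0 : 0 < α) (h1 : α < 1) {K : Set 𝔼} (hK : IsCompact K) {r : ℝ}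
    (hr : 0 < r) {s : Finset 𝔼} (hs : ∀ x ∈ K, ∃ z ∈ s, x ∈ Metric.ball z (5 / 8 * r)) :
    ∃ χ θ : 𝔼 → 𝔼 → ℝ, (∀ z ∈ s, (∃ d, C2B α (χ z) d d d d ∧ C2B α (θ z) d d d d) ∧
      (∀ x, |χ z x| ≤ 1) ∧ (∀ x, |θ z x| ≤ 1) ∧ tsupport (χ z) ⊆ Metric.ball z r ∧
      ∀ x, θ z x ≠ 0 → χ z x = 1) ∧ ∀ x ∈ K, ∑ z ∈ s, θ z x = 1 := by
  obtain ⟨p, hp⟩ := SmoothPartitionOfUnity.exists_isSubordinate (modelWithCornersSelf ℝ 𝔼)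
    hK.isClosed (fun z : s => Metric.ball (z : 𝔼) (5 / 8 * r)) (fun z => Metric.isOpen_ball)
    (fun x hx => by
      obtain ⟨z, hz, hxz⟩ := hs x hx
      exact mem_iUnion.2 ⟨⟨z, hz⟩, hxz⟩)
  classical
  let χ : ∀ z : 𝔼, ContDiffBump z := fun z => ⟨5 / 8 * r, 3 / 4 * r, by positivity, by linarith⟩
  let θ : 𝔼 → 𝔼 → ℝ := fun z x => if hz : z ∈ s then p ⟨z, hz⟩ x else 0
  have hθ : ∀ z (hz : z ∈ s), θ z = p ⟨z, hz⟩ := fun z hz => by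
    funext x; simp [θ, hz]
  refine ⟨fun z => χ z, θ, fun z hz => ⟨?_, fun x => ?_, fun x => ?_, ?_, fun x hx => ?_⟩,
    fun x hx => ?_⟩
  · obtain ⟨d₁, hd₁, e₁⟩ := exists_C2B_of_compactSupport h0 h1 ((χ z).contDiff (n := 3))
      (χ z).hasCompactSupport
    have hc : HasCompactSupport (p ⟨z, hz⟩) :=
      (isCompact_closedBall z (5 / 8 * r)).of_isClosed_subset (isClosed_tsupport _)
        ((hp ⟨z, hz⟩).trans Metric.ball_subset_closedBall)
    have hd : ContDiff ℝ 3 (p ⟨z, hz⟩) :=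
      contDiff_infty.1 (p ⟨z, hz⟩).contMDiff.contDiff 3
    obtain ⟨d₂, hd₂, e₂⟩ := exists_C2B_of_compactSupport h0 h1 hd hc
    refine ⟨d₁ + d₂, ?_, ?_⟩
    · exact e₁.mono (by linarith) (by linarith) (by linarith) (by linarith)
    · rw [hθ z hz]
      exact e₂.mono (by linarith) (by linarith) (by linarith) (by linarith)
  · rw [abs_of_nonneg (χ z).nonneg]; exact (χ z).le_one
  · rw [hθ z hz, abs_of_nonneg (p.nonneg _ _)]; exact p.le_one _ _
  · rw [(χ z).tsupport_eq]
    exact Metric.closedBall_subset_ball (by show 3 / 4 * r < r; linarith)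
  · rw [hθ z hz] at hx
    exact (χ z).one_of_mem_closedBall (Metric.ball_subset_closedBall
      (hp ⟨z, hz⟩ (subset_tsupport _ hx)))
  · rw [← p.sum_eq_one hx, finsum_eq_sum_of_fintype, ← Finset.sum_coe_sort]
    exact Finset.sum_congr rfl fun z _ => by rw [hθ z z.2]

theorem Lop_zero (a : 𝔼 → Fin n → Fin n → ℝ) (b : 𝔼 → Fin n → ℝ) (c : 𝔼 → ℝ) (x : 𝔼) :
    Lop a b c (fun _ => 0) x = 0 := by
  have h : fderiv ℝ (fun _ : 𝔼 => (0 : ℝ)) = fun _ => 0 := by funext x; simp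
  simp [Lop, h]

theorem Lop_sum {a : 𝔼 → Fin n → Fin n → ℝ} {b : 𝔼 → Fin n → ℝ} {c : 𝔼 → ℝ} {ι : Type}
    (s : Finset ι) {u : ι → 𝔼 → ℝ} (hu : ∀ i ∈ s, ContDiff ℝ 2 (u i)) (x : 𝔼) :
    Lop a b c (fun y => ∑ i ∈ s, u i y) x = ∑ i ∈ s, Lop a b c (u i) x := by
  classical
  induction s using Finset.induction_on with
  | empty => simpa using Lop_zero a b c x
  | insert i s his ih =>
    simp only [Finset.sum_insert his]
    rw [← ih fun j hj => hu j (Finset.mem_insert_of_mem hj)]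
    exact Lop_add (hu i (Finset.mem_insert_self i s)).contDiffAt
      (ContDiff.sum fun j hj => hu j (Finset.mem_insert_of_mem hj)).contDiffAt

theorem Lop_massive (a : 𝔼 → Fin n → Fin n → ℝ) (b : 𝔼 → Fin n → ℝ) (c : 𝔼 → ℝ) (μ : ℝ)
    (u : 𝔼 → ℝ) (x : 𝔼) : Lop (fun x i j => -a x i j) (fun x i => -b x i) (fun x => μ - c x) u x =
      μ * u x - Lop a b c u x := by
  simp only [Lop, neg_mul, Finset.sum_neg_distrib]
  ring

theorem massive_solver [NeZero n] (h0 : 0 < α) (h1 : α < 1) {lam : ℝ} (hlam : 0 < lam)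
    {Ω : Set 𝔼} (hΩ : Bornology.IsBounded Ω)
    (hchart : ∀ x ∈ closure Ω, ∃ r C ψ, 0 < r ∧ Chart α Ω x r C ψ)
    {a : 𝔼 → Fin n → Fin n → ℝ} {b : 𝔼 → Fin n → ℝ} {c : 𝔼 → ℝ}
    (hsym : ∀ x ∈ closure Ω, ∀ i j, a x i j = a x j i)
    (hell : ∀ x ∈ closure Ω, ∀ ξ : Fin n → ℝ,
        lam * ∑ i, ξ i ^ 2 ≤ ∑ i, ∑ j, a x i j * ξ i * ξ j)
    (ha : ∀ i j, IsHB α (closure Ω) fun x => a x i j)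
    (hb : ∀ i, IsHB α (closure Ω) fun x => b x i) (hc : IsHB α (closure Ω) c) :
    ∃ μ M : ℝ, 1 ≤ μ ∧ 0 ≤ M ∧ ∀ (f : 𝔼 → ℝ) (A : ℝ), 0 ≤ A → HB α (closure Ω) f A A →
      ∃ u : 𝔼 → ℝ, C2B α u (M * A) (M * A) (M * A) (M * A) ∧ (∀ x ∈ frontier Ω, u x = 0) ∧
        ∀ x ∈ closure Ω, μ * u x - Lop a b c u x = f x := by
  obtain ⟨Lam, hLam, haL⟩ := IsHB.exists_common fun p : Fin n × Fin n => ha p.1 p.2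
  obtain ⟨R, C', hR, hch⟩ := exists_uniform_chart hΩ hchart
  obtain ⟨C₁, hC₁, H⟩ := local_solver (n := n) h0 h1 hlam hLam (le_max_right C' 1)
  set q : ℝ := 1 / (4 * 5 ^ n * C₁ + 1) with hq
  have hq0 : 0 < q := by positivity
  set r := min R (q ^ α⁻¹) with hr
  have hr0 : 0 < r := lt_min hR (Real.rpow_pos_of_pos hq0 _)
  have hrα : r ^ α ≤ q := by
    calc r ^ α ≤ (q ^ α⁻¹) ^ α := Real.rpow_le_rpow hr0.le (min_le_right _ _) h0.le
      _ = q := Real.rpow_inv_rpow hq0.le h0.ne'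
  have hsmall : 2 * 5 ^ n * (C₁ * r ^ α) ≤ 1 / 2 := by
    have h2 : C₁ * r ^ α ≤ C₁ * q := by gcongr
    have h3 : 4 * 5 ^ n * (C₁ * q) ≤ 1 := by
      rw [hq, mul_one_div, ← mul_div_assoc, div_le_one (by positivity)]
      linarith
    have h4 : (4 * 5 ^ n) * (C₁ * r ^ α) ≤ (4 * 5 ^ n) * (C₁ * q) := by gcongr
    linarith
  obtain ⟨s, hsK, hsep, hcov⟩ := exists_separated_net hΩ.isCompact_closure hr0
  obtain ⟨χ, θ, hχθ, hsum⟩ := exists_cutoffs h0 h1 hΩ.isCompact_closure hr0 hcov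
  have hev : ∀ z ∈ s, ∀ᶠ σ : ℝ in atTop, ∃ M, 0 ≤ M ∧ ∀ (f : 𝔼 → ℝ) (A : ℝ), 0 ≤ A →
      HB α (closure Ω) f (σ ^ (-α) * A) A → ∃ u : 𝔼 → ℝ,
        C2B α u (M * A) (M * A) (M * A) (M * A) ∧ (∀ x ∈ frontier Ω, u x = 0) ∧
        (∀ x ∉ Metric.ball z r, σ ^ 2 * u x - Lop a b c u x - θ z x * f x = 0) ∧
        HB α (closure Ω) (fun x => σ ^ 2 * u x - Lop a b c u x - θ z x * f x)
          (C₁ * r ^ α * (σ ^ (-α) * A)) (C₁ * r ^ α * A) := fun z hz => by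
    obtain ⟨ψ, hψ⟩ := hch z (hsK z hz) r (min_le_left _ _)
    obtain ⟨⟨d, hd1, hd2⟩, k1, k2, k3, k4⟩ := hχθ z hz
    exact H Ω a b c hsym hell (fun i j => haL (i, j)) hb hc z (hsK z hz) r hr0 ψ
      (hψ.mono subset_rfl (le_max_left C' 1)) (χ z) (θ z) d hd1 hd2 k1 k2 k3 k4
  obtain ⟨σ, hσ, hσ1⟩ := (((Filter.eventually_all_finset s).2 hev).and
    (eventually_ge_atTop (1 : ℝ))).exists
  choose! M hM0 hM using hσ
  have hσ0 : 0 < σ := by linarith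
  have hMs : 0 ≤ ∑ z ∈ s, M z := Finset.sum_nonneg hM0
  refine ⟨σ ^ 2, (∑ z ∈ s, M z) * σ ^ α / (1 - 1 / 2), by nlinarith, by positivity,
    fun f A hA hf => ?_⟩
  have hsolve : ∀ (f : 𝔼 → ℝ) (A : ℝ), 0 ≤ A → HB α (closure Ω) f (σ ^ (-α) * A) A →
      ∃ u : 𝔼 → ℝ, C2B α u ((∑ z ∈ s, M z) * A) ((∑ z ∈ s, M z) * A) ((∑ z ∈ s, M z) * A)
        ((∑ z ∈ s, M z) * A) ∧ (∀ x ∈ frontier Ω, u x = 0) ∧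
        HB α (closure Ω) (fun x => f x - Lop (fun x i j => -a x i j) (fun x i => -b x i)
          (fun x => σ ^ 2 - c x) u x) (σ ^ (-α) * (1 / 2 * A)) (1 / 2 * A) := by
    intro f A hA hf
    choose! u hu1 hu2 hu3 hu4 using fun z hz => hM z hz f A hA hf
    refine ⟨fun x => ∑ z ∈ s, u z x, ?_, fun x hx => Finset.sum_eq_zero fun z hz =>
      hu2 z hz x hx, ?_⟩
    · simp only [Finset.sum_mul]
      exact C2B.sum s hu1
    · have hov := HB.sum_overlap s (by positivity) (by positivity) hu4 (fun z => Metric.ball z r)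
        (fun z hz x _ hx => hu3 z hz x hx) (m := 5 ^ n)
        fun x _ t ht hxt => card_le_of_separated_of_mem_ball hr0 hsep x t ht hxt
      have ht : 0 ≤ σ ^ (-α) * A := by positivity
      refine HB.congr (hov.neg.mono ?_ ?_) fun x hx => ?_
      · push_cast
        have : 5 ^ n * (C₁ * r ^ α) ≤ 1 / 2 := by
          have : 0 ≤ 5 ^ n * (C₁ * r ^ α) := by positivity
          linarith
        nlinarith
      · push_cast
        nlinarith
      · rw [Lop_massive, Lop_sum s fun z hz => (hu1 z hz).contDiff, Finset.mul_sum,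
          Finset.sum_sub_distrib, Finset.sum_sub_distrib, ← Finset.sum_mul, hsum x hx]
        ring
  have hσα : σ ^ (-α) * (σ ^ α * A) = A := by
    rw [← mul_assoc, ← Real.rpow_add hσ0]; simp
  obtain ⟨u, hu1, hu2, hu3⟩ := neumann_series (C₂ := σ ^ (-α)) h0 (by norm_num) (by norm_num)
    hsolve (fun f A hf => hf.bd) (A := σ ^ α * A) (f := f) (by positivity) (by
      rw [hσα]
      refine hf.mono le_rfl ?_
      exact le_mul_of_one_le_left hA (Real.one_le_rpow hσ1 h0.le))
  refine ⟨u, ?_, hu2, fun x hx => by rw [← hu3 x hx, Lop_massive]⟩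
  have e : (∑ z ∈ s, M z) * σ ^ α / (1 - 1 / 2) * A =
    (∑ z ∈ s, M z) * (σ ^ α * A) / (1 - 1 / 2) := by ring
  rwa [e]

end FirstNeumann

section SecondNeumann

set_option linter.unusedSectionVars false

variable {n : ℕ} {α : ℝ}

local notation "𝔼" => EuclideanSpace ℝ (Fin n)

theorem exists_holder_scale (h1 : α < 1) {Q L : ℝ} (hQ : 0 < Q) (hL : 0 ≤ L) :
    ∃ δ : ℝ, 0 < δ ∧ δ ≤ 1 ∧ ∀ t d : ℝ, 0 ≤ t → d ≤ 2 * Q → d ≤ L / δ * t →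
      0 < α → d ≤ 1 / (2 * δ) * t ^ α := by
  set p : ℝ := 1 / (2 * L + 1) with hp
  have hp0 : 0 < p := by positivity
  set τ := p ^ (1 - α)⁻¹ with hτ
  have hτ0 : 0 < τ := Real.rpow_pos_of_pos hp0 _
  have hτp : τ ^ (1 - α) = p := Real.rpow_inv_rpow hp0.le (by linarith)
  have hτα : 0 < τ ^ α := Real.rpow_pos_of_pos hτ0 _
  set δ := min 1 (τ ^ α / (4 * Q)) with hδ
  have hδ0 : 0 < δ := lt_min one_pos (by positivity)
  refine ⟨δ, hδ0, min_le_left _ _, fun t d ht hd hd' h0 => ?_⟩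
  rcases le_total t τ with h | h
  · have e : t = t ^ (1 - α) * t ^ α := by
      rcases ht.eq_or_lt with rfl | ht
      · simp [h0.ne']
      · rw [← Real.rpow_add ht]; simp
    have h2 : t ^ (1 - α) ≤ p := hτp ▸ Real.rpow_le_rpow ht h (by linarith)
    have h3 : L * p ≤ 1 / 2 := by
      rw [hp, mul_one_div, div_le_div_iff₀ (by positivity) two_pos]; linarith
    have h4 : 0 ≤ t ^ α := Real.rpow_nonneg ht _
    calc d ≤ L / δ * (t ^ (1 - α) * t ^ α) := by rwa [← e]
      _ ≤ L / δ * (p * t ^ α) := by gcongr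
      _ = L * p * (t ^ α / δ) := by ring
      _ ≤ 1 / 2 * (t ^ α / δ) := by gcongr
      _ = _ := by field_simp
  · have h2 : τ ^ α ≤ t ^ α := Real.rpow_le_rpow hτ0.le h h0.le
    have h3 : δ * (4 * Q) ≤ τ ^ α := by
      rw [← le_div_iff₀ (by positivity)]; exact min_le_right _ _
    refine hd.trans ?_
    rw [div_mul_eq_mul_div, one_mul, le_div_iff₀ (by positivity)]
    linarith

theorem C2B.lipschitz {u : 𝔼 → ℝ} {A₀ A₁ A₂ A₃ : ℝ} (hu : C2B α u A₀ A₁ A₂ A₃) (x y : 𝔼) :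
    |u x - u y| ≤ A₁ * ‖x - y‖ :=
  Convex.norm_image_sub_le_of_norm_fderiv_le (𝕜 := ℝ) (fun z _ => hu.differentiable z)
    (fun z _ => hu.b1 z) convex_univ (mem_univ y) (mem_univ x)

theorem zero_boundary_solver [NeZero n] (h0 : 0 < α) (h1 : α < 1) {lam : ℝ} (hlam : 0 < lam)
    {Ω : Set 𝔼} (hΩo : IsOpen Ω) (hΩ : Bornology.IsBounded Ω)
    (hchart : ∀ x ∈ closure Ω, ∃ r C ψ, 0 < r ∧ Chart α Ω x r C ψ)
    {a : 𝔼 → Fin n → Fin n → ℝ} {b : 𝔼 → Fin n → ℝ} {c : 𝔼 → ℝ}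
    (hsym : ∀ x, ∀ i j, a x i j = a x j i)
    (hell : ∀ x ∈ closure Ω, ∀ ξ : Fin n → ℝ,
        lam * ∑ i, ξ i ^ 2 ≤ ∑ i, ∑ j, a x i j * ξ i * ξ j)
    (ha : ∀ i j, IsHB α (closure Ω) fun x => a x i j)
    (hb : ∀ i, IsHB α (closure Ω) fun x => b x i) (hc : IsHB α (closure Ω) c)
    (hc0 : ∀ x ∈ Ω, c x ≤ 0) {f : 𝔼 → ℝ} (hf : IsHB α (closure Ω) f) :
    ∃ (u : 𝔼 → ℝ) (M : ℝ), C2B α u M M M M ∧ (∀ x ∈ frontier Ω, u x = 0) ∧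
      ∀ x ∈ closure Ω, Lop a b c u x = f x := by
  obtain ⟨μ, M, hμ, hM, hms⟩ := massive_solver h0 h1 hlam hΩ hchart (fun x _ => hsym x) hell ha hb hc
  obtain ⟨B, hB, hbB⟩ := IsHB.exists_common hb
  have hell0 : ∀ x ∈ Ω, ∀ ξ : Fin n → ℝ, 0 ≤ ∑ i, ∑ j, a x i j * ξ i * ξ j := fun x hx ξ =>
    (mul_nonneg hlam.le (Finset.sum_nonneg fun i _ => sq_nonneg _)).trans
      (hell x (subset_closure hx) ξ)
  obtain ⟨q, Q', hq, hq1, hqQ', hLq⟩ := exists_barrier hΩ hlam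
    (fun x hx => hell x (subset_closure hx)) (fun x hx i => (hbB i).bd x (subset_closure hx)) hc0
  set Q := max Q' 1 with hQdef
  have hQ : 0 < Q := lt_max_of_lt_right one_pos
  have hqQ : ∀ x ∈ closure Ω, q x ≤ Q := fun x hx => (hqQ' x hx).trans (le_max_left _ _)
  obtain ⟨δ, hδ, hδ1, hscale⟩ := exists_holder_scale (α := α) (L := μ * M * (Q + 1)) h1 hQ
    (by positivity)
  set ρ := μ / (μ + 1 / Q) with hρ
  have hμ0 : 0 < μ := by linarith
  have hd : 0 < μ + 1 / Q := by positivity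
  have hρ0 : 0 ≤ ρ := by positivity
  have hρ1 : ρ < 1 := by
    rw [hρ, div_lt_one hd]
    have : 0 < 1 / Q := by positivity
    linarith
  set θ := max ρ (1 / 2) with hθ
  let P : (𝔼 → ℝ) → ℝ → Prop := fun f A => (∀ x ∈ closure Ω, |f x| ≤ A * q x) ∧
    ∀ x ∈ closure Ω, ∀ y ∈ closure Ω, |f x - f y| ≤ A / δ * ‖x - y‖ ^ α
  have hsolve : ∀ (f : 𝔼 → ℝ) (A : ℝ), 0 ≤ A → P f A → ∃ u : 𝔼 → ℝ,
      C2B α u (M * (Q + 1 / δ) * A) (M * (Q + 1 / δ) * A) (M * (Q + 1 / δ) * A)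
        (M * (Q + 1 / δ) * A) ∧ (∀ x ∈ frontier Ω, u x = 0) ∧
      P (fun x => f x - Lop (fun x i j => -a x i j) (fun x i => -b x i) (fun x => 0 - c x) u x)
        (θ * A) := by
    intro f A hA hf
    have hfH : HB α (closure Ω) f (A * (Q + 1 / δ)) (A * (Q + 1 / δ)) := by
      refine HB.mono (A := A * Q) (B := A / δ) ⟨fun x hx => (hf.1 x hx).trans ?_, hf.2⟩ ?_ ?_
      · have := hqQ x hx; gcongr
      · have : 0 ≤ 1 / δ := by positivity
        nlinarith
      · rw [div_eq_mul_one_div]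
        gcongr
        linarith
    obtain ⟨u, hu1, hu2, hu3⟩ := hms f _ (by positivity) hfH
    have huc := hu1.contDiff
    have up : ∀ x ∈ closure Ω, u x ≤ A / (μ + 1 / Q) * q x :=
      le_barrier hΩo hΩ hsym hell0 hc0 hq hq1 hqQ hLq huc.continuous.continuousOn
        (fun x _ => huc.contDiffAt) hu2 hμ0.le hA hQ fun x hx => by
          rw [hu3 x (subset_closure hx)]
          exact (le_abs_self _).trans (hf.1 x (subset_closure hx))
    have dn : ∀ x ∈ closure Ω, (-1) * u x ≤ A / (μ + 1 / Q) * q x :=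
      le_barrier (u := fun x => (-1) * u x) hΩo hΩ hsym hell0 hc0 hq hq1 hqQ hLq
        (continuous_const.mul huc.continuous).continuousOn
        (fun x _ => (contDiff_const.mul huc).contDiffAt) (fun x hx => by rw [hu2 x hx, mul_zero])
        hμ0.le hA hQ fun x hx => by
          have h2 := hu3 x (subset_closure hx)
          have h3 := (neg_le_abs _).trans (hf.1 x (subset_closure hx))
          rw [Lop_smul huc.contDiffAt]
          linarith
    have res : ∀ x ∈ closure Ω, f x - Lop (fun x i j => -a x i j) (fun x i => -b x i)
        (fun x => 0 - c x) u x = μ * u x := fun x hx => by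
      rw [Lop_massive, ← hu3 x hx]; ring
    have bd : ∀ x ∈ closure Ω, |μ * u x| ≤ ρ * A * q x := fun x hx => by
      have e : ρ * A * q x = μ * (A / (μ + 1 / Q) * q x) := by rw [hρ]; ring
      rw [abs_mul, abs_of_pos hμ0, e]
      gcongr
      exact abs_le.2 ⟨by linarith [dn x hx], up x hx⟩
    refine ⟨u, ?_, hu2, fun x hx => ?_, fun x hx y hy => ?_⟩
    · have e : M * (Q + 1 / δ) * A = M * (A * (Q + 1 / δ)) := by ring
      rwa [e]
    · show |f x - _| ≤ _
      rw [res x hx]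
      refine (bd x hx).trans ?_
      have := hq1 x hx
      have : ρ ≤ θ := le_max_left _ _
      gcongr
    · show |(f x - _) - (f y - _)| ≤ _
      rw [res x hx, res y hy]
      have hb2 : ∀ z ∈ closure Ω, |μ * u z| ≤ A * Q := fun z hz => by
        refine (bd z hz).trans ?_
        have k1 := hq1 z hz
        have k2 := hqQ z hz
        have : ρ * A ≤ A := mul_le_of_le_one_left hA hρ1.le
        gcongr
      have hlip : |μ * u x - μ * u y| ≤ A * (μ * M * (Q + 1) / δ * ‖x - y‖) := by
        rw [← mul_sub, abs_mul, abs_of_pos hμ0]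
        refine (mul_le_mul_of_nonneg_left (hu1.lipschitz x y) hμ0.le).trans ?_
        have k : Q + 1 / δ ≤ (Q + 1) / δ := by
          rw [add_div]
          gcongr
          exact le_div_self hQ.le hδ hδ1
        calc μ * (M * (A * (Q + 1 / δ)) * ‖x - y‖) = A * (μ * M * ‖x - y‖) * (Q + 1 / δ) := by ring
          _ ≤ A * (μ * M * ‖x - y‖) * ((Q + 1) / δ) := by gcongr
          _ = _ := by ring
      rcases hA.eq_or_lt with hA0 | hA0
      · rw [← hA0] at hlip ⊢
        simpa using hlip
      · have h2 := hscale ‖x - y‖ (|μ * u x - μ * u y| / A) (norm_nonneg _)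
          (by
            rw [div_le_iff₀ hA0]
            have := abs_sub (μ * u x) (μ * u y)
            linarith [hb2 x hx, hb2 y hy])
          (by rw [div_le_iff₀ hA0]; linarith) h0
        rw [div_le_iff₀ hA0] at h2
        refine h2.trans ?_
        have : (1 / 2 : ℝ) ≤ θ := le_max_right _ _
        have h4 : 0 ≤ ‖x - y‖ ^ α := by positivity
        calc 1 / (2 * δ) * ‖x - y‖ ^ α * A = 1 / 2 * A / δ * ‖x - y‖ ^ α := by field_simp
          _ ≤ _ := by gcongr
  obtain ⟨k, hk, hfk⟩ := hf
  have hP : P (fun x => -f x) k := by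
    refine ⟨fun x hx => ?_, fun x hx y hy => ?_⟩
    · rw [abs_neg]
      exact (hfk.bd x hx).trans (le_mul_of_one_le_right hk (hq1 x hx))
    · rw [neg_sub_neg, abs_sub_comm]
      refine (hfk.hd x hx y hy).trans ?_
      gcongr
      exact le_div_self hk hδ hδ1
  obtain ⟨u, hu1, hu2, hu3⟩ := neumann_series (C₂ := Q) (f := fun x => -f x) (A := k) h0
    (hρ0.trans (le_max_left _ _)) (max_lt hρ1 (by norm_num)) hsolve (fun f A hf x hx => by
      have h2 := hf.1 x hx
      have h3 := hq1 x hx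
      have hA : 0 ≤ A := by
        by_contra! hA
        have := (abs_nonneg _).trans h2
        nlinarith
      rw [mul_comm]
      have := hqQ x hx
      exact h2.trans (by gcongr)) hk hP
  refine ⟨u, _, hu1, hu2, fun x hx => ?_⟩
  have := hu3 x hx
  rw [Lop_massive] at this
  linarith

end SecondNeumann

section LocalParam

set_option linter.unusedSectionVars false

variable {n : ℕ} [NeZero n] {α : ℝ}

local notation "𝔼" => EuclideanSpace ℝ (Fin n)

/-- A parametrization of a neighbourhood of `x` in `K` by a convex set with nonempty interior. -/
structure LocalParam (K : Set (EuclideanSpace ℝ (Fin n))) (x : EuclideanSpace ℝ (Fin n))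
    (ψ g : EuclideanSpace ℝ (Fin n) → EuclideanSpace ℝ (Fin n))
    (W : Set (EuclideanSpace ℝ (Fin n))) : Prop where
  convex : Convex ℝ W
  interior : (interior W).Nonempty
  mem : ψ x ∈ W
  contDiffAt : ContDiffAt ℝ 2 ψ x
  contDiffAt_inv : ContDiffAt ℝ 2 g (ψ x)
  surj : Function.Surjective (fderiv ℝ g (ψ x))
  mapsTo : MapsTo g W K
  inv : ∀ᶠ y in 𝓝[K] x, ψ y ∈ W ∧ g (ψ y) = y

theorem exists_localParam_interior {Ω : Set 𝔼} (hΩ : IsOpen Ω) {x : 𝔼} (hx : x ∈ Ω) :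
    ∃ ψ g W, LocalParam (closure Ω) x ψ g W := by
  obtain ⟨r, hr, hb⟩ := Metric.isOpen_iff.1 hΩ x hx
  refine ⟨id, id, Metric.ball x r, convex_ball _ _, ?_, Metric.mem_ball_self hr,
    contDiffAt_id, contDiffAt_id, ?_, fun y hy => subset_closure (hb hy), ?_⟩
  · rw [Metric.isOpen_ball.interior_eq]; exact ⟨x, Metric.mem_ball_self hr⟩
  · rw [fderiv_id]; exact fun v => ⟨v, rfl⟩
  · exact mem_nhdsWithin_of_mem_nhds (by
      filter_upwards [Metric.ball_mem_nhds x hr] with y hy using ⟨hy, rfl⟩)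

theorem exists_localParam_boundary {Ω : Set 𝔼} (hΩ : IsOpen Ω) {x : 𝔼} {B D : Set 𝔼}
    {ψ ψinv : 𝔼 → 𝔼} (hB : IsOpen B) (hx : x ∈ B) (hxf : x ∈ frontier Ω)
    (hbij : BijOn ψ B D) (hinv : InvOn ψinv ψ B D)
    (hpos : ψ '' (B ∩ Ω) ⊆ {x | 0 < x 0}) (hzero : ψ '' (B ∩ frontier Ω) ⊆ {x | x 0 = 0})
    (hψ : ContDiffOn ℝ 2 ψ B) (hψinv : ContDiffOn ℝ 2 ψinv D) :
    ∃ W, LocalParam (closure Ω) x ψ ψinv W := by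
  have hBx := hB.mem_nhds hx
  have hcx : ContDiffAt ℝ 2 ψ x := hψ.contDiffAt hBx
  obtain ⟨L, G, hL, hGL⟩ := exists_strict_left_inverse hB hx hbij hinv hψ hψinv
  have hinj : Function.Injective L := Function.LeftInverse.injective hGL
  have hsurj : Function.Surjective L := (LinearMap.injective_iff_surjective (f := L.toLinearMap)).1 hinj
  have hDn : D ∈ 𝓝 (ψ x) := by
    rw [← hL.map_nhds_eq_of_surj (LinearMap.range_eq_top.2 hsurj)]
    exact mem_map.2 (mem_of_superset hBx hbij.mapsTo)
  obtain ⟨ρ, hρ, hρD⟩ := Metric.mem_nhds_iff.1 hDn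
  have hy0 : ψ x 0 = 0 := hzero ⟨x, ⟨hx, hxf⟩, rfl⟩
  have hc0 : Continuous fun y : 𝔼 => y 0 := (EuclideanSpace.proj (𝕜 := ℝ) (0 : Fin n)).continuous
  set W₀ : Set 𝔼 := Metric.ball (ψ x) ρ ∩ {y | 0 < y 0} with hW₀
  set W : Set 𝔼 := Metric.ball (ψ x) ρ ∩ {y | 0 ≤ y 0} with hW
  have hlin : IsLinearMap ℝ fun y : 𝔼 => y 0 := ⟨fun _ _ => rfl, fun _ _ => rfl⟩
  have hconv : Convex ℝ W := (convex_ball _ _).inter (convex_halfSpace_ge hlin 0)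
  have hconv₀ : Convex ℝ W₀ := (convex_ball _ _).inter (convex_halfSpace_gt hlin 0)
  have hopen₀ : IsOpen W₀ := Metric.isOpen_ball.inter (isOpen_lt continuous_const hc0)
  have hgat : ∀ y ∈ Metric.ball (ψ x) ρ, ContDiffAt ℝ 2 ψinv y := fun y hy =>
    hψinv.contDiffAt (mem_of_superset (Metric.isOpen_ball.mem_nhds hy) hρD)
  have hgB : ∀ y ∈ D, ψinv y ∈ B := fun y hy => by
    obtain ⟨z, hz, rfl⟩ := hbij.surjOn hy
    rwa [hinv.1 hz]
  -- points of `Ω` near `x` are mapped into the half ball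
  have hev : ∀ᶠ y in 𝓝 x, y ∈ B ∧ ψ y ∈ Metric.ball (ψ x) ρ :=
    (show ∀ᶠ y in 𝓝 x, y ∈ B from hBx).and
      (hcx.continuousAt.eventually (Metric.ball_mem_nhds _ hρ))
  obtain ⟨p, ⟨hpB, hpb⟩, hpΩ⟩ := mem_closure_iff_nhds.1 (frontier_subset_closure hxf) _ hev
  have hpW : ψ p ∈ W₀ := ⟨hpb, hpos ⟨p, ⟨hpB, hpΩ⟩, rfl⟩⟩
  have hne : (ψinv '' W₀ ∩ Ω).Nonempty := ⟨p, ⟨ψ p, hpW, hinv.1 hpB⟩, hpΩ⟩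
  have himg : ψinv '' W₀ ⊆ Ω := by
    refine IsPreconnected.subset_left_of_subset_union (v := (closure Ω)ᶜ) hΩ
      isClosed_closure.isOpen_compl (disjoint_compl_right.mono_left subset_closure) ?_
      hne ?_
    · rintro _ ⟨y, hy, rfl⟩
      by_contra hcon
      rw [mem_union, not_or, notMem_compl_iff] at hcon
      have hf : ψinv y ∈ frontier Ω := by rw [hΩ.frontier_eq]; exact ⟨hcon.2, hcon.1⟩
      have h1 : ψ (ψinv y) 0 = 0 := hzero ⟨_, ⟨hgB y (hρD hy.1), hf⟩, rfl⟩
      rw [hinv.2 (hρD hy.1)] at h1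
      exact hy.2.ne' h1
    · exact hconv₀.isPreconnected.image _
        fun y hy => (hgat y hy.1).continuousAt.continuousWithinAt
  have hcl : ∀ y ∈ W, y ∈ closure W₀ := by
    intro y hy
    have ht : Tendsto (fun t : ℝ => y + t • stdE (0 : Fin n)) (𝓝[>] 0) (𝓝 y) := by
      have : Continuous fun t : ℝ => y + t • stdE (0 : Fin n) := by fun_prop
      have h := this.tendsto 0
      simp only [zero_smul, add_zero] at h
      exact h.mono_left nhdsWithin_le_nhds
    refine mem_closure_of_tendsto ht ?_
    filter_upwards [ht (Metric.isOpen_ball.mem_nhds hy.1), self_mem_nhdsWithin] with t h1 h2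
    refine ⟨h1, ?_⟩
    have h3 : 0 ≤ y 0 := hy.2
    have h4 : (0 : ℝ) < t := h2
    simp
    linarith
  refine ⟨W, hconv, ⟨ψ p, ?_⟩, ⟨Metric.mem_ball_self hρ, hy0.ge⟩, hcx,
    hgat _ (Metric.mem_ball_self hρ), ?_, fun y hy => ?_, ?_⟩
  · exact interior_maximal (show W₀ ⊆ W from fun y hy => ⟨hy.1, le_of_lt (show 0 < y 0 from hy.2)⟩) hopen₀ hpW
  · have hgx := ((hgat _ (Metric.mem_ball_self hρ)).differentiableAt two_ne_zero).hasFDerivAt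
    have h1 := hgx.comp x hL.hasFDerivAt
    have h2 : ψinv ∘ ψ =ᶠ[𝓝 x] id := by
      filter_upwards [hBx] with y hy using hinv.1 hy
    have h3 := (h1.congr_of_eventuallyEq h2.symm).unique (hasFDerivAt_id x)
    exact fun v => ⟨L v, congrArg (fun T : 𝔼 →L[ℝ] 𝔼 => T v) h3⟩
  · refine closure_mono himg ?_
    exact (hgat y hy.1).continuousAt.continuousWithinAt.mem_closure_image (hcl y hy)
  · filter_upwards [mem_nhdsWithin_of_mem_nhds hev, self_mem_nhdsWithin] with y hy hyc
    refine ⟨⟨hy.2, ?_⟩, hinv.1 hy.1⟩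
    rw [closure_eq_self_union_frontier] at hyc
    rcases hyc with h | h
    · exact (show 0 < ψ y 0 from hpos ⟨y, ⟨hy.1, h⟩, rfl⟩).le
    · exact (show ψ y 0 = 0 from hzero ⟨y, ⟨hy.1, h⟩, rfl⟩).ge

theorem LocalParam.image_eq {K : Set 𝔼} {x : 𝔼} {ψ g : 𝔼 → 𝔼} {W : Set 𝔼}
    (h : LocalParam K x ψ g W) (hx : x ∈ K) : g (ψ x) = x :=
  (h.inv.self_of_nhdsWithin hx).2

theorem uniqueDiffOn_of_localParam {K : Set 𝔼} (h : ∀ x ∈ K, ∃ ψ g W, LocalParam K x ψ g W) :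
    UniqueDiffOn ℝ K := by
  intro x hx
  obtain ⟨ψ, g, W, hP⟩ := h x hx
  have h1 := uniqueDiffWithinAt_convex hP.convex hP.interior (subset_closure hP.mem)
  have h2 := (hP.contDiffAt_inv.differentiableAt two_ne_zero).hasFDerivAt.hasFDerivWithinAt (s := W)
  have h3 := h2.uniqueDiffWithinAt h1 hP.surj.denseRange
  rw [hP.image_eq hx] at h3
  exact h3.mono hP.mapsTo.image_subset

theorem locallyLipschitzOn_of_localParam {F : Type*} [NormedAddCommGroup F] [NormedSpace ℝ F]
    {K : Set 𝔼} (h : ∀ x ∈ K, ∃ ψ g W, LocalParam K x ψ g W) {f : 𝔼 → F}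
    (hf : ContDiffOn ℝ 1 f K) : LocallyLipschitzOn K f := by
  intro x hx
  obtain ⟨ψ, g, W, hP⟩ := h x hx
  have h1 : ContDiffWithinAt ℝ 1 (f ∘ g) W (ψ x) := by
    refine ContDiffWithinAt.comp (ψ x) ?_
      (hP.contDiffAt_inv.of_le one_le_two).contDiffWithinAt hP.mapsTo
    rw [hP.image_eq hx]
    exact hf x hx
  obtain ⟨C, t, ht, hC⟩ := h1.exists_lipschitzOnWith hP.convex
  obtain ⟨C', t', ht', hC'⟩ := (hP.contDiffAt.of_le one_le_two).exists_lipschitzOnWith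
  have hcont : Tendsto ψ (𝓝[K] x) (𝓝[W] (ψ x)) :=
    tendsto_nhdsWithin_iff.2 ⟨hP.contDiffAt.continuousAt.tendsto.mono_left nhdsWithin_le_nhds,
      hP.inv.mono fun _ h => h.1⟩
  have hmem : {y | (ψ y ∈ W ∧ g (ψ y) = y) ∧ ψ y ∈ t ∧ y ∈ t'} ∈ 𝓝[K] x :=
    inter_mem hP.inv (inter_mem (hcont ht) (mem_nhdsWithin_of_mem_nhds ht'))
  refine ⟨C * C', _, hmem, ?_⟩
  have h2 : LipschitzOnWith (C * C') ((f ∘ g) ∘ ψ)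
      {y | (ψ y ∈ W ∧ g (ψ y) = y) ∧ ψ y ∈ t ∧ y ∈ t'} :=
    hC.comp (hC'.mono fun y hy => hy.2.2) fun y hy => hy.2.1
  intro y hy z hz
  have h3 := h2 hy hz
  simpa [hy.1.2, hz.1.2] using h3

theorem isHB_of_contDiffOn_one (h0 : 0 < α) (h1 : α < 1) {K : Set 𝔼} (hK : IsCompact K)
    (h : ∀ x ∈ K, ∃ ψ g W, LocalParam K x ψ g W) {f : 𝔼 → ℝ} (hf : ContDiffOn ℝ 1 f K) :
    IsHB α K f := by
  obtain ⟨L, hL⟩ := (locallyLipschitzOn_of_localParam h hf).exists_lipschitzOnWith_of_compact hK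
  obtain ⟨A, hA⟩ := hK.exists_bound_of_continuousOn hf.continuousOn
  refine (HB.of_lipschitz h0 h1 (L := L) L.coe_nonneg hA fun x hx y hy => ?_).isHB
  rw [← dist_eq_norm, ← dist_eq_norm]
  exact hL.dist_le_mul x hx y hy

end LocalParam

section Assembly

set_option linter.unusedSectionVars false

variable {n : ℕ} {α : ℝ}

local notation "𝔼" => EuclideanSpace ℝ (Fin n)

theorem isHB_of_memCkα_zero {K : Set 𝔼} (hK : IsCompact K) {f : 𝔼 → ℝ} (hf : MemCkα 0 α K f) :
    IsHB α K f := by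
  obtain ⟨hc, M, hM⟩ := hf
  obtain ⟨A, hA⟩ := hK.exists_bound_of_continuousOn hc.continuousOn
  refine HB.isHB (A := A) (B := M) ⟨hA, fun x hx y hy => ?_⟩
  have h := hM x hx y hy
  rwa [← dist_eq_norm, dist_iteratedFDerivWithin_zero, dist_eq_norm, dist_eq_norm] at h

theorem isHB_fderivWithin_fderivWithin {K : Set 𝔼} (hK : IsCompact K) (hu : UniqueDiffOn ℝ K)
    {f : 𝔼 → ℝ} (hf : MemCkα 2 α K f) (i j : Fin n) :
    IsHB α K fun x => fderivWithin ℝ (fderivWithin ℝ f K) K x (stdE i) (stdE j) := by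
  obtain ⟨hc, M, hM⟩ := hf
  have e : ∀ x ∈ K, fderivWithin ℝ (fderivWithin ℝ f K) K x (stdE i) (stdE j) =
      iteratedFDerivWithin ℝ 2 f K x ![stdE i, stdE j] := fun x hx =>
    (iteratedFDerivWithin_two_apply' f hu hx _ _).symm
  obtain ⟨A, hA⟩ := hK.exists_bound_of_continuousOn
    (hc.continuousOn_iteratedFDerivWithin (m := 2) le_rfl hu)
  refine IsHB.congr (f := fun x => iteratedFDerivWithin ℝ 2 f K x ![stdE i, stdE j]) ?_ e
  refine HB.isHB (A := A) (B := M) ⟨fun x hx => ?_, fun x hx y hy => ?_⟩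
  · refine ((iteratedFDerivWithin ℝ 2 f K x).le_opNorm _).trans ?_
    simpa [Fin.prod_univ_two] using hA x hx
  · have h := hM x hx y hy
    rw [dist_eq_norm] at h
    refine le_trans ?_ h
    rw [← _root_.sub_apply]
    refine ((iteratedFDerivWithin ℝ 2 f K x - iteratedFDerivWithin ℝ 2 f K y).le_opNorm _).trans ?_
    simp [Fin.prod_univ_two]

theorem C2B.memCkα_add {K : Set 𝔼} (hu : UniqueDiffOn ℝ K) {f w : 𝔼 → ℝ} (hf : MemCkα 2 α K f)
    {A₀ A₁ A₂ A₃ : ℝ} (hw : C2B α w A₀ A₁ A₂ A₃) : MemCkα 2 α K fun x => f x + w x := by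
  obtain ⟨hc, M, hM⟩ := hf
  refine ⟨hc.add hw.contDiff.contDiffOn, M + A₃, fun x hx y hy => ?_⟩
  have e : ∀ x ∈ K, iteratedFDerivWithin ℝ 2 (fun x => f x + w x) K x =
      iteratedFDerivWithin ℝ 2 f K x + iteratedFDeriv ℝ 2 w x := fun x hx => by
    rw [fun_iteratedFDerivWithin_add_apply (hc x hx) hw.contDiff.contDiffAt.contDiffWithinAt hu hx,
      iteratedFDerivWithin_eq_iteratedFDeriv hu hw.contDiff.contDiffAt hx]
  have h2 : ‖iteratedFDeriv ℝ 2 w x - iteratedFDeriv ℝ 2 w y‖ ≤ A₃ * dist x y ^ α := by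
    have h3 := hw.b3 x y
    rw [dist_eq_norm]
    refine ContinuousMultilinearMap.opNorm_le_bound ((norm_nonneg _).trans h3) fun m => ?_
    rw [_root_.sub_apply, iteratedFDeriv_two_apply, iteratedFDeriv_two_apply, Fin.prod_univ_two,
      ← _root_.sub_apply, ← _root_.sub_apply, ← mul_assoc]
    exact (ContinuousLinearMap.le_opNorm₂ _ _ _).trans (by gcongr)
  rw [e x hx, e y hy, add_sub_add_comm, add_mul]
  exact (norm_add_le _ _).trans (add_le_add (hM x hx y hy) h2)

theorem partialDeriv2_eq {u : 𝔼 → ℝ} {x : 𝔼} (hu : ContDiffAt ℝ 2 u x) (i j : Fin n) :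
    partialDeriv2 u x i j = fderiv ℝ (fderiv ℝ u) x (stdE i) (stdE j) := by
  have h := (ContinuousLinearMap.apply ℝ ℝ (stdE j)).hasFDerivAt.comp x
    (differentiableAt_fderiv hu).hasFDerivAt
  exact congrArg (fun T : 𝔼 →L[ℝ] ℝ => T (stdE i)) h.fderiv

theorem Lop_symmetrize {u : 𝔼 → ℝ} {x : 𝔼} (hu : ContDiffAt ℝ 2 u x)
    (a : 𝔼 → Fin n → Fin n → ℝ) (b : 𝔼 → Fin n → ℝ) (c : 𝔼 → ℝ) :
    (∑ i, ∑ j, a x i j * partialDeriv2 u x i j) + (∑ i, b x i * partialDeriv1 u x i) + c x * u x =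
      Lop (fun x i j => (a x i j + a x j i) / 2) b c u x := by
  have hs : ∀ i j, fderiv ℝ (fderiv ℝ u) x (stdE i) (stdE j) =
      fderiv ℝ (fderiv ℝ u) x (stdE j) (stdE i) := fun i j =>
    (hu.isSymmSndFDerivAt (by simp)) _ _
  have h1 : ∑ i, ∑ j, a x j i * fderiv ℝ (fderiv ℝ u) x (stdE i) (stdE j) =
      ∑ i, ∑ j, a x i j * fderiv ℝ (fderiv ℝ u) x (stdE i) (stdE j) := by
    rw [Finset.sum_comm]
    exact Finset.sum_congr rfl fun i _ => Finset.sum_congr rfl fun j _ => by rw [hs]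
  have h2 : ∑ i, ∑ j, (a x i j + a x j i) / 2 * fderiv ℝ (fderiv ℝ u) x (stdE i) (stdE j) =
      (∑ i, ∑ j, a x i j * fderiv ℝ (fderiv ℝ u) x (stdE i) (stdE j) +
        ∑ i, ∑ j, a x j i * fderiv ℝ (fderiv ℝ u) x (stdE i) (stdE j)) / 2 := by
    simp only [← Finset.sum_add_distrib, Finset.sum_div]
    exact Finset.sum_congr rfl fun i _ => Finset.sum_congr rfl fun j _ => by ring
  rw [Lop, h2, h1]
  simp only [partialDeriv2_eq hu]
  simp only [partialDeriv1]
  ring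

theorem sum_symmetrize (A : Fin n → Fin n → ℝ) (ξ : Fin n → ℝ) :
    ∑ i, ∑ j, (A i j + A j i) / 2 * ξ i * ξ j = ∑ i, ∑ j, A i j * ξ i * ξ j := by
  have h1 : ∑ i, ∑ j, A j i * ξ i * ξ j = ∑ i, ∑ j, A i j * ξ i * ξ j := by
    rw [Finset.sum_comm]
    exact Finset.sum_congr rfl fun i _ => Finset.sum_congr rfl fun j _ => by ring
  have h2 : ∑ i, ∑ j, (A i j + A j i) / 2 * ξ i * ξ j =
      (∑ i, ∑ j, A i j * ξ i * ξ j + ∑ i, ∑ j, A j i * ξ i * ξ j) / 2 := by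
    simp only [← Finset.sum_add_distrib, Finset.sum_div]
    exact Finset.sum_congr rfl fun i _ => Finset.sum_congr rfl fun j _ => by ring
  rw [h2, h1]
  ring

theorem ellipticity_closure {Ω : Set 𝔼} {lam : ℝ} {a : 𝔼 → Fin n → Fin n → ℝ}
    (ha : ∀ i j, ContinuousOn (fun x => a x i j) (closure Ω))
    (hell : ∀ x ∈ Ω, ∀ ξ : Fin n → ℝ, lam * ∑ i, ξ i ^ 2 ≤ ∑ i, ∑ j, a x i j * ξ i * ξ j) :
    ∀ x ∈ closure Ω, ∀ ξ : Fin n → ℝ,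
      lam * ∑ i, ξ i ^ 2 ≤ ∑ i, ∑ j, a x i j * ξ i * ξ j := fun _ hx ξ =>
  le_on_closure (f := fun _ : 𝔼 => lam * ∑ i, ξ i ^ 2)
    (g := fun x => ∑ i, ∑ j, a x i j * ξ i * ξ j) (fun y hy => hell y hy ξ) continuousOn_const
    (continuousOn_finsetSum _ fun i _ => continuousOn_finsetSum _ fun j _ =>
      ((ha i j).mul continuousOn_const).mul continuousOn_const) hx

variable [NeZero n]

/-- Uniqueness for the Dirichlet problem. -/
theorem eq_zero_of_Lop_eq_zero {Ω : Set 𝔼} (hΩ : IsOpen Ω) (hb : Bornology.IsBounded Ω) {lam : ℝ}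
    (hlam : 0 < lam) {a : 𝔼 → Fin n → Fin n → ℝ} {b : 𝔼 → Fin n → ℝ} {c : 𝔼 → ℝ}
    (hs : ∀ x i j, a x i j = a x j i)
    (ha : ∀ x ∈ Ω, ∀ ξ : Fin n → ℝ, lam * ∑ i, ξ i ^ 2 ≤ ∑ i, ∑ j, a x i j * ξ i * ξ j)
    {B : ℝ} (hB : ∀ x ∈ Ω, ∀ i, |b x i| ≤ B) (hc : ∀ x ∈ Ω, c x ≤ 0) {u : 𝔼 → ℝ}
    (huc : ContinuousOn u (closure Ω)) (hu : ∀ x ∈ Ω, ContDiffAt ℝ 2 u x)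
    (hu0 : ∀ x ∈ frontier Ω, u x = 0) (hLu : ∀ x ∈ Ω, Lop a b c u x = 0) :
    ∀ x ∈ closure Ω, u x = 0 := by
  obtain ⟨q, Q, hq, hq1, hqQ, hLq⟩ := exists_barrier hb hlam ha hB hc
  intro x hx
  have hQ : 0 < Q := by linarith [hq1 x hx, hqQ x hx]
  have ha' : ∀ x ∈ Ω, ∀ ξ : Fin n → ℝ, 0 ≤ ∑ i, ∑ j, a x i j * ξ i * ξ j := fun y hy ξ =>
    le_trans (by positivity) (ha y hy ξ)
  have h1 := le_barrier hΩ hb hs ha' hc hq hq1 hqQ hLq huc hu hu0 le_rfl le_rfl hQ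
    (fun y hy => by simp [hLu y hy]) x hx
  have h2 := le_barrier (u := fun x => (-1) * u x) hΩ hb hs ha' hc hq hq1 hqQ hLq
    (continuousOn_const.mul huc) (fun y hy => contDiffAt_const.mul (hu y hy))
    (fun y hy => by simp [hu0 y hy]) le_rfl le_rfl hQ
    (fun y hy => by rw [Lop_smul (hu y hy), hLu y hy]; simp) x hx
  simp only [zero_div, zero_mul] at h1 h2
  linarith

end Assembly

section Assembly

set_option linter.unusedSectionVars false

variable {n : ℕ} {α : ℝ}

local notation "𝔼" => EuclideanSpace ℝ (Fin n)

variable [NeZero n]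

theorem exists_chart_of_isC2αDomain {Ω : Set 𝔼} (hΩo : IsOpen Ω)
    (hΩ : IsC2αDomain α Ω) : ∀ x ∈ closure Ω, ∃ r C ψ, 0 < r ∧ Chart α Ω x r C ψ := by
  intro x hx
  rw [closure_eq_self_union_frontier] at hx
  rcases hx with hx | hx
  · exact exists_chart_interior hΩo hx
  · obtain ⟨B, D, ψ, ψinv, hB, hxB, hbij, hinv, hpos, hzero, ⟨hψ, M, hM⟩, hψinv, -⟩ := hΩ.2 x hx
    obtain ⟨r, C, hr, h⟩ := exists_chart_boundary hB hxB hbij hinv hpos hzero hψ hM hψinv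
    exact ⟨r, C, ψ, hr, h⟩

theorem exists_localParam_of_isC2αDomain {Ω : Set 𝔼} (hΩo : IsOpen Ω) (hΩ : IsC2αDomain α Ω) :
    ∀ x ∈ closure Ω, ∃ ψ g W, LocalParam (closure Ω) x ψ g W := by
  intro x hx
  rw [closure_eq_self_union_frontier] at hx
  rcases hx with hx | hx
  · exact exists_localParam_interior hΩo hx
  · obtain ⟨B, D, ψ, ψinv, hB, hxB, hbij, hinv, hpos, hzero, hψ, hψinv⟩ := hΩ.2 x hx
    obtain ⟨W, h⟩ := exists_localParam_boundary hΩo hB hxB hx hbij hinv hpos hzero hψ.1 hψinv.1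
    exact ⟨ψ, ψinv, W, h⟩

/-- The value of `L φ` in `Ω` extends to a Hölder continuous function on the closure. -/
theorem exists_isHB_eq_Lop (h0 : 0 < α) (h1 : α < 1) {Ω : Set 𝔼} (hΩo : IsOpen Ω)
    (hΩ : IsC2αDomain α Ω) {a : 𝔼 → Fin n → Fin n → ℝ} {b : 𝔼 → Fin n → ℝ} {c : 𝔼 → ℝ}
    (ha : ∀ i j, IsHB α (closure Ω) fun x => a x i j)
    (hb : ∀ i, IsHB α (closure Ω) fun x => b x i) (hc : IsHB α (closure Ω) c) {φ : 𝔼 → ℝ}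
    (hφ : MemCkα 2 α (closure Ω) φ) :
    ∃ g, IsHB α (closure Ω) g ∧ ∀ x ∈ Ω, Lop a b c φ x = g x := by
  have hK := hΩ.1.isCompact_closure
  have hP := exists_localParam_of_isC2αDomain hΩo hΩ
  have hu := uniqueDiffOn_of_localParam hP
  set K := closure Ω
  have hφ1 : ContDiffOn ℝ 1 (fderivWithin ℝ φ K) K := hφ.1.fderivWithin hu (by norm_num)
  refine ⟨fun x => ∑ i, ∑ j, a x i j * fderivWithin ℝ (fderivWithin ℝ φ K) K x (stdE i) (stdE j) +
    ∑ i, b x i * fderivWithin ℝ φ K x (stdE i) + c x * φ x, ?_, fun x hx => ?_⟩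
  · refine ((IsHB.sum _ fun i _ => IsHB.sum _ fun j _ => (ha i j).mul
      (isHB_fderivWithin_fderivWithin hK hu hφ i j)).add (IsHB.sum _ fun i _ => (hb i).mul
      (isHB_of_contDiffOn_one h0 h1 hK hP ?_))).add
      (hc.mul (isHB_of_contDiffOn_one h0 h1 hK hP (hφ.1.of_le one_le_two)))
    exact hφ1.clm_apply contDiffOn_const
  · have hKx : ∀ y ∈ Ω, K ∈ 𝓝 y := fun y hy => mem_of_superset (hΩo.mem_nhds hy) subset_closure
    have e1 : fderivWithin ℝ φ K =ᶠ[𝓝 x] fderiv ℝ φ := by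
      filter_upwards [hΩo.mem_nhds hx] with y hy using fderivWithin_of_mem_nhds (hKx y hy)
    simp only [Lop, fderivWithin_of_mem_nhds (hKx x hx), e1.fderiv_eq (𝕜 := ℝ)]

end Assembly

end Schauder

/-- **Schauder existence theorem.**  Let `Ω ⊆ ℝⁿ` be a bounded domain of class `C^{2,α}`
(`0 < α < 1`).  Suppose `aᵢⱼ, bᵢ, c, f ∈ C^{0,α}(Ω̄)`, the ellipticity condition
`Σᵢⱼ aᵢⱼ(x) ξᵢ ξⱼ ≥ λ |ξ|²` (`λ > 0`) holds, the `bᵢ` are bounded, and `c ≤ 0` on `Ω`.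
Then for every `φ ∈ C^{2,α}(Ω̄)` there exists a unique `u ∈ C^{2,α}(Ω̄)` with
`L u = Σᵢⱼ aᵢⱼ ∂ᵢⱼ u + Σᵢ bᵢ ∂ᵢ u + c u = f` in `Ω` and `u = φ` on `∂Ω`
(uniqueness as functions on `Ω̄`). -/
theorem schauder_existence {n : ℕ} [NeZero n]
    (α : ℝ) (hα₀ : 0 < α) (hα₁ : α < 1)
    (Ω : Set (EuclideanSpace ℝ (Fin n))) (hΩo : IsOpen Ω) (hΩreg : IsC2αDomain α Ω)
    (lam : ℝ) (hlam : 0 < lam)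
    (a : EuclideanSpace ℝ (Fin n) → Fin n → Fin n → ℝ)
    (b : EuclideanSpace ℝ (Fin n) → Fin n → ℝ)
    (c f : EuclideanSpace ℝ (Fin n) → ℝ)
    (ha : ∀ i j, MemCkα 0 α (closure Ω) (fun x => a x i j))
    (hbreg : ∀ i, MemCkα 0 α (closure Ω) (fun x => b x i))
    (hcreg : MemCkα 0 α (closure Ω) c)
    (hfreg : MemCkα 0 α (closure Ω) f)
    (hell : ∀ x ∈ Ω, ∀ ξ : Fin n → ℝ, lam * ∑ i, ξ i ^ 2 ≤ ∑ i, ∑ j, a x i j * ξ i * ξ j)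
    (hbbd : ∃ B : ℝ, ∀ x ∈ Ω, ∀ i, |b x i| ≤ B)
    (hc : ∀ x ∈ Ω, c x ≤ 0)
    (φ : EuclideanSpace ℝ (Fin n) → ℝ) (hφ : MemCkα 2 α (closure Ω) φ) :
    ∃ u : EuclideanSpace ℝ (Fin n) → ℝ,
      (MemCkα 2 α (closure Ω) u ∧
        (∀ x ∈ Ω,
          (∑ i, ∑ j, a x i j * partialDeriv2 u x i j)
            + (∑ i, b x i * partialDeriv1 u x i) + c x * u x = f x) ∧
        (∀ x ∈ frontier Ω, u x = φ x)) ∧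
      ∀ v : EuclideanSpace ℝ (Fin n) → ℝ,
        (MemCkα 2 α (closure Ω) v ∧
          (∀ x ∈ Ω,
            (∑ i, ∑ j, a x i j * partialDeriv2 v x i j)
              + (∑ i, b x i * partialDeriv1 v x i) + c x * v x = f x) ∧
          (∀ x ∈ frontier Ω, v x = φ x)) →
        ∀ x ∈ closure Ω, v x = u x := by
  have hK := hΩreg.1.isCompact_closure
  have hu := Schauder.uniqueDiffOn_of_localParam
    (Schauder.exists_localParam_of_isC2αDomain hΩo hΩreg)
  have hsym : ∀ x i j, (a x i j + a x j i) / 2 = (a x j i + a x i j) / 2 := fun x i j => by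
    rw [add_comm]
  have hell' : ∀ x ∈ closure Ω, ∀ ξ : Fin n → ℝ,
      lam * ∑ i, ξ i ^ 2 ≤ ∑ i, ∑ j, (a x i j + a x j i) / 2 * ξ i * ξ j := fun x hx ξ => by
    rw [Schauder.sum_symmetrize]
    exact Schauder.ellipticity_closure (fun i j => (ha i j).1.continuousOn) hell x hx ξ
  have ha' : ∀ i j, Schauder.IsHB α (closure Ω) fun x => (a x i j + a x j i) / 2 := fun i j => by
    simp only [div_eq_mul_inv]
    exact ((Schauder.isHB_of_memCkα_zero hK (ha i j)).add
      (Schauder.isHB_of_memCkα_zero hK (ha j i))).mul (Schauder.IsHB.const _)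
  have hb' := fun i => Schauder.isHB_of_memCkα_zero hK (hbreg i)
  have hc' := Schauder.isHB_of_memCkα_zero hK hcreg
  have hat : ∀ {v : EuclideanSpace ℝ (Fin n) → ℝ}, MemCkα 2 α (closure Ω) v → ∀ x ∈ Ω,
      ContDiffAt ℝ 2 v x := fun hv x hx =>
    hv.1.contDiffAt (Filter.mem_of_superset (hΩo.mem_nhds hx) subset_closure)
  obtain ⟨g, hg, hgφ⟩ := Schauder.exists_isHB_eq_Lop hα₀ hα₁ hΩo hΩreg ha' hb' hc' hφ
  obtain ⟨w, M, hw, hw0, hLw⟩ := Schauder.zero_boundary_solver hα₀ hα₁ hlam hΩo hΩreg.1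
    (Schauder.exists_chart_of_isC2αDomain hΩo hΩreg) hsym hell' ha' hb' hc' hc
    ((Schauder.isHB_of_memCkα_zero hK hfreg).sub hg)
  have hmem := hw.memCkα_add hu hφ
  have hLu : ∀ x ∈ Ω, Schauder.Lop (fun x i j => (a x i j + a x j i) / 2) b c
      (fun y => φ y + w y) x = f x := fun x hx => by
    rw [Schauder.Lop_add (hat hφ x hx) hw.contDiff.contDiffAt, hgφ x hx,
      hLw x (subset_closure hx), add_sub_cancel]
  refine ⟨fun x => φ x + w x, ⟨hmem, fun x hx => ?_, fun x hx => by simp [hw0 x hx]⟩, ?_⟩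
  · rw [← hLu x hx]
    exact Schauder.Lop_symmetrize (hat hmem x hx) a b c
  · rintro v ⟨hv, hLv, hvφ⟩ x hx
    obtain ⟨B, hB⟩ := hbbd
    have key := Schauder.eq_zero_of_Lop_eq_zero (u := fun x => v x + (-1) * (φ x + w x))
      hΩo hΩreg.1 hlam hsym (fun x hx => hell' x (subset_closure hx)) hB hc
      (hv.1.continuousOn.add (continuousOn_const.mul hmem.1.continuousOn))
      (fun y hy => (hat hv y hy).add (contDiffAt_const.mul (hat hmem y hy)))
      (fun y hy => by simp [hvφ y hy, hw0 y hy])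
      (fun y hy => by
        rw [Schauder.Lop_add (hat hv y hy) (contDiffAt_const.mul (hat hmem y hy)),
          Schauder.Lop_smul (hat hmem y hy), hLu y hy,
          ← Schauder.Lop_symmetrize (hat hv y hy) a b c, hLv y hy]
        ring) x hx
    linarith
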